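/- arXiv:math/0006031 — 2 statements merged into one kernel-verified Lean document; each statement's English description precedes it below -/
import Mathlib

section
/- Let R > 0 and let {E_h} be an equibounded sequence in 𝒰_R ⊆ ℝⁿ (E_h ⊆ B(0,M) for all h) converging in the sense of Kuratowski to a compact set E. Then E ∈ 𝒰_R, ∂E_h →K ∂E in the sense of Kuratowski, and the (n−1)-dimensional Hausdorff measures of the boundaries converge: H^{n−1}(∂E_h) → H^{n−1}(∂E) < ∞. -/
open Set Metric MeasureTheory Filter Topology ENNReal NNReal

noncomputable section

abbrev En (n : ℕ) := EuclideanSpace ℝ (Fin n)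

def sphereCond (n : ℕ) (R : ℝ) (E : Set (En n)) : Prop :=
  ∀ p ∈ frontier E, ∃ p' p'' : En n, dist p p' = R ∧ dist p p'' = R ∧
    ball p' R ⊆ E ∧ ball p'' R ∩ E = ∅

def UR (n : ℕ) (R : ℝ) : Set (Set (En n)) :=
  {E | IsClosed E ∧ Bornology.IsBounded E ∧ sphereCond n R E}

def KConv {X : Type*} [MetricSpace X] (F : ℕ → Set X) (F₀ : Set X) : Prop :=
  (∀ (p : X) (φ : ℕ → ℕ) (x : ℕ → X), StrictMono φ → (∀ k, x k ∈ F (φ k)) →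
    Tendsto x atTop (𝓝 p) → p ∈ F₀) ∧
  (∀ p ∈ F₀, ∃ x : ℕ → X, (∀ h, x h ∈ F h) ∧ Tendsto x atTop (𝓝 p))

theorem inter_frontier_nonempty_of_isPreconnected {X : Type*} [TopologicalSpace X] {C F : Set X}
    (hC : IsPreconnected C) (h : (C ∩ F).Nonempty) (h' : (C ∩ Fᶜ).Nonempty) :
    (C ∩ frontier F).Nonempty := by
  by_contra hne
  have hmem : ∀ z ∈ C, z ∈ closure F → z ∈ interior F := fun z hz hzF => by
    by_contra hzi
    exact hne ⟨z, hz, hzF, hzi⟩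
  obtain ⟨x, hx, hxF⟩ := h
  obtain ⟨y, hy, hyF⟩ := h'
  obtain ⟨z, -, hzi, hzc⟩ := hC (interior F) (closure F)ᶜ isOpen_interior
    isClosed_closure.isOpen_compl
    (fun z hz => or_iff_not_imp_right.2 fun hzc => hmem z hz (not_not.1 hzc))
    ⟨x, hx, hmem x hx (subset_closure hxF)⟩
    ⟨y, hy, fun hyc => hyF (interior_subset (hmem y hy hyc))⟩
  exact hzc (interior_subset_closure hzi)

theorem hausdorffMeasure_le_of_norm_sub_le {V W : Type*} [NormedAddCommGroup V] [MeasurableSpace V]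
    [BorelSpace V] [NormedAddCommGroup W] [MeasurableSpace W] [BorelSpace W]
    {A : Set V} {B : Set W} {f : V → W} {K : ℝ≥0} {d : ℝ} (hd : 0 ≤ d)
    (hf : MapsTo f A B) (hK : ∀ x ∈ A, ∀ y ∈ A, ‖x - y‖ ≤ K * ‖f x - f y‖) :
    μH[d] A ≤ (K : ℝ≥0∞) ^ d * μH[d] B := by
  have hanti : AntilipschitzWith K (fun x : A => f x) :=
    AntilipschitzWith.of_le_mul_dist fun x y => by
      simpa [Subtype.dist_eq, dist_eq_norm] using hK x x.2 y y.2
  have h := hanti.le_hausdorffMeasure_image hd univ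
  rw [← (isometry_subtype_coe (s := A)).hausdorffMeasure_image (Or.inl hd), image_univ,
    Subtype.range_coe] at h
  refine h.trans ?_
  gcongr
  rintro _ ⟨x, -, rfl⟩
  exact hf x.2

/-- `ν` is a unit vector along which the balls of radius `R` touching `p` lie, one inside `F` and
the opposite one outside `F`. -/
def IsBallNormal {V : Type*} [NormedAddCommGroup V] [InnerProductSpace ℝ V]
    (R : ℝ) (F : Set V) (p ν : V) : Prop :=
  ‖ν‖ = 1 ∧ ball (p + R • ν) R ⊆ F ∧ Disjoint (ball (p - R • ν) R) F

section InnerProduct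

variable {V : Type*} [NormedAddCommGroup V] [InnerProductSpace ℝ V] {R δ : ℝ} {F G : Set V}

theorem exists_isBallNormal_of_centers (hR : 0 < R) {p p' p'' : V} (h' : dist p p' = R)
    (h'' : dist p p'' = R) (hb' : ball p' R ⊆ F) (hb'' : ball p'' R ∩ F = ∅) :
    ∃ ν, IsBallNormal R F p ν := by
  have hdisj : Disjoint (ball p' R) (ball p'' R) :=
    (disjoint_iff_inter_eq_empty.2 hb'').symm.mono_left hb'
  have hd : R + R ≤ dist p' p'' := (disjoint_ball_ball_iff hR hR).1 hdisj
  have hsum : (p' - p) + (p'' - p) = 0 := by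
    have hpar := parallelogram_law_with_norm ℝ (p' - p) (p'' - p)
    rw [dist_comm, dist_eq_norm] at h' h''
    rw [dist_eq_norm] at hd
    rw [sub_sub_sub_cancel_right, h', h''] at hpar
    rw [← norm_le_zero_iff]
    nlinarith [norm_nonneg ((p' - p) + (p'' - p))]
  have hν : R • R⁻¹ • (p' - p) = p' - p := smul_inv_smul₀ hR.ne' _
  refine ⟨R⁻¹ • (p' - p), ?_, ?_, ?_⟩
  · rw [norm_smul, ← dist_eq_norm, dist_comm, h', norm_inv, Real.norm_of_nonneg hR.le,
      inv_mul_cancel₀ hR.ne']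
  · rwa [hν, add_sub_cancel]
  · have : p - (p' - p) = p'' := by
      rw [← sub_eq_zero, ← neg_eq_zero, ← hsum]; abel
    rw [hν, this]
    exact disjoint_iff_inter_eq_empty.2 hb''

theorem abs_inner_isBallNormal_le (hR : 0 < R) {p q ν : V} (hν : IsBallNormal R F p ν)
    (hq : q ∈ frontier F) : |inner ℝ (q - p) ν| ≤ ‖q - p‖ ^ 2 / (2 * R) := by
  obtain ⟨hn, hin, hout⟩ := hν
  have h1 : R ≤ ‖(q - p) - R • ν‖ := by
    by_contra! hlt
    refine hq.2 (interior_maximal hin isOpen_ball ?_)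
    rwa [mem_ball, dist_eq_norm, ← sub_sub]
  have h2 : R ≤ ‖(q - p) + R • ν‖ := by
    by_contra! hlt
    refine disjoint_left.1 (hout.closure_right isOpen_ball) ?_ (frontier_subset_closure hq)
    rwa [mem_ball, dist_eq_norm, ← sub_add]
  have e1 := norm_sub_sq_real (q - p) (R • ν)
  have e2 := norm_add_sq_real (q - p) (R • ν)
  rw [inner_smul_right, norm_smul, hn, Real.norm_of_nonneg hR.le, mul_one] at e1 e2
  have h1' : R ^ 2 ≤ ‖(q - p) - R • ν‖ ^ 2 := by gcongr
  have h2' : R ^ 2 ≤ ‖(q - p) + R • ν‖ ^ 2 := by gcongr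
  rw [le_div_iff₀ (by positivity), ← abs_of_pos (by positivity : 0 < 2 * R), ← abs_mul, abs_le]
  constructor <;> linarith

theorem norm_sub_le_mul_norm_sub_normal_displacement (hR : 0 < R) (hδ : δ < R)
    {p₁ p₂ ν₁ ν₂ : V} {s₁ s₂ : ℝ} (hp₁ : p₁ ∈ frontier F) (hp₂ : p₂ ∈ frontier F)
    (hν₁ : IsBallNormal R F p₁ ν₁) (hν₂ : IsBallNormal R F p₂ ν₂)
    (hs₁ : |s₁| ≤ δ) (hs₂ : |s₂| ≤ δ) :
    ‖p₁ - p₂‖ ≤ R / (R - δ) * ‖(p₁ + s₁ • ν₁) - (p₂ + s₂ • ν₂)‖ := by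
  have hδ0 : 0 ≤ δ := (abs_nonneg _).trans hs₁
  have i1 := abs_inner_isBallNormal_le hR hν₂ hp₁
  have i2 := abs_inner_isBallNormal_le hR hν₁ hp₂
  rw [norm_sub_rev, ← neg_sub p₁ p₂, inner_neg_left, abs_neg] at i2
  have key : (1 - δ / R) * ‖p₁ - p₂‖ ^ 2 ≤
      ‖p₁ - p₂‖ * ‖(p₁ + s₁ • ν₁) - (p₂ + s₂ • ν₂)‖ := by
    refine le_trans ?_ (real_inner_le_norm _ _)
    have e : (p₁ + s₁ • ν₁) - (p₂ + s₂ • ν₂) = (p₁ - p₂) + s₁ • ν₁ - s₂ • ν₂ := by abel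
    rw [e, inner_sub_right, inner_add_right, real_inner_self_eq_norm_sq, inner_smul_right,
      inner_smul_right]
    have j1 : |s₁ * inner ℝ (p₁ - p₂) ν₁| ≤ δ * (‖p₁ - p₂‖ ^ 2 / (2 * R)) := by
      rw [abs_mul]; gcongr
    have j2 : |s₂ * inner ℝ (p₁ - p₂) ν₂| ≤ δ * (‖p₁ - p₂‖ ^ 2 / (2 * R)) := by
      rw [abs_mul]; gcongr
    have e3 : (1 - δ / R) * ‖p₁ - p₂‖ ^ 2 =
        ‖p₁ - p₂‖ ^ 2 - δ * (‖p₁ - p₂‖ ^ 2 / (2 * R)) - δ * (‖p₁ - p₂‖ ^ 2 / (2 * R)) := by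
      field_simp; ring
    linarith [(abs_le.1 j1).1, (abs_le.1 j2).2]
  rcases (norm_nonneg (p₁ - p₂)).eq_or_lt with h0 | h0
  · rw [← h0]
    have : 0 < R - δ := sub_pos.2 hδ
    positivity
  · have : (1 - δ / R) * ‖p₁ - p₂‖ ≤ ‖(p₁ + s₁ • ν₁) - (p₂ + s₂ • ν₂)‖ := by
      refine le_of_mul_le_mul_left ?_ h0
      linarith
    have hRδ : 0 < R - δ := sub_pos.2 hδ
    rw [div_mul_eq_mul_div, le_div_iff₀ hRδ]
    have e4 : ‖p₁ - p₂‖ * (R - δ) = R * ((1 - δ / R) * ‖p₁ - p₂‖) := by field_simp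
    rw [e4]
    gcongr

theorem ball_add_smul_subset (hδR : δ ≤ R) {p ν : V} (hν : ‖ν‖ = 1) :
    ball (p + δ • ν) δ ⊆ ball (p + R • ν) R := by
  refine ball_subset_ball' ?_
  rw [dist_add_left, dist_eq_norm, ← sub_smul, norm_smul, hν, mul_one, norm_sub_rev,
    Real.norm_of_nonneg (by linarith)]
  linarith

theorem ball_sub_smul_subset (hδR : δ ≤ R) {p ν : V} (hν : ‖ν‖ = 1) :
    ball (p - δ • ν) δ ⊆ ball (p - R • ν) R := by
  simpa [sub_eq_add_neg] using
    ball_add_smul_subset hδR (p := p) (ν := -ν) (by rwa [norm_neg])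

theorem inter_frontier_nonempty_of_convex {C : Set V} (hC : Convex ℝ C) {x y : V} (hx : x ∈ C)
    (hy : y ∈ C) (hxF : x ∈ F) (hyF : y ∉ F) : (C ∩ frontier F).Nonempty :=
  inter_frontier_nonempty_of_isPreconnected hC.isPreconnected ⟨x, hx, hxF⟩ ⟨y, hy, hyF⟩

theorem mem_of_ball_subset_of_subset_thickening (hδ : 0 < δ) (hδR : δ ≤ R)
    (hG : ∀ z ∈ frontier G, ∃ ν, IsBallNormal R G z ν)
    (hFG : F ⊆ thickening (δ / 2) G) {x : V} (hx : ball x δ ⊆ F) : x ∈ G := by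
  by_contra hxG
  obtain ⟨y, hyG, hxy⟩ := mem_thickening_iff.1 (hFG (hx (mem_ball_self hδ)))
  obtain ⟨z, hz, hzG⟩ := inter_frontier_nonempty_of_convex (convex_ball x (δ / 2))
    (mem_ball'.2 hxy) (mem_ball_self (by positivity)) hyG hxG
  obtain ⟨ν, hν, -, hout⟩ := hG z hzG
  have hmem : z - (δ / 2) • ν ∈ ball x δ := by
    rw [mem_ball] at hz ⊢
    have : dist (z - (δ / 2) • ν) z = δ / 2 := by
      rw [dist_eq_norm, sub_sub_cancel_left, norm_neg, norm_smul, hν, mul_one,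
        Real.norm_of_nonneg (by positivity)]
    linarith [dist_triangle (z - (δ / 2) • ν) z x]
  obtain ⟨w, hwG, hw⟩ := mem_thickening_iff.1 (hFG (hx hmem))
  exact disjoint_left.1 hout
    (ball_sub_smul_subset (by linarith) hν (mem_ball'.2 hw)) hwG

theorem exists_normal_displacement_mem_frontier (hδ : 0 < δ) (hδR : δ ≤ R)
    (hG : ∀ z ∈ frontier G, ∃ ν, IsBallNormal R G z ν)
    (hFG : F ⊆ thickening (δ / 2) G) (hGF : G ⊆ thickening (δ / 2) F)
    {p ν : V} (hν : IsBallNormal R F p ν) : ∃ s : ℝ, |s| ≤ δ ∧ p + s • ν ∈ frontier G := by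
  obtain ⟨hn, hin, hout⟩ := hν
  have h1 : p + δ • ν ∈ G := mem_of_ball_subset_of_subset_thickening hδ hδR hG hFG
    ((ball_add_smul_subset hδR hn).trans hin)
  have h2 : p - δ • ν ∉ G := by
    intro hmem
    obtain ⟨w, hwF, hw⟩ := mem_thickening_iff.1 (hGF hmem)
    exact disjoint_left.1 hout (ball_sub_smul_subset hδR hn
      (mem_ball'.2 (by linarith))) hwF
  have hconv : Convex ℝ ((fun s : ℝ => p + s • ν) '' Icc (-δ) δ) := by
    have := ((convex_Icc (-δ) δ).linear_image (LinearMap.toSpanSingleton ℝ V ν)).translate p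
    simpa [image_image] using this
  obtain ⟨_, ⟨s, hs, rfl⟩, hsG⟩ := inter_frontier_nonempty_of_convex hconv
    ⟨δ, ⟨by linarith, le_rfl⟩, rfl⟩ ⟨-δ, ⟨le_rfl, by linarith⟩, rfl⟩ h1
    (by simpa [sub_eq_add_neg] using h2)
  exact ⟨s, abs_le.2 hs, hsG⟩

variable [MeasurableSpace V] [BorelSpace V]

theorem hausdorffMeasure_frontier_le (hδ : 0 < δ) (hδR : δ < R)
    (hF : ∀ z ∈ frontier F, ∃ ν, IsBallNormal R F z ν)
    (hG : ∀ z ∈ frontier G, ∃ ν, IsBallNormal R G z ν)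
    (hFG : F ⊆ thickening (δ / 2) G) (hGF : G ⊆ thickening (δ / 2) F)
    {K : ℝ≥0} (hK : (K : ℝ) = R / (R - δ)) {d : ℝ} (hd : 0 ≤ d) :
    μH[d] (frontier F) ≤ (K : ℝ≥0∞) ^ d * μH[d] (frontier G) := by
  have key : ∀ p : V, ∃ ν : V, ∃ s : ℝ, p ∈ frontier F →
      IsBallNormal R F p ν ∧ |s| ≤ δ ∧ p + s • ν ∈ frontier G := by
    intro p
    by_cases hp : p ∈ frontier F
    · obtain ⟨ν, hν⟩ := hF p hp
      obtain ⟨s, hs⟩ := exists_normal_displacement_mem_frontier hδ hδR.le hG hFG hGF hν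
      exact ⟨ν, s, fun _ => ⟨hν, hs⟩⟩
    · exact ⟨0, 0, fun h => absurd h hp⟩
  choose ν s hνs using key
  refine hausdorffMeasure_le_of_norm_sub_le (f := fun p => p + s p • ν p) hd
    (fun p hp => (hνs p hp).2.2) fun x hx y hy => ?_
  rw [hK]
  exact norm_sub_le_mul_norm_sub_normal_displacement (hδ.trans hδR) hδR hx hy (hνs x hx).1
    (hνs y hy).1 (hνs x hx).2.1 (hνs y hy).2.1

theorem hausdorffMeasure_lt_top_of_abs_inner_le [FiniteDimensional ℝ V] {A : Set V}
    (hA : Bornology.IsBounded A) {v : V} (hv : ‖v‖ = 1)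
    (h : ∀ x ∈ A, ∀ y ∈ A, |inner ℝ (x - y) v| ≤ ‖x - y‖ / 2) :
    μH[(Module.finrank ℝ V : ℝ) - 1] A < ⊤ := by
  have hv0 : v ≠ 0 := by
    rintro rfl
    simp at hv
  have hpos : 0 < Module.finrank ℝ V := Module.finrank_pos_iff_exists_ne_zero.2 ⟨v, hv0⟩
  have : Fact (Module.finrank ℝ V = (Module.finrank ℝ V - 1) + 1) := ⟨by omega⟩
  have hdim : Module.finrank ℝ (ℝ ∙ v)ᗮ = Module.finrank ℝ V - 1 :=
    Submodule.finrank_orthogonal_span_singleton hv0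
  have hcast : (Module.finrank ℝ V : ℝ) - 1 = (Module.finrank ℝ (ℝ ∙ v)ᗮ : ℝ) := by
    rw [hdim]
    push_cast [Nat.one_le_iff_ne_zero.2 hpos.ne']
    rfl
  rw [hcast]
  let P := (ℝ ∙ v)ᗮ.orthogonalProjectionOnto
  have hle := hausdorffMeasure_le_of_norm_sub_le (A := A) (B := P '' A) (f := P) (K := 2)
    (d := (Module.finrank ℝ (ℝ ∙ v)ᗮ : ℝ)) (Nat.cast_nonneg _) (mapsTo_image _ _) ?_
  · refine hle.trans_lt (ENNReal.mul_lt_top ?_ ?_)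
    · exact ENNReal.rpow_lt_top_of_nonneg (Nat.cast_nonneg _) ENNReal.coe_ne_top
    · exact (P.lipschitz.isBounded_image hA).measure_lt_top
  · intro x hx y hy
    have hP : ((P (x - y) : (ℝ ∙ v)ᗮ) : V) = (x - y) - inner ℝ (x - y) v • v := by
      rw [Submodule.coe_orthogonalProjectionOnto_apply,
        Submodule.starProjection_orthogonal_val, Submodule.starProjection_unit_singleton ℝ hv,
        real_inner_comm]
    have h1 : ‖x - y‖ ≤ ‖P (x - y)‖ + |inner ℝ (x - y) v| := by
      have hnorm : ‖P (x - y)‖ = ‖x - y - inner ℝ (x - y) v • v‖ := by rw [← hP]; rfl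
      rw [hnorm]
      calc ‖x - y‖ = ‖(x - y - inner ℝ (x - y) v • v) + inner ℝ (x - y) v • v‖ := by
            rw [sub_add_cancel]
        _ ≤ _ := (norm_add_le _ _).trans_eq (by rw [norm_smul, hv, mul_one, Real.norm_eq_abs])
    rw [← map_sub]
    have := h x hx y hy
    push_cast
    linarith

theorem hausdorffMeasure_frontier_lt_top [FiniteDimensional ℝ V] (hR : 0 < R)
    (hb : Bornology.IsBounded F) (hF : ∀ z ∈ frontier F, ∃ ν, IsBallNormal R F z ν) :
    μH[(Module.finrank ℝ V : ℝ) - 1] (frontier F) < ⊤ := by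
  have hbf : Bornology.IsBounded (frontier F) := hb.closure.subset frontier_subset_closure
  choose! ν hν using hF
  set S : Set (V × V) := (fun p => (p, ν p)) '' frontier F
  have hS : TotallyBounded S := by
    have : S ⊆ frontier F ×ˢ closedBall 0 1 := by
      rintro _ ⟨p, hp, rfl⟩
      exact ⟨hp, by simp [(hν p hp).1]⟩
    exact ((hbf.prod isBounded_closedBall).subset this).isCompact_closure.totallyBounded.subset
      subset_closure
  have hε : 0 < min (R / 4) (1 / 4) := by positivity
  obtain ⟨t, htS, ht, hcov⟩ := finite_approx_of_totallyBounded hS _ hε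
  have hsub : frontier F ⊆
      ⋃ y ∈ t, {p ∈ frontier F | (p, ν p) ∈ ball y (min (R / 4) (1 / 4))} := by
    intro p hp
    obtain ⟨y, hy, hpy⟩ := mem_iUnion₂.1 (hcov ⟨p, hp, rfl⟩)
    exact mem_iUnion₂.2 ⟨y, hy, hp, hpy⟩
  refine (measure_mono hsub).trans_lt ((measure_biUnion_lt_top ht) fun y hy => ?_)
  obtain ⟨q, hq, rfl⟩ := htS hy
  refine hausdorffMeasure_lt_top_of_abs_inner_le (hbf.subset (sep_subset _ _)) (hν q hq).1 ?_
  rintro x ⟨hx, hxq⟩ z ⟨hz, hzq⟩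
  rw [mem_ball, Prod.dist_eq, max_lt_iff, lt_min_iff, lt_min_iff] at hxq hzq
  have hxz : ‖x - z‖ ≤ R / 2 := by
    rw [← dist_eq_norm]
    linarith [dist_triangle_right x z q, hxq.1.1, hzq.1.1]
  have h1 : |inner ℝ (x - z) (ν z)| ≤ ‖x - z‖ / 4 := by
    refine (abs_inner_isBallNormal_le hR (hν z hz) hx).trans ?_
    rw [div_le_div_iff₀ (by positivity) (by positivity)]
    nlinarith [norm_nonneg (x - z)]
  have h2 : |inner ℝ (x - z) (ν q - ν z)| ≤ ‖x - z‖ / 4 := by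
    refine (abs_real_inner_le_norm _ _).trans ?_
    have : ‖ν q - ν z‖ ≤ 1 / 4 := by
      rw [← dist_eq_norm, dist_comm]
      exact hzq.2.2.le
    nlinarith [norm_nonneg (x - z)]
  have h3 : inner ℝ (x - z) (ν q) = inner ℝ (x - z) (ν z) + inner ℝ (x - z) (ν q - ν z) := by
    rw [← inner_add_right, add_sub_cancel]
  rw [h3]
  linarith [abs_add_le (inner ℝ (x - z) (ν z)) (inner ℝ (x - z) (ν q - ν z))]

end InnerProduct

theorem ENNReal.tendsto_of_eventually_le_rpow_mul {ι : Type*} {l : Filter ι} {a : ι → ℝ≥0∞}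
    {b : ℝ≥0∞} (hb : b ≠ ⊤) (d : ℝ)
    (h : ∀ K : ℝ≥0, 1 < K → ∀ᶠ i in l, b ≤ (K : ℝ≥0∞) ^ d * a i ∧ a i ≤ (K : ℝ≥0∞) ^ d * b) :
    Tendsto a l (𝓝 b) := by
  have hlim : ∀ c : ℝ≥0∞, c ≠ ⊤ →
      Tendsto (fun K : ℝ≥0 => (K : ℝ≥0∞) ^ d * c) (𝓝[>] 1) (𝓝 c) := by
    intro c hc
    have h1 : Tendsto (fun K : ℝ≥0 => (K : ℝ≥0∞) ^ d) (𝓝[>] 1) (𝓝 1) := by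
      have h2 : Continuous fun K : ℝ≥0 => (K : ℝ≥0∞) ^ d :=
        ENNReal.continuous_rpow_const.comp ENNReal.continuous_coe
      simpa using (h2.tendsto 1).mono_left nhdsWithin_le_nhds
    simpa using ENNReal.Tendsto.mul_const h1 (Or.inr hc)
  refine tendsto_order.2 ⟨fun c hc => ?_, fun c hc => ?_⟩
  · obtain ⟨K, hKc, hK⟩ := (((hlim c hc.ne_top).eventually (eventually_lt_nhds hc)).and
      self_mem_nhdsWithin).exists
    filter_upwards [h K hK] with i hi
    exact lt_of_mul_lt_mul_left' (hKc.trans_le hi.1)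
  · obtain ⟨K, hKc, hK⟩ := (((hlim b hb).eventually (eventually_lt_nhds hc)).and
      self_mem_nhdsWithin).exists
    filter_upwards [h K hK] with i hi
    exact hi.2.trans_lt hKc

section Kuratowski

variable {X : Type*} [MetricSpace X] {F : ℕ → Set X} {F₀ : Set X}

theorem KConv.mem_of_frequently (h : KConv F F₀) {y : X} (hy : ∃ᶠ k in atTop, y ∈ F k) :
    y ∈ F₀ := by
  obtain ⟨φ, hφ, hyφ⟩ := extraction_of_frequently_atTop hy
  exact h.1 y φ (fun _ => y) hφ hyφ tendsto_const_nhds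

theorem KConv.eventually_subset_thickening (h : KConv F F₀) {C : Set X} (hC : IsCompact C)
    (hFC : ∀ k, F k ⊆ C) {ε : ℝ} (hε : 0 < ε) : ∀ᶠ k in atTop, F k ⊆ thickening ε F₀ := by
  by_contra hne
  obtain ⟨φ, hφ, hyφ⟩ := extraction_of_frequently_atTop (not_eventually.1 hne)
  choose x hx hxF using fun k => not_subset.1 (hyφ k)
  obtain ⟨p, -, ψ, hψ, hlim⟩ := hC.tendsto_subseq fun k => hFC _ (hx k)
  have hp : p ∈ F₀ := h.1 p (φ ∘ ψ) (x ∘ ψ) (hφ.comp hψ) (fun k => hx (ψ k)) hlim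
  have hmem : ∀ᶠ k in atTop, (x ∘ ψ) k ∈ thickening ε F₀ :=
    hlim (isOpen_thickening.mem_nhds (self_subset_thickening hε _ hp))
  obtain ⟨k, hk⟩ := hmem.exists
  exact hxF _ hk

theorem KConv.eventually_superset_thickening (h : KConv F F₀) (hF₀ : IsCompact F₀) {ε : ℝ}
    (hε : 0 < ε) : ∀ᶠ k in atTop, F₀ ⊆ thickening ε (F k) := by
  by_contra hne
  obtain ⟨φ, hφ, hyφ⟩ := extraction_of_frequently_atTop (not_eventually.1 hne)
  choose x hx hxF using fun k => not_subset.1 (hyφ k)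
  obtain ⟨p, hp, ψ, hψ, hlim⟩ := hF₀.tendsto_subseq hx
  obtain ⟨y, hyF, hy⟩ := h.2 p hp
  have hd := hlim.dist (hy.comp (hφ.comp hψ).tendsto_atTop)
  rw [dist_self] at hd
  obtain ⟨k, hk⟩ := (hd.eventually (eventually_lt_nhds hε)).exists
  exact hxF _ (mem_thickening_iff.2 ⟨_, hyF _, hk⟩)

end Kuratowski

section FrontierLimits

variable {V : Type*} [NormedAddCommGroup V] {R : ℝ} {F : ℕ → Set V} {F₀ : Set V}

theorem KConv.exists_frontier_tendsto [InnerProductSpace ℝ V] (h : KConv F F₀)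
    (hF : ∀ k, IsCompact (F k)) (hne : ∀ k, (frontier (F k)).Nonempty) {p : V} (hp : p ∈ frontier F₀) (hpF : p ∈ F₀) :
    ∃ x : ℕ → V, (∀ k, x k ∈ frontier (F k)) ∧ Tendsto x atTop (𝓝 p) := by
  have hcomp : ∀ k, IsCompact (frontier (F k)) := fun k =>
    (hF k).of_isClosed_subset isClosed_frontier (hF k).isClosed.frontier_subset
  choose x hx hdist using fun k => (hcomp k).exists_infDist_eq_dist (hne k) p
  refine ⟨x, hx, Metric.tendsto_nhds.2 fun ε hε => ?_⟩
  obtain ⟨z, hzF, hz⟩ := h.2 p hpF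
  have hpc : p ∈ closure F₀ᶜ := by
    rw [frontier_eq_closure_inter_closure] at hp
    exact hp.2
  obtain ⟨y, hyF, hy⟩ := Metric.mem_closure_iff.1 hpc ε hε
  have hy' : ∀ᶠ k in atTop, y ∉ F k := by
    rw [← not_frequently]
    exact fun hfr => hyF (h.mem_of_frequently hfr)
  filter_upwards [hy', hz (ball_mem_nhds p hε)] with k hyk hzk
  obtain ⟨w, hw, hwF⟩ := inter_frontier_nonempty_of_convex (convex_ball p ε) hzk
    (mem_ball'.2 hy) (hzF k) hyk
  rw [dist_comm, ← hdist]
  exact (infDist_le_dist_of_mem hwF).trans_lt (mem_ball'.1 hw)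

theorem KConv.exists_centers_of_tendsto [ProperSpace V] (h : KConv F F₀)
    (hF : ∀ k, ∀ p ∈ frontier (F k), ∃ p' p'' : V, dist p p' = R ∧ dist p p'' = R ∧
      ball p' R ⊆ F k ∧ ball p'' R ∩ F k = ∅)
    {φ : ℕ → ℕ} (hφ : StrictMono φ) {x : ℕ → V} (hx : ∀ k, x k ∈ frontier (F (φ k))) {p : V}
    (hlim : Tendsto x atTop (𝓝 p)) :
    ∃ p' p'' : V, dist p p' = R ∧ dist p p'' = R ∧ ball p' R ⊆ F₀ ∧ ball p'' R ∩ F₀ = ∅ := by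
  choose c' c'' hc' hc'' hin hout using fun k => hF (φ k) (x k) (hx k)
  have hbx := isBounded_range_of_tendsto x hlim
  obtain ⟨B, hB⟩ := hbx.subset_closedBall 0
  have hbound : ∀ c : ℕ → V, (∀ k, dist (x k) (c k) = R) → ∀ k, c k ∈ closedBall 0 (B + R) := by
    intro c hc k
    have h1 : dist (x k) 0 ≤ B := hB (mem_range_self k)
    rw [mem_closedBall]
    linarith [dist_triangle_left (c k) 0 (x k), hc k]
  obtain ⟨⟨p', p''⟩, -, ψ, hψ, hconv⟩ :=
    ((isCompact_closedBall (0 : V) (B + R)).prod (isCompact_closedBall 0 (B + R))).tendsto_subseq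
      (x := fun k => (c' k, c'' k)) fun k => ⟨hbound c' hc' k, hbound c'' hc'' k⟩
  have hp' : Tendsto (c' ∘ ψ) atTop (𝓝 p') := (continuous_fst.tendsto _).comp hconv
  have hp'' : Tendsto (c'' ∘ ψ) atTop (𝓝 p'') := (continuous_snd.tendsto _).comp hconv
  have hxψ := hlim.comp hψ.tendsto_atTop
  have hφψ := hφ.comp hψ
  refine ⟨p', p'', ?_, ?_, fun y hy => ?_, eq_empty_iff_forall_notMem.2 ?_⟩
  · exact tendsto_nhds_unique (hxψ.dist hp') (tendsto_const_nhds.congr fun k => (hc' _).symm)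
  · exact tendsto_nhds_unique (hxψ.dist hp'') (tendsto_const_nhds.congr fun k => (hc'' _).symm)
  · have hd : Tendsto (fun k => dist y ((c' ∘ ψ) k)) atTop (𝓝 (dist y p')) :=
      tendsto_const_nhds.dist hp'
    have hev : ∀ᶠ k in atTop, y ∈ F (φ (ψ k)) := by
      filter_upwards [hd.eventually (eventually_lt_nhds hy)] with k hk
      exact hin _ hk
    exact h.mem_of_frequently (hφψ.tendsto_atTop.frequently hev.frequently)
  · rintro y ⟨hy, hyF⟩
    obtain ⟨z, hzF, hz⟩ := h.2 y hyF
    have hd := (hz.comp hφψ.tendsto_atTop).dist hp''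
    obtain ⟨k, hk⟩ := (hd.eventually (eventually_lt_nhds hy)).exists
    exact (hout (ψ k)).le ⟨hk, hzF _⟩

theorem KConv.mem_frontier_of_tendsto [InnerProductSpace ℝ V] [ProperSpace V] (hR : 0 < R)
    (h : KConv F F₀) (hcl : ∀ k, IsClosed (F k))
    (hF : ∀ k, ∀ p ∈ frontier (F k), ∃ p' p'' : V, dist p p' = R ∧ dist p p'' = R ∧
      ball p' R ⊆ F k ∧ ball p'' R ∩ F k = ∅)
    {φ : ℕ → ℕ} (hφ : StrictMono φ) {x : ℕ → V} (hx : ∀ k, x k ∈ frontier (F (φ k))) {p : V}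
    (hlim : Tendsto x atTop (𝓝 p)) : p ∈ frontier F₀ := by
  obtain ⟨p', p'', -, hd, -, hout⟩ := h.exists_centers_of_tendsto hF hφ hx hlim
  have hpF : p ∈ F₀ := h.1 p φ x hφ (fun k => (hcl _).frontier_subset (hx k)) hlim
  rw [frontier_eq_closure_inter_closure]
  refine ⟨subset_closure hpF, closure_mono (disjoint_iff_inter_eq_empty.2 hout).subset_compl_right
    ?_⟩
  rw [closure_ball _ hR.ne']
  exact hd.le

end FrontierLimits

theorem boundary_convergence_UR (n : ℕ) (hn : 2 ≤ n) (R : ℝ) (hR : 0 < R)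
    (Eh : ℕ → Set (En n)) (hEh : ∀ h, Eh h ∈ UR n R)
    (M : ℝ) (hM : 0 < M) (hbd : ∀ h, Eh h ⊆ ball 0 M)
    (E : Set (En n)) (hE : IsCompact E) (hK : KConv Eh E) :
    E ∈ UR n R ∧ KConv (fun h => frontier (Eh h)) (frontier E) ∧
      μH[(n : ℝ) - 1] (frontier E) < ⊤ ∧
      Tendsto (fun h => μH[(n : ℝ) - 1] (frontier (Eh h))) atTop
        (𝓝 (μH[(n : ℝ) - 1] (frontier E))) := by
  have hball : ∀ h, ∀ z ∈ frontier (Eh h), ∃ ν, IsBallNormal R (Eh h) z ν := by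
    intro h z hz
    obtain ⟨p', p'', h', h'', hin, hout⟩ := (hEh h).2.2 z hz
    exact exists_isBallNormal_of_centers hR h' h'' hin hout
  have hcpt : ∀ h, IsCompact (Eh h) := fun h => isCompact_of_isClosed_isBounded (hEh h).1 (hEh h).2.1
  have hfr : ∀ p ∈ frontier E, ∃ x : ℕ → En n, (∀ h, x h ∈ frontier (Eh h)) ∧
      Tendsto x atTop (𝓝 p) := by
    intro p hp
    have hpE : p ∈ E := hE.isClosed.frontier_subset hp
    obtain ⟨y, hy, -⟩ := hK.2 p hpE
    have : Nonempty (Fin n) := ⟨⟨0, by omega⟩⟩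
    refine hK.exists_frontier_tendsto hcpt (fun h => nonempty_frontier_iff.2 ⟨⟨y h, hy h⟩, ?_⟩)
      hp hpE
    intro huniv
    obtain ⟨z, hz⟩ := NormedSpace.exists_lt_norm ℝ (En n) M
    have := hbd h (huniv ▸ mem_univ z)
    rw [mem_ball_zero_iff] at this
    exact lt_asymm hz this
  have hsphere : ∀ h, sphereCond n R (Eh h) := fun h => (hEh h).2.2
  have hUR : E ∈ UR n R := by
    refine ⟨hE.isClosed, hE.isBounded, fun p hp => ?_⟩
    obtain ⟨x, hx, hlim⟩ := hfr p hp
    exact hK.exists_centers_of_tendsto hsphere strictMono_id hx hlim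
  have hballE : ∀ z ∈ frontier E, ∃ ν, IsBallNormal R E z ν := by
    intro z hz
    obtain ⟨p', p'', h', h'', hin, hout⟩ := hUR.2.2 z hz
    exact exists_isBallNormal_of_centers hR h' h'' hin hout
  have hfin : μH[(n : ℝ) - 1] (frontier E) < ⊤ := by
    simpa using hausdorffMeasure_frontier_lt_top hR hE.isBounded hballE
  refine ⟨hUR, ⟨fun p φ x hφ hx hlim => hK.mem_frontier_of_tendsto hR (fun h => (hEh h).1) hsphere
    hφ hx hlim, hfr⟩, hfin, ?_⟩
  have hd : 0 ≤ (n : ℝ) - 1 := by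
    have : (2 : ℝ) ≤ n := by exact_mod_cast hn
    linarith
  refine ENNReal.tendsto_of_eventually_le_rpow_mul hfin.ne ((n : ℝ) - 1) fun K hK1 => ?_
  have hK1' : (1 : ℝ) < K := by exact_mod_cast hK1
  have hK0 : (0 : ℝ) < K := by linarith
  have hinv : (K : ℝ)⁻¹ < 1 := inv_lt_one_of_one_lt₀ hK1'
  have hδ : 0 < R * (1 - (K : ℝ)⁻¹) := mul_pos hR (by linarith)
  have hδR : R * (1 - (K : ℝ)⁻¹) < R := by nlinarith [inv_pos.2 hK0]
  have hKδ : (K : ℝ) = R / (R - R * (1 - (K : ℝ)⁻¹)) := by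
    rw [mul_sub, mul_one, _root_.sub_sub_cancel]
    field_simp
  filter_upwards [hK.eventually_subset_thickening (isCompact_closedBall (0 : En n) M)
    (fun h => (hbd h).trans ball_subset_closedBall) (half_pos hδ),
    hK.eventually_superset_thickening hE (half_pos hδ)] with h h1 h2
  exact ⟨hausdorffMeasure_frontier_le hδ hδR hballE (hball h) h2 h1 hKδ hd,
    hausdorffMeasure_frontier_le hδ hδR (hball h) hballE h1 h2 hKδ hd⟩
end
end

section
/- Let n ≥ 2, R > 0, and let φ : ℝ^{n−1} → ℝ be a convex function. Let E ∈ 𝒰_R and let {E_h} be a sequence in 𝒰_R with E_h → E in L¹. Then for every choice of elementary symmetric curvature functions (K_1^E, …, K_{n−1}^E) of ∂E and (K_1^{E_h}, …, K_{n−1}^{E_h}) of ∂E_h one has ∫_{∂E} φ(K_1^E, …, K_{n−1}^E) dH^{n−1} ≤ liminf_{h→∞} ∫_{∂E_h} φ(K_1^{E_h}, …, K_{n−1}^{E_h}) dH^{n−1}. -/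
open Set Metric MeasureTheory Filter Topology ENNReal NNReal

noncomputable section

def L1Conv {n : ℕ} (F : ℕ → Set (En n)) (E : Set (En n)) : Prop :=
  Tendsto (fun h => ∫ x, |(F h).indicator (fun _ => (1:ℝ)) x - E.indicator (fun _ => (1:ℝ)) x|)
    atTop (𝓝 0)

def emb (n : ℕ) (x : En (n - 1)) (z : ℝ) : En n :=
  (WithLp.equiv 2 (Fin n → ℝ)).symm (fun i => if h : (i : ℕ) < n - 1 then x ⟨i, h⟩ else z)

def pd (n : ℕ) (f : En (n - 1) → ℝ) (i : Fin (n - 1)) (x : En (n - 1)) : ℝ :=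
  fderiv ℝ f x (EuclideanSpace.single i 1)

def pd2 (n : ℕ) (f : En (n - 1) → ℝ) (i j : Fin (n - 1)) (x : En (n - 1)) : ℝ :=
  fderiv ℝ (pd n f i) x (EuclideanSpace.single j 1)

def Gmat (n : ℕ) (f : En (n - 1) → ℝ) (x : En (n - 1)) : Matrix (Fin (n - 1)) (Fin (n - 1)) ℝ :=
  fun i j => (if i = j then 1 else 0) + pd n f i x * pd n f j x

def Bmat (n : ℕ) (f : En (n - 1) → ℝ) (x : En (n - 1)) : Matrix (Fin (n - 1)) (Fin (n - 1)) ℝ :=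
  fun i j => pd2 n f i j x / Real.sqrt (1 + ‖fderiv ℝ f x‖ ^ 2)

/-- The `p`-th elementary symmetric curvature of the graph of `f` at `(x, f x)`:
`binom(n-1,p)⁻¹ (−1)^p` times the degree-`(n-1-p)` coefficient of the characteristic
polynomial of `G⁻¹B`. -/
def Kp (n : ℕ) (f : En (n - 1) → ℝ) (p : ℕ) (x : En (n - 1)) : ℝ :=
  ((n - 1).choose p : ℝ)⁻¹ *
    ((-1 : ℝ) ^ p * (((Gmat n f x)⁻¹ * Bmat n f x).charpoly.coeff (n - 1 - p)))

/-- `f` is of class `C^{1,1}` on `S`: differentiable with Lipschitz gradient. -/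
def C11On (n : ℕ) (f : En (n - 1) → ℝ) (S : Set (En (n - 1))) : Prop :=
  (∀ x ∈ S, DifferentiableAt ℝ f x) ∧
    ∃ C : ℝ≥0, LipschitzOnWith C (fun x => fderiv ℝ f x) S

/-- `K p`, `p = 1, …, n-1`, is a family of elementary symmetric curvature functions
of `∂E`. -/
def IsCurvFuns (n : ℕ) (E : Set (En n)) (K : ℕ → En n → ℝ) : Prop :=
  ∀ (g : En n ≃ᵢ En n) (ρ r : ℝ), 0 < ρ → 0 < r → ∀ f : En (n - 1) → ℝ,
    C11On n f (ball 0 ρ) →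
    (E ∩ (g '' {q | ∃ x : En (n - 1), ‖x‖ < ρ ∧ ∃ z ∈ Ioo (-r) r, q = emb n x z})
      = g '' {q | ∃ x : En (n - 1), ‖x‖ < ρ ∧ ∃ z ∈ Ioo (-r) r, z ≤ f x ∧ q = emb n x z}) →
    ∀ x ∈ ball (0 : En (n - 1)) ρ, |f x| < r →
      DifferentiableAt ℝ (fun y => fderiv ℝ f y) x →
      ∀ p : ℕ, 1 ≤ p → p ≤ n - 1 → K p (g (emb n x (f x))) = Kp n f p x

/-- The vector `(K_1(q), …, K_{n-1}(q))`. -/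
def KvecOf (n : ℕ) (K : ℕ → En n → ℝ) (q : En n) : En (n - 1) :=
  (WithLp.equiv 2 (Fin (n - 1) → ℝ)).symm (fun i => K ((i : ℕ) + 1) q)

section SphereGeometry

variable {V : Type*} [NormedAddCommGroup V] [InnerProductSpace ℝ V]

/-- `ν` is an outer unit normal of `E` at the boundary point `p`, with both tangent balls of
radius `R`. -/
structure IsOuterNormal (R : ℝ) (E : Set V) (p ν : V) : Prop where
  mem_frontier : p ∈ frontier E
  norm_eq : ‖ν‖ = 1
  inner_ball : ball (p - R • ν) R ⊆ E
  outer_ball : Disjoint (ball (p + R • ν) R) E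

variable {R : ℝ} {E : Set V} {p q ν μ : V}

lemma IsOuterNormal.two_mul_le (hR : 0 < R) (hp : IsOuterNormal R E p ν)
    (hq : IsOuterNormal R E q μ) : 2 * R ≤ ‖p - q + R • (ν + μ)‖ := by
  have h : Disjoint (ball (p + R • ν) R) (ball (q - R • μ) R) :=
    hp.outer_ball.mono_right hq.inner_ball
  rw [disjoint_ball_ball_iff hR hR, dist_eq_norm] at h
  have : p + R • ν - (q - R • μ) = p - q + R • (ν + μ) := by
    rw [smul_add]; abel
  rw [this] at h
  linarith

lemma IsOuterNormal.mul_norm_sub_le (hR : 0 < R) (hp : IsOuterNormal R E p ν)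
    (hq : IsOuterNormal R E q μ) : R * ‖ν - μ‖ ≤ ‖p - q‖ := by
  have h1 := hp.two_mul_le hR hq
  have h2 := hq.two_mul_le hR hp
  have e2 : q - p + R • (μ + ν) = -(p - q - R • (ν + μ)) := by
    rw [add_comm μ ν]; abel
  rw [e2, norm_neg] at h2
  have par := parallelogram_law_with_norm ℝ (p - q) (R • (ν + μ))
  have par2 := parallelogram_law_with_norm ℝ ν μ
  rw [norm_smul, Real.norm_of_nonneg hR.le] at par
  rw [hp.norm_eq, hq.norm_eq] at par2
  have := mul_self_le_mul_self (by positivity) h1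
  have := mul_self_le_mul_self (by positivity) h2
  have : (R * ‖ν - μ‖) ^ 2 ≤ ‖p - q‖ ^ 2 := by
    nlinarith
  exact (sq_le_sq₀ (by positivity) (norm_nonneg _)).1 this

lemma IsOuterNormal.unique (hR : 0 < R) (hp : IsOuterNormal R E p ν)
    (hq : IsOuterNormal R E p μ) : ν = μ := by
  have h := hp.mul_norm_sub_le hR hq
  rw [sub_self, norm_zero] at h
  have : ‖ν - μ‖ ≤ 0 := by
    by_contra! h'
    have := mul_pos hR h'
    linarith
  exact sub_eq_zero.1 (norm_le_zero_iff.1 this)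

lemma IsOuterNormal.inner_le (hR : 0 < R) (hp : IsOuterNormal R E p ν) (hq : q ∈ E) :
    2 * R * inner ℝ (q - p) ν ≤ ‖q - p‖ ^ 2 := by
  have h : q ∉ ball (p + R • ν) R := fun h => hp.outer_ball.le_bot ⟨h, hq⟩
  rw [mem_ball, dist_eq_norm, not_lt, ← sub_sub] at h
  have h2 := mul_self_le_mul_self hR.le h
  have := norm_sub_sq_real (q - p) (R • ν)
  rw [norm_smul, inner_smul_right, hp.norm_eq, Real.norm_of_nonneg hR.le] at this
  nlinarith

lemma IsOuterNormal.neg_le_inner (hR : 0 < R) (hp : IsOuterNormal R E p ν)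
    (hq : q ∈ frontier E) : -‖q - p‖ ^ 2 ≤ 2 * R * inner ℝ (q - p) ν := by
  have h : q ∉ ball (p - R • ν) R := fun h =>
    hq.2 (interior_maximal hp.inner_ball isOpen_ball h)
  rw [mem_ball, dist_eq_norm, not_lt, ← sub_add] at h
  have h2 := mul_self_le_mul_self hR.le h
  have := norm_add_sq_real (q - p) (R • ν)
  rw [norm_smul, inner_smul_right, hp.norm_eq, Real.norm_of_nonneg hR.le] at this
  nlinarith

lemma IsOuterNormal.add_smul_notMem (hR : 0 < R) (hp : IsOuterNormal R E p ν) {v : V}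
    (hv : ‖v‖ ^ 2 < 2 * R * inner ℝ v ν) : p + v ∉ E := by
  intro h
  have := hp.inner_le hR h
  rw [add_sub_cancel_left] at this
  linarith

lemma IsOuterNormal.sub_mem_interior (hR : 0 < R) (hp : IsOuterNormal R E p ν) {v : V}
    (hv : ‖v‖ ^ 2 < 2 * R * inner ℝ v ν) : p - v ∈ interior E := by
  refine interior_maximal hp.inner_ball isOpen_ball ?_
  rw [mem_ball, dist_eq_norm, _root_.sub_sub_sub_cancel_left, ← neg_sub, norm_neg]
  have := norm_sub_sq_real v (R • ν)
  rw [norm_smul, inner_smul_right, hp.norm_eq, Real.norm_of_nonneg hR.le] at this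
  refine (sq_lt_sq₀ (norm_nonneg _) hR.le).1 ?_
  nlinarith

lemma IsOuterNormal.le_dist (hR : 0 < R) (hp : IsOuterNormal R E p ν) {t : ℝ} (ht0 : 0 < t)
    (hq : q ∈ E) : t ^ 2 + (1 - t / R) * ‖q - p‖ ^ 2 ≤ dist (p + t • ν) q ^ 2 := by
  have h := hp.inner_le hR hq
  have e : p + t • ν - q = -(q - p - t • ν) := by abel
  rw [dist_eq_norm, e, norm_neg, norm_sub_sq_real (q - p), norm_smul, inner_smul_right, hp.norm_eq,
    Real.norm_of_nonneg ht0.le]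
  have : t * (2 * inner ℝ (q - p) ν) ≤ t / R * ‖q - p‖ ^ 2 := by
    rw [div_mul_eq_mul_div, mul_div_assoc]
    refine mul_le_mul_of_nonneg_left ?_ ht0.le
    rw [le_div_iff₀ hR]
    linarith
  nlinarith

lemma IsOuterNormal.infDist_eq (hE : IsClosed E) (hR : 0 < R) (hp : IsOuterNormal R E p ν) {t : ℝ}
    (ht0 : 0 < t) (htR : t < R) : infDist (p + t • ν) E = t := by
  have hpE : p ∈ E := hE.frontier_subset hp.mem_frontier
  apply le_antisymm
  · refine (infDist_le_dist_of_mem hpE).trans ?_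
    simp [dist_eq_norm, norm_smul, hp.norm_eq, abs_of_pos ht0]
  · refine (le_infDist ⟨p, hpE⟩).2 fun q hq => ?_
    have h := hp.le_dist hR ht0 hq
    have : 0 ≤ (1 - t / R) * ‖q - p‖ ^ 2 :=
      mul_nonneg (sub_nonneg.2 ((div_le_one hR).2 htR.le)) (sq_nonneg _)
    exact (sq_le_sq₀ ht0.le dist_nonneg).1 (by linarith)

lemma IsOuterNormal.eq_of_dist_le (hR : 0 < R) (hp : IsOuterNormal R E p ν) {t : ℝ}
    (ht0 : 0 < t) (htR : t < R) (hq : q ∈ E) (hqt : dist (p + t • ν) q ≤ t) : q = p := by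
  have h := hp.le_dist hR ht0 hq
  have h1 : 0 < 1 - t / R := sub_pos.2 ((div_lt_one hR).2 htR)
  have h2 := pow_le_pow_left₀ dist_nonneg hqt 2
  have h3 : ‖q - p‖ ^ 2 ≤ 0 := by
    by_contra! h4
    have := mul_pos h1 h4
    linarith
  exact sub_eq_zero.1 (norm_eq_zero.1 (pow_eq_zero_iff two_ne_zero |>.1
    (le_antisymm h3 (sq_nonneg _))))

lemma mem_frontier_of_dist_eq_infDist {x : V} (hp : p ∈ E) (hx : x ∉ E)
    (h : infDist x E = dist x p) : p ∈ frontier E := by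
  refine ⟨subset_closure hp, fun hi => ?_⟩
  have hd : 0 < dist x p := dist_pos.2 (by rintro rfl; exact hx hp)
  have hc : Tendsto (fun τ : ℝ => p + τ • (x - p)) (𝓝[>] 0) (𝓝 p) := by
    have : Continuous fun τ : ℝ => p + τ • (x - p) := by fun_prop
    simpa using (this.tendsto 0).mono_left nhdsWithin_le_nhds
  have h1 := hc.eventually (isOpen_interior.mem_nhds hi)
  have h2 : ∀ᶠ τ : ℝ in 𝓝[>] 0, τ < 1 :=
    (eventually_lt_nhds one_pos).filter_mono nhdsWithin_le_nhds
  obtain ⟨τ, ⟨h3, h4⟩, h5⟩ := ((h1.and h2).and self_mem_nhdsWithin).exists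
  have h6 := infDist_le_dist_of_mem (x := x) (interior_subset h3)
  have e : x - (p + τ • (x - p)) = (1 - τ) • (x - p) := by rw [sub_smul, one_smul]; abel
  rw [h, dist_eq_norm x (p + _), e, norm_smul, Real.norm_of_nonneg (by linarith),
    ← dist_eq_norm] at h6
  have : 0 < τ * dist x p := mul_pos h5 hd
  linarith

lemma IsOuterNormal.eq_add_infDist_smul (hR : 0 < R) (hp : IsOuterNormal R E p ν) {x : V}
    (hE : IsClosed E) (hx : x ∉ E) (h : infDist x E = dist x p) : x = p + infDist x E • ν := by
  have hpE : p ∈ E := hE.frontier_subset hp.mem_frontier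
  have hd : 0 < dist x p := dist_pos.2 (by rintro rfl; exact hx hpE)
  have hdis : Disjoint (ball x (dist x p)) (ball (p - R • ν) R) := by
    refine Disjoint.mono_right hp.inner_ball ?_
    rw [← h]
    exact disjoint_ball_infDist
  rw [disjoint_ball_ball_iff hd hR, dist_eq_norm x (p - _), ← sub_add] at hdis
  rw [h]
  rw [dist_eq_norm] at hd hdis ⊢
  have h1 := norm_add_sq_real (x - p) (R • ν)
  rw [norm_smul, inner_smul_right, hp.norm_eq, Real.norm_of_nonneg hR.le] at h1
  have h2 := mul_self_le_mul_self (by positivity) hdis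
  have h3 : ‖x - p‖ ≤ inner ℝ (x - p) ν := by
    by_contra! h4
    have := mul_lt_mul_of_pos_left h4 hR
    nlinarith
  have h5 := norm_sub_sq_real (x - p) (‖x - p‖ • ν)
  rw [norm_smul, inner_smul_right, hp.norm_eq, norm_norm] at h5
  have h6 : ‖x - p - ‖x - p‖ • ν‖ ^ 2 ≤ 0 := by
    have := mul_le_mul_of_nonneg_left h3 hd.le
    nlinarith
  have h7 := norm_eq_zero.1 (pow_eq_zero_iff two_ne_zero |>.1 (le_antisymm h6 (sq_nonneg _)))
  rw [sub_sub, sub_eq_zero] at h7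
  exact h7

end SphereGeometry

lemma sphereCond.exists_isOuterNormal {n : ℕ} {R : ℝ} (hR : 0 < R) {E : Set (En n)}
    (h : sphereCond n R E) {p : En n} (hp : p ∈ frontier E) :
    ∃ ν, IsOuterNormal R E p ν := by
  obtain ⟨p', p'', h1, h2, h3, h4⟩ := h p hp
  have h4' : Disjoint (ball p'' R) E := disjoint_iff_inter_eq_empty.2 h4
  have hRi : R * R⁻¹ = 1 := mul_inv_cancel₀ hR.ne'
  have hd : R + R ≤ dist p'' p' :=
    (disjoint_ball_ball_iff hR hR).1 (h4'.mono_right h3)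
  have h2' : ‖p'' - p‖ = R := by rw [← dist_eq_norm, dist_comm, h2]
  have h1' : ‖p - p'‖ = R := by rw [← dist_eq_norm, h1]
  have e : p'' - p = p - p' := by
    have par := parallelogram_law_with_norm ℝ (p'' - p) (p - p')
    rw [sub_add_sub_cancel, ← dist_eq_norm, h1', h2'] at par
    have := mul_self_le_mul_self (by positivity) hd
    have : ‖p'' - p - (p - p')‖ * ‖p'' - p - (p - p')‖ ≤ 0 := by nlinarith
    have := norm_eq_zero.1 (mul_self_eq_zero.1 (le_antisymm this (mul_self_nonneg _)))
    exact sub_eq_zero.1 this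
  refine ⟨R⁻¹ • (p'' - p), hp, ?_, ?_, ?_⟩
  · rw [norm_smul, h2', norm_inv, Real.norm_of_nonneg hR.le, mul_comm, hRi]
  · rw [smul_smul, hRi, one_smul, e, _root_.sub_sub_cancel]
    exact h3
  · rw [smul_smul, hRi, one_smul, add_sub_cancel]
    exact h4'

/-- An isometric splitting of `V` as the orthogonal sum of `W` and a line. -/
structure NormalFrame (W V : Type*) [NormedAddCommGroup W] [InnerProductSpace ℝ W]
    [NormedAddCommGroup V] [InnerProductSpace ℝ V] where
  /-- the inclusion of the hyperplane -/
  ι : W →ₗᵢ[ℝ] V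
  /-- the unit normal to the hyperplane -/
  e : V
  /-- the orthogonal projection to the hyperplane -/
  P : V →L[ℝ] W
  norm_e : ‖e‖ = 1
  inner_ι_e : ∀ x, inner ℝ (ι x) e = 0
  decomp : ∀ v, ι (P v) + inner ℝ v e • e = v

section NormalFactor

variable {W : Type*} [NormedAddCommGroup W]

/-- The normalizing factor of the upward normal of a graph with gradient `v`. -/
def normalFactor (v : W) : ℝ := (√(1 + ‖v‖ ^ 2))⁻¹

lemma normalFactor_pos (v : W) : 0 < normalFactor v := by
  unfold normalFactor; positivity

lemma normalFactor_sq (v : W) : normalFactor v ^ 2 * (1 + ‖v‖ ^ 2) = 1 := by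
  unfold normalFactor
  rw [inv_pow, Real.sq_sqrt (by positivity)]
  exact inv_mul_cancel₀ (by positivity)

lemma eq_normalFactor {v : W} {c : ℝ} (hc : 0 < c) (h : c ^ 2 * (1 + ‖v‖ ^ 2) = 1) :
    c = normalFactor v := by
  have h2 := normalFactor_sq v
  have h3 : c ^ 2 = normalFactor v ^ 2 := by
    have : (0 : ℝ) < 1 + ‖v‖ ^ 2 := by positivity
    exact mul_right_cancel₀ this.ne' (h.trans h2.symm)
  exact (pow_left_inj₀ hc.le (normalFactor_pos v).le two_ne_zero).1 h3

end NormalFactor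

section Chart

variable {W V : Type*} [NormedAddCommGroup W] [InnerProductSpace ℝ W]
  [NormedAddCommGroup V] [InnerProductSpace ℝ V] (fr : NormalFrame W V)

namespace NormalFrame

lemma inner_add_e (x : W) (z : ℝ) : inner ℝ (fr.ι x + z • fr.e) fr.e = z := by
  rw [inner_add_left, fr.inner_ι_e, inner_smul_left, real_inner_self_eq_norm_sq, fr.norm_e]
  simp

lemma P_add (x : W) (z : ℝ) : fr.P (fr.ι x + z • fr.e) = x := by
  have h := fr.decomp (fr.ι x + z • fr.e)
  rw [inner_add_e] at h
  exact fr.ι.injective (add_right_cancel h)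

lemma inner_add_add (x y : W) (z w : ℝ) :
    inner ℝ (fr.ι x + z • fr.e) (fr.ι y + w • fr.e) = inner ℝ x y + z * w := by
  rw [inner_add_right, inner_smul_right, inner_add_e, inner_add_left, fr.ι.inner_map_map,
    inner_smul_left, real_inner_comm (fr.ι y) fr.e,
    fr.inner_ι_e]
  simp [mul_comm]

lemma norm_add_sq (x : W) (z : ℝ) : ‖fr.ι x + z • fr.e‖ ^ 2 = ‖x‖ ^ 2 + z ^ 2 := by
  rw [← real_inner_self_eq_norm_sq, inner_add_add, real_inner_self_eq_norm_sq, sq z]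

lemma norm_sq (v : V) : ‖v‖ ^ 2 = ‖fr.P v‖ ^ 2 + inner ℝ v fr.e ^ 2 := by
  conv_lhs => rw [← fr.decomp v, norm_add_sq]

lemma norm_P_le (v : V) : ‖fr.P v‖ ≤ ‖v‖ := by
  have := fr.norm_sq v
  exact (sq_le_sq₀ (norm_nonneg _) (norm_nonneg _)).1 (by nlinarith [sq_nonneg (inner ℝ v fr.e)])

lemma P_e : fr.P fr.e = 0 := by
  have := fr.P_add 0 1
  simpa using this

lemma norm_add_le (x : W) (z : ℝ) : ‖fr.ι x + z • fr.e‖ ≤ ‖x‖ + |z| := by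
  refine (_root_.norm_add_le _ _).trans ?_
  rw [fr.ι.norm_map, norm_smul, fr.norm_e, mul_one, Real.norm_eq_abs]

/-- The point with coordinates `(x, z)` in the frame translated to `p`. -/
def pt (p : V) (x : W) (z : ℝ) : V := p + (fr.ι x + z • fr.e)

lemma pt_sub_pt (p : V) (x y : W) (z w : ℝ) :
    fr.pt p x z - fr.pt p y w = fr.ι (x - y) + (z - w) • fr.e := by
  rw [pt, pt, map_sub, sub_smul]; abel

lemma pt_sub (p : V) (x : W) (z : ℝ) : fr.pt p x z - p = fr.ι x + z • fr.e := by
  rw [pt, add_sub_cancel_left]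

lemma pt_decomp (p q : V) : fr.pt p (fr.P (q - p)) (inner ℝ (q - p) fr.e) = q := by
  rw [pt, fr.decomp, add_sub_cancel]

end NormalFrame

variable {R : ℝ} {E : Set V} {p : V}

lemma exists_pt_mem_frontier (hR : 0 < R) (hE : IsClosed E) (hp : IsOuterNormal R E p fr.e)
    {x : W} (hx : ‖x‖ < R / 16) :
    ∃ z ∈ Icc (-(R / 16)) (R / 16), fr.pt p x z ∈ frontier E := by
  have hcont : Continuous fun z : ℝ => fr.pt p x z := by
    unfold NormalFrame.pt; fun_prop
  have hx2 : ‖x‖ ^ 2 < (R / 16) ^ 2 := by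
    have := norm_nonneg x
    gcongr
  have htop : fr.pt p x (R / 16) ∉ E := by
    refine hp.add_smul_notMem hR ?_
    rw [fr.norm_add_sq, fr.inner_add_e]
    nlinarith
  have hbot : fr.pt p x (-(R / 16)) ∈ E := by
    have : fr.pt p x (-(R / 16)) = p - (fr.ι (-x) + (R / 16) • fr.e) := by
      simp only [NormalFrame.pt, map_neg, neg_smul]; abel
    rw [this]
    refine interior_subset (hp.sub_mem_interior hR ?_)
    rw [fr.norm_add_sq, fr.inner_add_e, norm_neg]
    nlinarith
  have hK : IsCompact (Icc (-(R / 16)) (R / 16) ∩ (fun z : ℝ => fr.pt p x z) ⁻¹' E) :=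
    isCompact_Icc.inter_right (hE.preimage hcont)
  obtain ⟨z, ⟨hz1, hz2⟩, hz3⟩ := hK.exists_isGreatest ⟨-(R / 16), ⟨le_rfl, by linarith⟩, hbot⟩
  refine ⟨z, hz1, subset_closure hz2, fun hi => ?_⟩
  have hlt : z < R / 16 := lt_of_le_of_ne hz1.2 (by rintro rfl; exact htop hz2)
  have h1 : ∀ᶠ w in 𝓝[>] z, fr.pt p x w ∈ E :=
    ((hcont.tendsto z).eventually (isOpen_interior.mem_nhds hi)).mono
      (fun _ h => interior_subset h) |>.filter_mono nhdsWithin_le_nhds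
  have h2 : ∀ᶠ w in 𝓝[>] z, w < R / 16 := (eventually_lt_nhds hlt).filter_mono nhdsWithin_le_nhds
  obtain ⟨w, ⟨h3, h4⟩, h5⟩ := ((h1.and h2).and self_mem_nhdsWithin).exists
  have h5' : z < w := h5
  have := hz3 ⟨⟨by linarith [hz1.1], h4.le⟩, h3⟩
  linarith

lemma norm_sub_e_le (hR : 0 < R) (hp : IsOuterNormal R E p fr.e) {x : W} {z : ℝ} {ν : V}
    (hx : ‖x‖ < R / 16) (hz : |z| < R / 8) (hν : IsOuterNormal R E (fr.pt p x z) ν) :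
    9 / 10 ≤ inner ℝ ν fr.e ∧ ‖fr.P ν‖ ≤ 1 / 7 := by
  have h := hν.mul_norm_sub_le hR hp
  rw [fr.pt_sub] at h
  have hx2 : ‖x‖ ^ 2 < (R / 16) ^ 2 := by
    have := norm_nonneg x
    gcongr
  have hz2 : z ^ 2 < (R / 8) ^ 2 := by
    rw [← sq_abs z]
    have := abs_nonneg z
    gcongr
  have h2 := pow_le_pow_left₀ (by positivity) h 2
  rw [fr.norm_add_sq, mul_pow] at h2
  have h3 : ‖ν - fr.e‖ ^ 2 ≤ 5 / 256 := by
    have : R ^ 2 * ‖ν - fr.e‖ ^ 2 ≤ R ^ 2 * (5 / 256) := by nlinarith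
    exact le_of_mul_le_mul_left this (by positivity)
  have h4 := norm_sub_sq_real ν fr.e
  rw [hν.norm_eq, fr.norm_e] at h4
  refine ⟨by nlinarith, ?_⟩
  have h5 := fr.norm_P_le (ν - fr.e)
  rw [map_sub, fr.P_e, sub_zero] at h5
  exact (sq_le_sq₀ (norm_nonneg _) (by norm_num)).1 (by nlinarith [norm_nonneg (fr.P ν)])

lemma pt_add_notMem (hR : 0 < R) {x : W} {z h : ℝ} {ν : V}
    (hν : IsOuterNormal R E (fr.pt p x z) ν) (hνe : 9 / 10 ≤ inner ℝ ν fr.e)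
    (h0 : 0 < h) (hh : h < R) : fr.pt p x (z + h) ∉ E := by
  have : fr.pt p x (z + h) = fr.pt p x z + h • fr.e := by
    simp only [NormalFrame.pt, add_smul]; abel
  rw [this]
  refine hν.add_smul_notMem hR ?_
  rw [norm_smul, fr.norm_e, inner_smul_left, real_inner_comm, Real.norm_of_nonneg h0.le]
  simp only [conj_trivial]
  have := mul_pos h0 hR
  nlinarith

lemma pt_sub_mem_interior (hR : 0 < R) {x : W} {z h : ℝ} {ν : V}
    (hν : IsOuterNormal R E (fr.pt p x z) ν) (hνe : 9 / 10 ≤ inner ℝ ν fr.e)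
    (h0 : 0 < h) (hh : h < R) : fr.pt p x (z - h) ∈ interior E := by
  have : fr.pt p x (z - h) = fr.pt p x z - h • fr.e := by
    simp only [NormalFrame.pt, sub_smul]; abel
  rw [this]
  refine hν.sub_mem_interior hR ?_
  rw [norm_smul, fr.norm_e, inner_smul_left, real_inner_comm, Real.norm_of_nonneg h0.le]
  simp only [conj_trivial]
  have := mul_pos h0 hR
  nlinarith

/-- The upward unit normal of a graph with gradient `v`. -/
def NormalFrame.graphNormal (v : W) : V :=
  fr.ι (-(normalFactor v • v)) + normalFactor v • fr.e

/-- `f` is a `C^{1,1}` chart of `∂E` around `p` in the frame `fr`. -/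
structure IsChart [CompleteSpace W] (R : ℝ) (E : Set V) (p : V) (f : W → ℝ) : Prop where
  abs_lt : ∀ x ∈ ball (0 : W) (R / 16), |f x| < R / 8
  mem_iff : ∀ x ∈ ball (0 : W) (R / 16), ∀ z ∈ Ioo (-(R / 8)) (R / 8),
    (fr.pt p x z ∈ E ↔ z ≤ f x)
  mem_frontier_iff : ∀ x ∈ ball (0 : W) (R / 16), ∀ z ∈ Ioo (-(R / 8)) (R / 8),
    (fr.pt p x z ∈ frontier E ↔ z = f x)
  hasGradientAt : ∀ x ∈ ball (0 : W) (R / 16), HasGradientAt f (gradient f x) x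
  lipschitz : LipschitzOnWith (Real.toNNReal (8 / R)) (gradient f) (ball (0 : W) (R / 16))
  isOuterNormal : ∀ x ∈ ball (0 : W) (R / 16),
    IsOuterNormal R E (fr.pt p x (f x)) (fr.graphNormal (gradient f x))
  gradient_zero : gradient f 0 = 0
  map_zero : f 0 = 0

variable {fr} in
lemma IsOuterNormal.abs_inner_pt_le (hR : 0 < R) (hE : IsClosed E) {x y : W} {z w : ℝ} {ν : V}
    (hx : IsOuterNormal R E (fr.pt p x z) ν) (hy : fr.pt p y w ∈ frontier E) :
    2 * R * |inner ℝ (y - x) (fr.P ν) + (w - z) * inner ℝ ν fr.e|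
      ≤ ‖y - x‖ ^ 2 + (w - z) ^ 2 := by
  have h1 := hx.inner_le hR (hE.frontier_subset hy)
  have h2 := hx.neg_le_inner hR hy
  have e : inner ℝ (fr.pt p y w - fr.pt p x z) ν =
      inner ℝ (y - x) (fr.P ν) + (w - z) * inner ℝ ν fr.e := by
    conv_lhs => rw [← fr.decomp ν, fr.pt_sub_pt, fr.inner_add_add]
  rw [e, fr.pt_sub_pt, fr.norm_add_sq] at h1 h2
  rw [← abs_of_pos (show 0 < 2 * R by positivity), ← abs_mul, abs_le]
  constructor <;> linarith

theorem exists_isChart [CompleteSpace W] (hR : 0 < R) (hE : IsClosed E)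
    (hN : ∀ q ∈ frontier E, ∃ ν, IsOuterNormal R E q ν) (hp : IsOuterNormal R E p fr.e) :
    ∃ f : W → ℝ, IsChart fr R E p f := by
  have H : ∀ x : W, ∃ z : ℝ, ∃ ν : V, x ∈ ball (0 : W) (R / 16) →
      |z| ≤ R / 16 ∧ IsOuterNormal R E (fr.pt p x z) ν := by
    intro x
    by_cases hx : x ∈ ball (0 : W) (R / 16)
    · obtain ⟨z, hz, hz2⟩ := exists_pt_mem_frontier fr hR hE hp (mem_ball_zero_iff.1 hx)
      obtain ⟨ν, hν⟩ := hN _ hz2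
      exact ⟨z, ν, fun _ => ⟨abs_le.2 hz, hν⟩⟩
    · exact ⟨0, 0, fun h => absurd h hx⟩
  choose f N hfN using H
  have hf : ∀ x ∈ ball (0 : W) (R / 16), |f x| < R / 8 := fun x hx =>
    (hfN x hx).1.trans_lt (by linarith)
  have hnu : ∀ x ∈ ball (0 : W) (R / 16), IsOuterNormal R E (fr.pt p x (f x)) (N x) :=
    fun x hx => (hfN x hx).2
  have hc : ∀ x ∈ ball (0 : W) (R / 16),
      9 / 10 ≤ inner ℝ (N x) fr.e ∧ ‖fr.P (N x)‖ ≤ 1 / 7 := fun x hx =>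
    norm_sub_e_le fr hR hp (mem_ball_zero_iff.1 hx) (hf x hx) (hnu x hx)
  have hmem : ∀ x ∈ ball (0 : W) (R / 16), fr.pt p x (f x) ∈ E := fun x hx =>
    hE.frontier_subset (hnu x hx).mem_frontier
  have habove : ∀ x ∈ ball (0 : W) (R / 16), ∀ z ∈ Ioo (-(R / 8)) (R / 8), f x < z →
      fr.pt p x z ∉ E := by
    intro x hx z hz hlt
    have h1 := abs_lt.1 (hf x hx)
    have := pt_add_notMem fr (h := z - f x) hR (hnu x hx) (hc x hx).1 (by linarith)
      (by linarith [hz.2])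
    rwa [add_sub_cancel] at this
  have hbelow : ∀ x ∈ ball (0 : W) (R / 16), ∀ z ∈ Ioo (-(R / 8)) (R / 8), z < f x →
      fr.pt p x z ∈ interior E := by
    intro x hx z hz hlt
    have h1 := abs_lt.1 (hf x hx)
    have := pt_sub_mem_interior fr (h := f x - z) hR (hnu x hx) (hc x hx).1 (by linarith)
      (by linarith [hz.1])
    rwa [_root_.sub_sub_cancel] at this
  have hlip : ∀ x ∈ ball (0 : W) (R / 16), ∀ y ∈ ball (0 : W) (R / 16),
      |f y - f x| ≤ ‖y - x‖ := by
    intro x hx y hy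
    have h1 := (hnu x hx).abs_inner_pt_le hR hE (hnu y hy).mem_frontier
    obtain ⟨h2, h3⟩ := hc x hx
    have h4 : ‖y - x‖ ≤ R / 8 := by
      have := norm_sub_le y x
      rw [mem_ball_zero_iff] at hx hy
      linarith
    have h5 : |f y - f x| ≤ R / 8 := by
      have := abs_sub (f y) (f x)
      linarith [(hfN x hx).1, (hfN y hy).1]
    have h6 : |inner ℝ (y - x) (fr.P (N x))| ≤ ‖y - x‖ * (1 / 7) :=
      (abs_real_inner_le_norm _ _).trans (by gcongr)
    have h7 : |f y - f x| * (9 / 10) ≤ |(f y - f x) * inner ℝ (N x) fr.e| := by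
      rw [abs_mul]
      gcongr
      exact h2.trans (le_abs_self _)
    have h8 : |(f y - f x) * inner ℝ (N x) fr.e| ≤
        |inner ℝ (y - x) (fr.P (N x)) + (f y - f x) * inner ℝ (N x) fr.e| +
        |inner ℝ (y - x) (fr.P (N x))| := by
      have := abs_sub (inner ℝ (y - x) (fr.P (N x)) + (f y - f x) * inner ℝ (N x) fr.e)
        (inner ℝ (y - x) (fr.P (N x)))
      rwa [add_sub_cancel_left] at this
    have h9 : ‖y - x‖ ^ 2 + (f y - f x) ^ 2 ≤ R / 8 * (‖y - x‖ + |f y - f x|) := by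
      rw [← sq_abs (f y - f x)]
      nlinarith [norm_nonneg (y - x), abs_nonneg (f y - f x)]
    have h10 : |inner ℝ (y - x) (fr.P (N x)) + (f y - f x) * inner ℝ (N x) fr.e| ≤
        (‖y - x‖ + |f y - f x|) / 16 := by
      have : 2 * R * |inner ℝ (y - x) (fr.P (N x)) + (f y - f x) * inner ℝ (N x) fr.e| ≤
        2 * R * ((‖y - x‖ + |f y - f x|) / 16) := h1.trans (h9.trans (le_of_eq (by ring)))
      exact le_of_mul_le_mul_left this (by positivity)
    have := norm_nonneg (y - x)
    linarith
  set F : W → W := fun x => -((inner ℝ (N x) fr.e)⁻¹ • fr.P (N x)) with hF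
  have hgrad : ∀ x ∈ ball (0 : W) (R / 16), HasGradientAt f (F x) x := by
    intro x hx
    have hcpos : 0 < inner ℝ (N x) fr.e := lt_of_lt_of_le (by norm_num) (hc x hx).1
    rw [hasGradientAt_iff_isLittleO]
    have hlo : (fun y : W => ‖y - x‖ ^ 2) =o[𝓝 x] fun y => y - x :=
      Asymptotics.isLittleO_pow_sub_sub x one_lt_two
    refine Asymptotics.IsBigO.trans_isLittleO (Asymptotics.IsBigO.of_bound (2 / R) ?_) hlo
    filter_upwards [isOpen_ball.mem_nhds hx] with y hy
    have h1 := (hnu x hx).abs_inner_pt_le hR hE (hnu y hy).mem_frontier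
    have e : f y - f x - inner ℝ (F x) (y - x) = (inner ℝ (N x) fr.e)⁻¹ *
        (inner ℝ (y - x) (fr.P (N x)) + (f y - f x) * inner ℝ (N x) fr.e) := by
      simp only [hF, inner_neg_left, inner_smul_left, conj_trivial,
        real_inner_comm (y - x) (fr.P (N x))]
      field_simp
      ring
    have h2 : (f y - f x) ^ 2 ≤ ‖y - x‖ ^ 2 := by
      rw [← sq_abs]
      have := hlip x hx y hy
      gcongr
    have h3 : |inner ℝ (y - x) (fr.P (N x)) + (f y - f x) * inner ℝ (N x) fr.e|
        ≤ ‖y - x‖ ^ 2 / R := by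
      rw [le_div_iff₀ hR]
      linarith
    rw [e, norm_mul, Real.norm_eq_abs, Real.norm_eq_abs, abs_of_pos (inv_pos.2 hcpos), norm_pow,
      norm_norm]
    have h4 : (inner ℝ (N x) fr.e)⁻¹ ≤ 2 := by
      rw [inv_le_comm₀ hcpos two_pos]
      linarith [(hc x hx).1]
    calc _ ≤ 2 * (‖y - x‖ ^ 2 / R) := mul_le_mul h4 h3 (abs_nonneg _) two_pos.le
      _ = _ := by ring
  have hgF : ∀ x ∈ ball (0 : W) (R / 16), gradient f x = F x := fun x hx => (hgrad x hx).gradient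
  have hNF : ∀ x ∈ ball (0 : W) (R / 16), N x = fr.graphNormal (F x) := by
    intro x hx
    have hcpos : 0 < inner ℝ (N x) fr.e := lt_of_lt_of_le (by norm_num) (hc x hx).1
    have e1 : fr.P (N x) = -(inner ℝ (N x) fr.e • F x) := by
      simp [hF, smul_smul, hcpos.ne']
    have h1 := fr.norm_sq (N x)
    rw [(hnu x hx).norm_eq, e1, norm_neg, norm_smul, Real.norm_of_nonneg hcpos.le] at h1
    have e2 : inner ℝ (N x) fr.e = normalFactor (F x) := eq_normalFactor hcpos (by linarith)
    conv_lhs => rw [← fr.decomp (N x), e1, e2]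
    rfl
  have h00 : (0 : W) ∈ ball (0 : W) (R / 16) := mem_ball_self (by positivity)
  have hpt0 : fr.pt p 0 0 = p := by simp [NormalFrame.pt]
  have hf0 : f 0 = 0 := by
    by_contra hne
    have hI : (0 : ℝ) ∈ Ioo (-(R / 8)) (R / 8) := ⟨by linarith, by linarith⟩
    rcases lt_or_gt_of_ne hne with h | h
    · have := habove 0 h00 0 hI h
      rw [hpt0] at this
      exact this (hE.frontier_subset hp.mem_frontier)
    · have := hbelow 0 h00 0 hI h
      rw [hpt0] at this
      exact hp.mem_frontier.2 this
  refine ⟨f, hf, ?_, ?_, ?_, ?_, ?_, ?_, hf0⟩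
  · intro x hx z hz
    constructor
    · intro h
      by_contra! h'
      exact habove x hx z hz h' h
    · intro h
      rcases h.eq_or_lt with rfl | h
      · exact hmem x hx
      · exact interior_subset (hbelow x hx z hz h)
  · intro x hx z hz
    constructor
    · intro h
      rcases lt_trichotomy z (f x) with h' | h' | h'
      · exact absurd (hbelow x hx z hz h') h.2
      · exact h'
      · exact absurd (hE.frontier_subset h) (habove x hx z hz h')
    · rintro rfl
      exact (hnu x hx).mem_frontier
  · intro x hx
    rw [hgF x hx]
    exact hgrad x hx
  · refine LipschitzOnWith.of_dist_le_mul fun x hx y hy => ?_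
    rw [hgF x hx, hgF y hy, Real.coe_toNNReal _ (by positivity), dist_eq_norm, dist_eq_norm]
    obtain ⟨cx, px⟩ := hc x hx
    obtain ⟨cy, py⟩ := hc y hy
    have hcx : 0 < inner ℝ (N x) fr.e := by linarith
    have hcy : 0 < inner ℝ (N y) fr.e := by linarith
    set δ := ‖N x - N y‖ with hδ
    have h1 : R * δ ≤ 2 * ‖x - y‖ := by
      have := (hnu x hx).mul_norm_sub_le hR (hnu y hy)
      rw [fr.pt_sub_pt] at this
      have h2 := fr.norm_add_le (x - y) (f x - f y)
      have h3 := hlip y hy x hx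
      linarith
    have h2 : |inner ℝ (N x) fr.e - inner ℝ (N y) fr.e| ≤ δ := by
      rw [← inner_sub_left]
      refine (abs_real_inner_le_norm _ _).trans ?_
      rw [fr.norm_e, mul_one]
    have h3 : ‖fr.P (N x) - fr.P (N y)‖ ≤ δ := by
      rw [← map_sub]
      exact fr.norm_P_le _
    have e : F x - F y = -((inner ℝ (N x) fr.e)⁻¹ • (fr.P (N x) - fr.P (N y)) +
        ((inner ℝ (N x) fr.e)⁻¹ - (inner ℝ (N y) fr.e)⁻¹) • fr.P (N y)) := by
      simp only [hF, smul_sub, sub_smul]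
      abel
    have h4 : (inner ℝ (N x) fr.e)⁻¹ ≤ 10 / 9 := by
      rw [inv_le_comm₀ hcx (by norm_num)]
      linarith
    have h4' : (inner ℝ (N y) fr.e)⁻¹ ≤ 10 / 9 := by
      rw [inv_le_comm₀ hcy (by norm_num)]
      linarith
    have h5 : |(inner ℝ (N x) fr.e)⁻¹ - (inner ℝ (N y) fr.e)⁻¹| ≤ 2 * δ := by
      rw [inv_sub_inv hcx.ne' hcy.ne', div_eq_mul_inv, mul_inv, abs_mul, abs_mul,
        abs_of_pos (inv_pos.2 hcx), abs_of_pos (inv_pos.2 hcy), abs_sub_comm]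
      have : (inner ℝ (N x) fr.e)⁻¹ * (inner ℝ (N y) fr.e)⁻¹ ≤ 10 / 9 * (10 / 9) := by
        gcongr
      calc _ ≤ δ * (10 / 9 * (10 / 9)) := by gcongr
        _ ≤ 2 * δ := by
          have : 0 ≤ δ := norm_nonneg _
          linarith
    have h6 : ‖F x - F y‖ ≤ 10 / 9 * δ + 2 * δ * (1 / 7) := by
      rw [e, norm_neg]
      refine (_root_.norm_add_le _ _).trans ?_
      rw [norm_smul, norm_smul, Real.norm_of_nonneg (inv_pos.2 hcx).le, Real.norm_eq_abs]
      gcongr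
    have h7 : δ ≤ 2 * ‖x - y‖ / R := by
      rw [le_div_iff₀ hR]
      linarith
    have : 0 ≤ δ := norm_nonneg _
    calc _ ≤ 4 * δ := by linarith
      _ ≤ 4 * (2 * ‖x - y‖ / R) := by gcongr
      _ = _ := by ring
  · intro x hx
    rw [hgF x hx, ← hNF x hx]
    exact hnu x hx
  · rw [hgF 0 h00]
    have : N 0 = fr.e := by
      have h := hnu 0 h00
      rw [hf0, hpt0] at h
      exact h.unique hR hp
    simp only [hF, this, fr.P_e, smul_zero, neg_zero]

end Chart

section StdFrame

variable {n : ℕ}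

lemma emb_apply_lt (x : En (n - 1)) (z : ℝ) (i : Fin n) (h : (i : ℕ) < n - 1) :
    emb n x z i = x ⟨i, h⟩ := by
  simp [emb, h]

lemma emb_apply_last (x : En (n - 1)) (z : ℝ) (i : Fin n) (h : ¬ (i : ℕ) < n - 1) :
    emb n x z i = z := by
  simp [emb, h]

lemma emb_add_emb (x y : En (n - 1)) (z w : ℝ) :
    emb n x z + emb n y w = emb n (x + y) (z + w) := by
  ext i
  by_cases h : (i : ℕ) < n - 1
  · simp [emb_apply_lt _ _ _ h]
  · simp [emb_apply_last _ _ _ h]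

lemma smul_emb (c : ℝ) (x : En (n - 1)) (z : ℝ) : c • emb n x z = emb n (c • x) (c * z) := by
  ext i
  by_cases h : (i : ℕ) < n - 1
  · simp [emb_apply_lt _ _ _ h]
  · simp [emb_apply_last _ _ _ h]

lemma inner_emb_emb (hn : 2 ≤ n) (x y : En (n - 1)) (z w : ℝ) :
    inner ℝ (emb n x z) (emb n y w) = inner ℝ x y + z * w := by
  obtain ⟨m, rfl⟩ : ∃ m, n = m + 1 := ⟨n - 1, by omega⟩
  rw [PiLp.inner_apply, PiLp.inner_apply, Fin.sum_univ_castSucc]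
  congr 1
  · refine Finset.sum_congr rfl fun i _ => ?_
    rw [emb_apply_lt x z i.castSucc (by simp), emb_apply_lt y w i.castSucc (by simp)]
    rfl
  · rw [emb_apply_last x z (Fin.last m) (by simp), emb_apply_last y w (Fin.last m) (by simp)]
    simp [mul_comm]

/-- The frame of `ℝⁿ` given by the splitting `ℝⁿ⁻¹ × ℝ`. -/
def stdFrame (hn : 2 ≤ n) : NormalFrame (En (n - 1)) (En n) where
  ι :=
    { toFun := fun x => emb n x 0
      map_add' := fun x y => by rw [emb_add_emb, add_zero]
      map_smul' := fun c x => by rw [RingHom.id_apply, smul_emb, mul_zero]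
      norm_map' := fun x => by
        rw [← sq_eq_sq₀ (norm_nonneg _) (norm_nonneg _), ← real_inner_self_eq_norm_sq,
          ← real_inner_self_eq_norm_sq]
        exact (inner_emb_emb hn x x 0 0).trans (by simp) }
  e := emb n 0 1
  P := LinearMap.toContinuousLinearMap
    { toFun := fun v => WithLp.toLp 2 fun i : Fin (n - 1) => v ⟨i, by omega⟩
      map_add' := fun v w => by ext i; simp
      map_smul' := fun c v => by ext i; simp }
  norm_e := by
    rw [← sq_eq_sq₀ (norm_nonneg _) zero_le_one, ← real_inner_self_eq_norm_sq, inner_emb_emb hn]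
    simp
  inner_ι_e x := (inner_emb_emb hn x 0 0 1).trans (by simp)
  decomp v := by
    have hl : v = emb n (WithLp.toLp 2 fun i : Fin (n - 1) => v ⟨i, by omega⟩)
        (v ⟨n - 1, by omega⟩) := by
      ext i
      by_cases h : (i : ℕ) < n - 1
      · rw [emb_apply_lt _ _ _ h]
      · rw [emb_apply_last _ _ _ h]
        exact congrArg v (Fin.ext (show (i : ℕ) = n - 1 by omega))
    have h2 : inner ℝ v (emb n 0 1) = v ⟨n - 1, by omega⟩ := by
      conv_lhs => rw [hl, inner_emb_emb hn]
      simp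
    rw [h2, smul_emb]
    conv_rhs => rw [hl]
    refine (emb_add_emb _ _ _ _).trans ?_
    simp

lemma stdFrame_add (hn : 2 ≤ n) (x : En (n - 1)) (z : ℝ) :
    (stdFrame hn).ι x + z • (stdFrame hn).e = emb n x z := by
  change emb n x 0 + z • emb n 0 1 = _
  rw [smul_emb, emb_add_emb]
  simp

end StdFrame

section FrameMap

variable {W V : Type*} [NormedAddCommGroup W] [InnerProductSpace ℝ W]
  [NormedAddCommGroup V] [InnerProductSpace ℝ V]

/-- The image of a frame under a linear isometry. -/
def NormalFrame.map (fr : NormalFrame W V) (U : V ≃ₗᵢ[ℝ] V) : NormalFrame W V where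
  ι := U.toLinearIsometry.comp fr.ι
  e := U fr.e
  P := fr.P.comp (U.symm.toContinuousLinearEquiv : V →L[ℝ] V)
  norm_e := by rw [U.norm_map, fr.norm_e]
  inner_ι_e x := by
    change inner ℝ (U (fr.ι x)) (U fr.e) = 0
    rw [U.inner_map_map, fr.inner_ι_e]
  decomp v := by
    change U (fr.ι (fr.P (U.symm v))) + inner ℝ v (U fr.e) • U fr.e = v
    have h : inner ℝ v (U fr.e) = inner ℝ (U.symm v) fr.e := by
      rw [← U.inner_map_map (U.symm v), U.apply_symm_apply]
    rw [h, ← map_smul, ← map_add, fr.decomp, U.apply_symm_apply]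

lemma NormalFrame.map_add (fr : NormalFrame W V) (U : V ≃ₗᵢ[ℝ] V) (x : W) (z : ℝ) :
    (fr.map U).ι x + z • (fr.map U).e = U (fr.ι x + z • fr.e) := by
  rw [_root_.map_add, map_smul]
  rfl

lemma NormalFrame.exists_map_e_eq (fr : NormalFrame W V) {ν : V} (hν : ‖ν‖ = 1) :
    ∃ U : V ≃ₗᵢ[ℝ] V, (fr.map U).e = ν :=
  ⟨_, Submodule.reflection_sub (fr.norm_e.trans hν.symm)⟩

/-- The coordinates given by a frame. -/
def NormalFrame.coord [FiniteDimensional ℝ V] [FiniteDimensional ℝ W] (fr : NormalFrame W V) :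
    (W × ℝ) ≃L[ℝ] V :=
  LinearEquiv.toContinuousLinearEquiv
    { toFun := fun y => fr.ι y.1 + y.2 • fr.e
      map_add' := fun y y' => by simp only [Prod.fst_add, Prod.snd_add, _root_.map_add, add_smul]; abel
      map_smul' := fun c y => by simp [mul_smul]
      invFun := fun v => (fr.P v, inner ℝ v fr.e)
      left_inv := fun y => by simp only [fr.P_add, fr.inner_add_e]
      right_inv := fun v => fr.decomp v }

lemma NormalFrame.coord_apply [FiniteDimensional ℝ V] [FiniteDimensional ℝ W]
    (fr : NormalFrame W V) (y : W × ℝ) : fr.coord y = fr.ι y.1 + y.2 • fr.e := rfl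

end FrameMap

section FrameMeasure

variable {n : ℕ}

instance isAddHaarMeasure_hausdorff_sub_one [hn : Fact (2 ≤ n)] :
    (μH[(n : ℝ) - 1] : Measure (En (n - 1))).IsAddHaarMeasure := by
  have : (n : ℝ) - 1 = (Module.finrank ℝ (En (n - 1)) : ℕ) := by
    have := hn.out
    rw [finrank_euclideanSpace_fin]
    push_cast [Nat.cast_sub (by omega : 1 ≤ n)]
    rfl
  rw [this]
  exact isAddHaarMeasure_hausdorffMeasure

/-- Lebesgue measure in the coordinates of a frame, up to a normalizing constant. -/
theorem exists_volume_eq_smul_map_coord (hn : 2 ≤ n) :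
    ∃ κ : ℝ≥0∞, κ ≠ 0 ∧ κ ≠ ∞ ∧ ∀ U : En n ≃ₗᵢ[ℝ] En n, (volume : Measure (En n)) =
      κ • Measure.map ((stdFrame hn).map U).coord
        ((μH[(n : ℝ) - 1] : Measure (En (n - 1))).prod volume) := by
  have : Fact (2 ≤ n) := ⟨hn⟩
  set μ := (μH[(n : ℝ) - 1] : Measure (En (n - 1))).prod (volume : Measure ℝ)
  have hμ : (Measure.map (stdFrame hn).coord μ).IsAddHaarMeasure :=
    (stdFrame hn).coord.isAddHaarMeasure_map μ
  have key := Measure.isAddLeftInvariant_eq_smul (volume : Measure (En n))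
    (Measure.map (stdFrame hn).coord μ)
  refine ⟨(Measure.addHaarScalarFactor (volume : Measure (En n))
    (Measure.map (stdFrame hn).coord μ) : ℝ≥0), ?_, ENNReal.coe_ne_top, fun U => ?_⟩
  · intro h
    have h' := ENNReal.coe_eq_zero.1 h
    rw [h', zero_smul] at key
    exact NeZero.ne (volume : Measure (En n)) key
  · have hU := (U.measurePreserving).map_eq
    conv_lhs => rw [← hU, key]
    rw [ENNReal.smul_def, Measure.map_smul, Measure.map_map U.continuous.measurable
      (stdFrame hn).coord.continuous.measurable]
    have : (U ∘ (stdFrame hn).coord) = ((stdFrame hn).map U).coord := by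
      ext1 y
      rw [NormalFrame.coord_apply, NormalFrame.map_add]
      rfl
    rw [this]

lemma NormalFrame.pt_map_stdFrame (hn : 2 ≤ n) (U : En n ≃ₗᵢ[ℝ] En n) (p : En n)
    (x : En (n - 1)) (z : ℝ) :
    ((stdFrame hn).map U).pt p x z = p + U (emb n x z) := by
  rw [NormalFrame.pt, NormalFrame.map_add, stdFrame_add]

theorem IsCurvFuns.eq_Kp {hn : 2 ≤ n} {E : Set (En n)} {K : ℕ → En n → ℝ}
    (hK : IsCurvFuns n E K) {R : ℝ} (hR : 0 < R) {p : En n} {U : En n ≃ₗᵢ[ℝ] En n}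
    {f : En (n - 1) → ℝ} (hf : IsChart ((stdFrame hn).map U) R E p f)
    {x : En (n - 1)} (hx : x ∈ ball 0 (R / 16)) (hd : DifferentiableAt ℝ (gradient f) x)
    {k : ℕ} (hk : 1 ≤ k) (hk' : k ≤ n - 1) :
    K k (((stdFrame hn).map U).pt p x (f x)) = Kp n f k x := by
  have hfd : (fun y => fderiv ℝ f y) = fun y => InnerProductSpace.toDual ℝ _ (gradient f y) := by
    ext1 y; simp [gradient]
  have := hK (U.toIsometryEquiv.trans (IsometryEquiv.addLeft p)) (R / 16) (R / 8) (by positivity)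
    (by positivity) f ?_ ?_ x hx (hf.abs_lt x hx) ?_ k hk hk'
  · rw [NormalFrame.pt_map_stdFrame]
    exact this
  · refine ⟨fun y hy => (hf.hasGradientAt y hy).differentiableAt, Real.toNNReal (8 / R), ?_⟩
    rw [hfd]
    intro y hy z hz
    rw [LinearIsometryEquiv.edist_map]
    exact hf.lipschitz hy hz
  · ext q
    constructor
    · rintro ⟨hqE, _, ⟨y, hy, z, hz, rfl⟩, rfl⟩
      refine ⟨_, ⟨y, hy, z, hz, ?_, rfl⟩, rfl⟩
      rw [← hf.mem_iff y (mem_ball_zero_iff.2 hy) z hz, NormalFrame.pt_map_stdFrame]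
      exact hqE
    · rintro ⟨_, ⟨y, hy, z, hz, hzf, rfl⟩, rfl⟩
      refine ⟨?_, _, ⟨y, hy, z, hz, rfl⟩, rfl⟩
      have := (hf.mem_iff y (mem_ball_zero_iff.2 hy) z hz).2 hzf
      rw [NormalFrame.pt_map_stdFrame] at this
      exact this
  · rw [hfd]
    exact (InnerProductSpace.toDual ℝ (En (n - 1))).toContinuousLinearEquiv.differentiableAt.comp x hd

end FrameMeasure

section Weingarten

variable {W : Type*} [NormedAddCommGroup W] [InnerProductSpace ℝ W]

/-- The derivative of `F / √(1 + |F|²)`. -/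
def weingarten (F : W → W) (x : W) : W →L[ℝ] W := fderiv ℝ (fun y => normalFactor (F y) • F y) x

lemma hasFDerivAt_normalFactor {F : W → W} {x : W} (hF : DifferentiableAt ℝ F x) :
    HasFDerivAt (fun y => normalFactor (F y))
      ((-(normalFactor (F x) ^ 3)) • (innerSL ℝ (F x)).comp (fderiv ℝ F x)) x := by
  have h1 : HasFDerivAt (fun y => 1 + ‖F y‖ ^ 2) (2 • (innerSL ℝ (F x)).comp (fderiv ℝ F x)) x :=
    (hF.hasFDerivAt.norm_sq).const_add 1
  have hp : (0 : ℝ) < 1 + ‖F x‖ ^ 2 := by positivity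
  have h2 := (hasDerivAt_inv (Real.sqrt_ne_zero'.2 hp)).comp_hasFDerivAt x (h1.sqrt hp.ne')
  refine h2.congr_fderiv ?_
  ext v
  simp only [normalFactor, smul_apply, ContinuousLinearMap.comp_apply, smul_eq_mul, nsmul_eq_mul,
    Nat.cast_ofNat]
  have := Real.sqrt_ne_zero'.2 hp
  field_simp

lemma hasFDerivAt_weingarten {F : W → W} {x : W} (hF : DifferentiableAt ℝ F x) :
    HasFDerivAt (fun y => normalFactor (F y) • F y) (weingarten F x) x :=
  ((hasFDerivAt_normalFactor hF).differentiableAt.smul hF).hasFDerivAt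

lemma weingarten_apply {F : W → W} {x : W} (hF : DifferentiableAt ℝ F x) (v : W) :
    weingarten F x v = normalFactor (F x) • fderiv ℝ F x v -
      (normalFactor (F x) ^ 3 * inner ℝ (F x) (fderiv ℝ F x v)) • F x := by
  have h := ((hasFDerivAt_normalFactor hF).smul hF.hasFDerivAt).fderiv
  rw [weingarten, show (fun y => normalFactor (F y) • F y) = (fun y => normalFactor (F y)) • F
    from rfl, h]
  change normalFactor (F x) • fderiv ℝ F x v +
    (-(normalFactor (F x) ^ 3) * inner ℝ (F x) (fderiv ℝ F x v)) • F x = _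
  rw [neg_mul, neg_smul, ← sub_eq_add_neg]

omit [InnerProductSpace ℝ W] in
lemma normalFactor_le_one (v : W) : normalFactor v ≤ 1 := by
  have h1 := normalFactor_sq v
  have h2 := normalFactor_pos v
  nlinarith [sq_nonneg ‖v‖, sq_nonneg (normalFactor v)]

lemma norm_weingarten_le {F : W → W} {x : W} (hF : DifferentiableAt ℝ F x) :
    ‖weingarten F x‖ ≤ 2 * ‖fderiv ℝ F x‖ := by
  refine ContinuousLinearMap.opNorm_le_bound _ (by positivity) fun v => ?_
  rw [weingarten_apply hF]
  set a := normalFactor (F x)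
  have ha0 : 0 < a := normalFactor_pos _
  have ha1 : a ≤ 1 := normalFactor_le_one _
  have ha2 : a ^ 2 * (1 + ‖F x‖ ^ 2) = 1 := normalFactor_sq _
  have hH := (fderiv ℝ F x).le_opNorm v
  have hi := abs_real_inner_le_norm (F x) (fderiv ℝ F x v)
  refine (norm_sub_le _ _).trans ?_
  rw [norm_smul, norm_smul, Real.norm_of_nonneg ha0.le, Real.norm_eq_abs, abs_mul,
    abs_of_pos (pow_pos ha0 3)]
  have h1 : a * ‖fderiv ℝ F x v‖ ≤ ‖fderiv ℝ F x v‖ :=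
    mul_le_of_le_one_left (norm_nonneg _) ha1
  have h2 : a ^ 3 * |inner ℝ (F x) (fderiv ℝ F x v)| * ‖F x‖ ≤ ‖fderiv ℝ F x v‖ := by
    calc a ^ 3 * |inner ℝ (F x) (fderiv ℝ F x v)| * ‖F x‖
        ≤ a ^ 3 * (‖F x‖ * ‖fderiv ℝ F x v‖) * ‖F x‖ := by gcongr
      _ = (a * (a ^ 2 * ‖F x‖ ^ 2)) * ‖fderiv ℝ F x v‖ := by ring
      _ ≤ 1 * ‖fderiv ℝ F x v‖ := by
          gcongr
          have : a ^ 2 * ‖F x‖ ^ 2 ≤ 1 := by nlinarith [sq_nonneg a]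
          exact mul_le_one₀ ha1 (by positivity) this
      _ = _ := one_mul _
  linarith

end Weingarten

section Coefficients

lemma Matrix.det_one_sub_smul_eq_sum {ι : Type*} [Fintype ι] [DecidableEq ι] (A : Matrix ι ι ℝ)
    (t : ℝ) : (1 - t • A).det =
      ∑ p ∈ Finset.range (Fintype.card ι + 1), A.charpoly.coeff (Fintype.card ι - p) * t ^ p := by
  have h1 : (1 - t • A).det = A.charpolyRev.eval t := by
    rw [Matrix.charpolyRev, ← Polynomial.coe_evalRingHom, RingHom.map_det]
    congr 1
    ext i j
    by_cases h : i = j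
    · subst h; simp [mul_comm t]
    · simp [h, mul_comm t]
  have hd : A.charpoly.natDegree = Fintype.card ι := A.charpoly_natDegree_eq_dim
  rw [h1, ← Matrix.reverse_charpoly,
    Polynomial.eval_eq_sum_range' (n := Fintype.card ι + 1)
      (by have := A.charpoly.reverse_natDegree_le; omega)]
  refine Finset.sum_congr rfl fun p hp => ?_
  rw [Polynomial.coeff_reverse, hd, Polynomial.revAt_le (by simpa [Nat.lt_succ_iff] using hp)]

/-- Coefficients of a polynomial of degree less than `n` are fixed linear combinations of its
values at `n` distinct points. -/
lemma exists_coeff_eq_sum_eval {n : ℕ} {s : Fin n → ℝ} (hs : Function.Injective s) :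
    ∃ c : ℕ → Fin n → ℝ, ∀ a : ℕ → ℝ, ∀ p < n,
      a p = ∑ i, c p i * ∑ q ∈ Finset.range n, a q * s i ^ q := by
  have hdet : IsUnit (Matrix.vandermonde s).det :=
    isUnit_iff_ne_zero.2 (Matrix.det_vandermonde_ne_zero_iff.2 hs)
  refine ⟨fun p i => if h : p < n then (Matrix.vandermonde s)⁻¹ ⟨p, h⟩ i else 0,
    fun a p hp => ?_⟩
  have h1 : (Matrix.vandermonde s)⁻¹.mulVec ((Matrix.vandermonde s).mulVec fun q : Fin n => a q)
      = fun q : Fin n => a q := by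
    rw [Matrix.mulVec_mulVec, Matrix.nonsing_inv_mul _ hdet, Matrix.one_mulVec]
  have h2 := congrFun h1 ⟨p, hp⟩
  rw [← h2]
  simp only [Matrix.mulVec, dotProduct, dif_pos hp, Finset.sum_range, Matrix.vandermonde_apply]
  refine Finset.sum_congr rfl fun i _ => ?_
  congr 1
  exact Finset.sum_congr rfl fun q _ => mul_comm _ _

end Coefficients

section Curvature

variable {n : ℕ} {f : En (n - 1) → ℝ} {x : En (n - 1)}

lemma fderiv_apply_single_eq (i : Fin (n - 1)) : pd n f i = fun y => gradient f y i := by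
  ext1 y
  have h : fderiv ℝ f y = InnerProductSpace.toDual ℝ _ (gradient f y) := by simp [gradient]
  rw [pd, h, InnerProductSpace.toDual_apply_apply, EuclideanSpace.inner_single_right]
  simp

lemma pd2_eq (hd : DifferentiableAt ℝ (gradient f) x) (i j : Fin (n - 1)) :
    pd2 n f i j x = fderiv ℝ (gradient f) x (EuclideanSpace.single j 1) i := by
  rw [pd2, fderiv_apply_single_eq]
  have := ((EuclideanSpace.proj i : En (n - 1) →L[ℝ] ℝ).hasFDerivAt (x := gradient f x)).comp x
    hd.hasFDerivAt
  rw [HasFDerivAt.fderiv (f := fun y => gradient f y i) this]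
  rfl

lemma Gmat_inv_mul_Bmat (hd : DifferentiableAt ℝ (gradient f) x) :
    (Gmat n f x)⁻¹ * Bmat n f x = LinearMap.toMatrix (EuclideanSpace.basisFun _ ℝ).toBasis
      (EuclideanSpace.basisFun _ ℝ).toBasis (weingarten (gradient f) x : En (n - 1) →ₗ[ℝ] _) := by
  set F := gradient f x with hF
  set a := normalFactor F with ha
  have hfac : a ^ 2 * (1 + ‖F‖ ^ 2) = 1 := normalFactor_sq F
  have hG : Gmat n f x = 1 + Matrix.vecMulVec F F := by
    ext i j
    simp [Gmat, fderiv_apply_single_eq, Matrix.one_apply, Matrix.vecMulVec_apply, hF]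
  have hn2 : dotProduct (F : Fin (n - 1) → ℝ) F = ‖F‖ ^ 2 := by
    rw [EuclideanSpace.real_norm_sq_eq]
    simp [dotProduct, sq]
  have hinv : (Gmat n f x)⁻¹ = 1 - a ^ 2 • Matrix.vecMulVec F F := by
    apply Matrix.inv_eq_right_inv
    rw [hG, add_mul, one_mul, mul_sub, mul_one, mul_smul_comm, Matrix.vecMulVec_mul_vecMulVec, hn2]
    ext i j
    simp only [Matrix.add_apply, Matrix.sub_apply, Matrix.smul_apply, Matrix.vecMulVec_apply,
      smul_eq_mul, Pi.smul_apply]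
    linear_combination (-(F i * F j)) * hfac
  have hnorm : ‖fderiv ℝ f x‖ = ‖F‖ := by simp [hF, gradient]
  rw [hinv]
  ext i j
  rw [LinearMap.toMatrix_apply, sub_mul, one_mul, smul_mul_assoc, Matrix.vecMulVec_mul]
  have hB : ∀ k l, Bmat n f x k l =
      a * fderiv ℝ (gradient f) x (EuclideanSpace.single l 1) k := by
    intro k l
    rw [Bmat, pd2_eq hd, hnorm, ha, normalFactor, div_eq_inv_mul]
  simp only [OrthonormalBasis.coe_toBasis, EuclideanSpace.basisFun_apply,
    ContinuousLinearMap.coe_coe, weingarten_apply hd, OrthonormalBasis.coe_toBasis_repr_apply,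
    EuclideanSpace.basisFun_repr, PiLp.sub_apply, PiLp.smul_apply, smul_eq_mul, Matrix.sub_apply,
    Matrix.smul_apply, Matrix.vecMulVec_apply, Matrix.vecMul, dotProduct, hB]
  rw [PiLp.inner_apply, ← hF, ← ha]
  have : ∑ k, F k * (a * fderiv ℝ (gradient f) x (EuclideanSpace.single j 1) k) =
      a * ∑ k, inner ℝ (F k) (fderiv ℝ (gradient f) x (EuclideanSpace.single j 1) k) := by
    rw [Finset.mul_sum]
    refine Finset.sum_congr rfl fun k _ => ?_
    simp only [RCLike.inner_apply, conj_trivial]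
    ring
  rw [this]
  ring

lemma Kp_zero (f : En (n - 1) → ℝ) (x : En (n - 1)) : Kp n f 0 x = 1 := by
  have h := ((Gmat n f x)⁻¹ * Bmat n f x).charpoly_monic
  rw [Polynomial.Monic, Polynomial.leadingCoeff, Matrix.charpoly_natDegree_eq_dim,
    Fintype.card_fin] at h
  simp [Kp, h]

/-- The coefficients in the Steiner polynomial. -/
def steinerCoeff (n p : ℕ) : ℝ := (-1) ^ p * (n - 1).choose p

lemma steinerCoeff_ne_zero {p : ℕ} (hp : p < n) : steinerCoeff n p ≠ 0 := by
  refine mul_ne_zero (pow_ne_zero _ (by norm_num)) ?_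
  exact_mod_cast (Nat.choose_pos (by omega)).ne'

theorem det_one_sub_weingarten (hn : 2 ≤ n) (hd : DifferentiableAt ℝ (gradient f) x) (t : ℝ) :
    (1 - t • weingarten (gradient f) x).det =
      ∑ p ∈ Finset.range n, steinerCoeff n p * Kp n f p x * t ^ p := by
  have h1 : (1 - t • weingarten (gradient f) x).det =
      (1 - t • ((Gmat n f x)⁻¹ * Bmat n f x)).det := by
    rw [Gmat_inv_mul_Bmat hd, ContinuousLinearMap.det,
      ← LinearMap.det_toMatrix (EuclideanSpace.basisFun _ ℝ).toBasis]
    congr 1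
    rw [ContinuousLinearMap.toLinearMap_sub, ContinuousLinearMap.toLinearMap_smul, _root_.map_sub,
      map_smul]
    congr 1
    exact LinearMap.toMatrix_one _
  rw [h1, Matrix.det_one_sub_smul_eq_sum, Fintype.card_fin, Nat.sub_add_cancel (by omega)]
  refine Finset.sum_congr rfl fun p hp => ?_
  have hc : ((n - 1).choose p : ℝ) ≠ 0 := by
    have := Finset.mem_range.1 hp
    exact_mod_cast (Nat.choose_pos (by omega)).ne'
  have hs : (-1 : ℝ) ^ p * (-1) ^ p = 1 := by rw [← mul_pow]; simp
  rw [steinerCoeff, Kp]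
  field_simp
  rw [mul_comm, sq, hs, mul_one]

end Curvature

lemma exists_det_one_sub_mem (W : Type*) [NormedAddCommGroup W] [NormedSpace ℝ W]
    [FiniteDimensional ℝ W] (C : ℝ) :
    ∃ s₀ > (0 : ℝ), ∀ T : W →L[ℝ] W, ‖T‖ ≤ C → ∀ t ∈ Icc 0 s₀,
      (1 - t • T).det ∈ Icc (1 / 2 : ℝ) 2 := by
  have hc : ContinuousAt (fun A : W →L[ℝ] W => A.det) 1 :=
    ContinuousLinearMap.continuous_det.continuousAt
  have h1 : (1 : W →L[ℝ] W).det = 1 := by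
    rw [ContinuousLinearMap.det]; exact LinearMap.det_id
  have hmem : Icc (1 / 2 : ℝ) 2 ∈ 𝓝 (1 : W →L[ℝ] W).det := by
    rw [h1]; exact Icc_mem_nhds (by norm_num) (by norm_num)
  obtain ⟨δ, hδ, h⟩ := Metric.mem_nhds_iff.1 (hc hmem)
  refine ⟨δ / (2 * (|C| + 1)), by positivity, fun T hT t ht => h ?_⟩
  rw [mem_ball, dist_eq_norm, sub_sub_cancel_left, norm_neg, norm_smul, Real.norm_of_nonneg ht.1]
  calc t * ‖T‖ ≤ δ / (2 * (|C| + 1)) * (|C| + 1) := by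
        gcongr
        · exact ht.2
        · linarith [le_abs_self C]
    _ = δ / 2 := by field_simp
    _ < δ := by linarith

lemma MapClusterPt.eq_of_tendsto {α X Y : Type*} [TopologicalSpace X] [TopologicalSpace Y]
    [T2Space Y] {l : Filter α} {e : α → X} {q : X} (hq : MapClusterPt q l e) {g : X → Y} {c : Y}
    (hg : ContinuousAt g q) (h : Tendsto (fun k => g (e k)) l (𝓝 c)) : g q = c :=
  eq_of_nhds_neBot ((hq.continuousAt_comp hg).clusterPt.mono h)

section Nearest

variable {V : Type*} [NormedAddCommGroup V] [InnerProductSpace ℝ V]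

open Classical in
/-- A nearest point of `E`, if there is one. -/
def nearest (E : Set V) (y : V) : V :=
  if h : ∃ q ∈ E, infDist y E = dist y q then h.choose else 0

/-- The outer tubular neighborhood of `E` of width `s`. -/
def tube (E : Set V) (s : ℝ) : Set V := {y | 0 < infDist y E ∧ infDist y E < s}

variable {R s : ℝ} {E : Set V} {p y ν : V}

omit [InnerProductSpace ℝ V] in
lemma isOpen_tube : IsOpen (tube E s) :=
  (isOpen_lt continuous_const (continuous_infDist_pt E)).inter
    (isOpen_lt (continuous_infDist_pt E) continuous_const)

omit [InnerProductSpace ℝ V] in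
lemma notMem_of_mem_tube (hy : y ∈ tube E s) : y ∉ E := fun h =>
  hy.1.ne' (infDist_zero_of_mem h)

omit [InnerProductSpace ℝ V] in
lemma nonempty_of_mem_tube (hy : y ∈ tube E s) : E.Nonempty := by
  by_contra! h
  have := hy.1
  simp [h] at this

lemma IsOuterNormal.add_smul_mem_tube (hE : IsClosed E) (hR : 0 < R) (hp : IsOuterNormal R E p ν)
    (hs : s ≤ R) {t : ℝ} (ht : t ∈ Ioo 0 s) : p + t • ν ∈ tube E s := by
  have := hp.infDist_eq hE hR ht.1 (ht.2.trans_le hs)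
  exact ⟨this.symm ▸ ht.1, this.symm ▸ ht.2⟩

variable [FiniteDimensional ℝ V]

lemma nearest_spec (hE : IsClosed E) (hne : E.Nonempty) (y : V) :
    nearest E y ∈ E ∧ infDist y E = dist y (nearest E y) := by
  have h : ∃ q ∈ E, infDist y E = dist y q := hE.exists_infDist_eq_dist hne y
  rw [nearest, dif_pos h]
  exact h.choose_spec

lemma nearest_mem_frontier (hE : IsClosed E) (hy : y ∈ tube E s) : nearest E y ∈ frontier E := by
  obtain ⟨h1, h2⟩ := nearest_spec hE (nonempty_of_mem_tube hy) y
  exact mem_frontier_of_dist_eq_infDist h1 (notMem_of_mem_tube hy) h2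

lemma eq_nearest_add (hE : IsClosed E) (hR : 0 < R) (hy : y ∈ tube E s)
    (hν : IsOuterNormal R E (nearest E y) ν) : y = nearest E y + infDist y E • ν :=
  hν.eq_add_infDist_smul hR hE (notMem_of_mem_tube hy)
    (nearest_spec hE (nonempty_of_mem_tube hy) y).2

lemma IsOuterNormal.nearest_add_smul (hE : IsClosed E) (hR : 0 < R) (hp : IsOuterNormal R E p ν)
    {t : ℝ} (ht : t ∈ Ioo 0 R) : nearest E (p + t • ν) = p := by
  have h := nearest_spec hE ⟨p, hE.frontier_subset hp.mem_frontier⟩ (p + t • ν)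
  refine hp.eq_of_dist_le hR ht.1 ht.2 h.1 ?_
  rw [← h.2, hp.infDist_eq hE hR ht.1 ht.2]

lemma eq_nearest_of_dist_le (hE : IsClosed E) (hR : 0 < R) (hs : s ≤ R)
    (hN : ∀ q ∈ frontier E, ∃ ν, IsOuterNormal R E q ν) (hy : y ∈ tube E s) {q : V} (hq : q ∈ E)
    (h : dist y q ≤ infDist y E) : q = nearest E y := by
  obtain ⟨ν, hν⟩ := hN _ (nearest_mem_frontier hE hy)
  refine hν.eq_of_dist_le hR hy.1 (hy.2.trans_le hs) hq ?_
  rwa [← eq_nearest_add hE hR hy hν]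

/-- Almost nearest points converge to the nearest point. -/
lemma tendsto_nearest_of_tendsto (hE : IsClosed E) (hR : 0 < R) (hs : s ≤ R)
    (hN : ∀ q ∈ frontier E, ∃ ν, IsOuterNormal R E q ν) (hy : y ∈ tube E s) {α : Type*}
    {l : Filter α} {e : α → V} (h1 : Tendsto (fun k => infDist (e k) E) l (𝓝 0))
    (h2 : Tendsto (fun k => dist y (e k)) l (𝓝 (infDist y E))) :
    Tendsto e l (𝓝 (nearest E y)) := by
  have : ProperSpace V := FiniteDimensional.proper_real V
  refine (isCompact_closedBall y (infDist y E + 1)).tendsto_nhds_of_unique_mapClusterPt ?_ ?_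
  · filter_upwards [h2.eventually_le_const (lt_add_one _)] with k hk
    rwa [mem_closedBall, dist_comm]
  · intro q _ hq
    have hq1 : infDist q E = 0 :=
      hq.eq_of_tendsto (continuous_infDist_pt E).continuousAt h1
    have hq2 : dist y q = infDist y E :=
      hq.eq_of_tendsto (continuous_const.dist continuous_id).continuousAt h2
    exact eq_nearest_of_dist_le hE hR hs hN hy
      ((hE.mem_iff_infDist_zero (nonempty_of_mem_tube hy)).2 hq1) hq2.le

end Nearest

section LocalChart

variable {W V : Type*} [NormedAddCommGroup W] [InnerProductSpace ℝ W]
  [NormedAddCommGroup V] [InnerProductSpace ℝ V] {fr : NormalFrame W V}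

/-- The point of the graph of `f` over `x`. -/
def NormalFrame.graphPt (fr : NormalFrame W V) (p : V) (f : W → ℝ) (x : W) : V := fr.pt p x (f x)

/-- The cylinder around `p` in which a chart describes `∂E`. -/
def NormalFrame.cyl (fr : NormalFrame W V) (R : ℝ) (p : V) (δ : ℝ) : Set V :=
  {q | ‖fr.P (q - p)‖ < δ ∧ |inner ℝ (q - p) fr.e| < R / 8}

variable {R δ s : ℝ} {E A : Set V} {p : V} {f : W → ℝ}

lemma NormalFrame.isOpen_cyl : IsOpen (fr.cyl R p δ) := by
  have h1 : Continuous fun q : V => ‖fr.P (q - p)‖ := by fun_prop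
  have h2 : Continuous fun q : V => |(inner ℝ (q - p) fr.e : ℝ)| := by fun_prop
  exact (isOpen_lt h1 continuous_const).inter (isOpen_lt h2 continuous_const)

lemma NormalFrame.mem_cyl_self (hR : 0 < R) (hδ : 0 < δ) : p ∈ fr.cyl R p δ := by
  simp only [cyl, mem_ofPred_eq, sub_self, _root_.map_zero, norm_zero, inner_zero_left, abs_zero]
  exact ⟨hδ, by positivity⟩

lemma NormalFrame.P_graphPt (x : W) : fr.P (fr.graphPt p f x - p) = x := by
  rw [graphPt, pt_sub, P_add]

lemma NormalFrame.graphPt_sub (x y : W) : fr.graphPt p f x - fr.graphPt p f y =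
    fr.ι (x - y) + (f x - f y) • fr.e := fr.pt_sub_pt p x y _ _

/-- The part of the chart domain over `A`. -/
def NormalFrame.chartPreimage (fr : NormalFrame W V) (p : V) (f : W → ℝ) (δ : ℝ) (A : Set V) :
    Set W := ball 0 δ ∩ fr.graphPt p f ⁻¹' A

lemma NormalFrame.coord_tube [FiniteDimensional ℝ V] [FiniteDimensional ℝ W] (v : W) (x : W)
    (z t : ℝ) : fr.pt p x z + t • fr.graphNormal v =
      p + fr.coord (x - (t * normalFactor v) • v, z + t * normalFactor v) := by
  rw [coord_apply, pt, graphNormal]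
  simp only [_root_.map_sub, _root_.map_neg, map_smul, smul_add, smul_neg, smul_smul, add_smul]
  abel

variable [CompleteSpace W]

/-- The outward tube over the graph of `f` in coordinates. -/
def tubeMap (f : W → ℝ) (y : W × ℝ) : W × ℝ :=
  (y.1 - (y.2 * normalFactor (gradient f y.1)) • gradient f y.1,
    f y.1 + y.2 * normalFactor (gradient f y.1))

namespace IsChart

lemma eq_graphPt (hf : IsChart fr R E p f) (hδ : δ ≤ R / 16) {q : V} (hq : q ∈ frontier E)
    (hqc : q ∈ fr.cyl R p δ) : q = fr.graphPt p f (fr.P (q - p)) := by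
  have h := (hf.mem_frontier_iff (fr.P (q - p)) (mem_ball_zero_iff.2 (hqc.1.trans_le hδ))
    (inner ℝ (q - p) fr.e) (_root_.abs_lt.1 hqc.2)).1 (by rwa [fr.pt_decomp])
  rw [NormalFrame.graphPt, ← h, fr.pt_decomp]

lemma graphPt_mem_frontier (hf : IsChart fr R E p f) {x : W} (hx : x ∈ ball (0 : W) (R / 16)) :
    fr.graphPt p f x ∈ frontier E := (hf.isOuterNormal x hx).mem_frontier

lemma norm_gradient_le (hf : IsChart fr R E p f) (hR : 0 < R) {x : W}
    (hx : x ∈ ball (0 : W) (R / 16)) : ‖gradient f x‖ ≤ 8 / R * ‖x‖ := by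
  have h := hf.lipschitz.dist_le_mul x hx 0 (mem_ball_self (by positivity))
  rwa [hf.gradient_zero, dist_zero_right, dist_zero_right, Real.coe_toNNReal _ (by positivity)] at h

lemma abs_sub_le (hf : IsChart fr R E p f) (hR : 0 < R) (hδ : δ ≤ R / 16) {x y : W}
    (hx : x ∈ ball (0 : W) δ) (hy : y ∈ ball (0 : W) δ) :
    |f x - f y| ≤ 8 / R * δ * ‖x - y‖ := by
  have hsub : ball (0 : W) δ ⊆ ball 0 (R / 16) := ball_subset_ball hδ
  refine (convex_ball (0 : W) δ).norm_image_sub_le_of_norm_hasFDerivWithin_le (𝕜 := ℝ)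
    (f' := fun z => InnerProductSpace.toDual ℝ W (gradient f z))
    (fun z hz => (hf.hasGradientAt z (hsub hz)).hasFDerivAt.hasFDerivWithinAt) (fun z hz => ?_) hy hx
  rw [LinearIsometryEquiv.norm_map]
  refine (hf.norm_gradient_le hR (hsub hz)).trans ?_
  have := mem_ball_zero_iff.1 hz
  gcongr

lemma norm_graphPt_sub_le (hf : IsChart fr R E p f) (hR : 0 < R) (hδ : δ ≤ R / 16) {x y : W}
    (hx : x ∈ ball (0 : W) δ) (hy : y ∈ ball (0 : W) δ) :
    ‖fr.graphPt p f x - fr.graphPt p f y‖ ≤ (1 + 8 / R * δ) * ‖x - y‖ := by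
  rw [fr.graphPt_sub]
  refine (fr.norm_add_le _ _).trans ?_
  linarith [hf.abs_sub_le hR hδ hx hy]

lemma lipschitzOnWith_graphPt (hf : IsChart fr R E p f) (hR : 0 < R) (hδ0 : 0 < δ)
    (hδ : δ ≤ R / 16) :
    LipschitzOnWith (Real.toNNReal (1 + 8 / R * δ)) (fr.graphPt p f) (ball 0 δ) :=
  LipschitzOnWith.of_dist_le_mul fun x hx y hy => by
    rw [dist_eq_norm, dist_eq_norm, Real.coe_toNNReal _ (by positivity)]
    exact hf.norm_graphPt_sub_le hR hδ hx hy

lemma image_graphPt (hf : IsChart fr R E p f) (hδ : δ ≤ R / 16) (hA : A ⊆ fr.cyl R p δ) :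
    fr.graphPt p f '' fr.chartPreimage p f δ A = A ∩ frontier E := by
  ext q
  constructor
  · rintro ⟨x, ⟨hx, hxA⟩, rfl⟩
    exact ⟨hxA, hf.graphPt_mem_frontier (ball_subset_ball hδ hx)⟩
  · rintro ⟨hqA, hq⟩
    have h := hf.eq_graphPt hδ hq (hA hqA)
    exact ⟨_, ⟨mem_ball_zero_iff.2 (hA hqA).1, by rwa [mem_preimage, ← h]⟩, h.symm⟩

lemma measurableSet_chartPreimage [MeasurableSpace V] [BorelSpace V] [MeasurableSpace W]
    [BorelSpace W] (hf : IsChart fr R E p f) (hR : 0 < R) (hδ0 : 0 < δ)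
    (hδ : δ ≤ R / 16) (hA : MeasurableSet A) : MeasurableSet (fr.chartPreimage p f δ A) := by
  classical
  have := (hf.lipschitzOnWith_graphPt hR hδ0 hδ).continuousOn
  have h2 := this.measurable_piecewise (continuousOn_const (c := (0 : V))) measurableSet_ball
  have : fr.chartPreimage p f δ A =
      ball 0 δ ∩ (ball (0 : W) δ).piecewise (fr.graphPt p f) (fun _ => 0) ⁻¹' A := by
    ext x
    refine and_congr_right fun hx => ?_
    rw [mem_preimage, mem_preimage, piecewise_eq_of_mem _ _ _ hx]
  rw [this]
  exact measurableSet_ball.inter (h2 hA)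

lemma le_map_restrict [MeasurableSpace V] [BorelSpace V] [MeasurableSpace W]
    [BorelSpace W] (hf : IsChart fr R E p f) (hR : 0 < R) (hδ0 : 0 < δ)
    (hδ : δ ≤ R / 16) (hAc : A ⊆ fr.cyl R p δ) {d : ℝ} (hd : 0 ≤ d) :
    (μH[d] : Measure W).restrict (fr.chartPreimage p f δ A) ≤
      Measure.map (fun q => fr.P (q - p)) ((μH[d] : Measure V).restrict (A ∩ frontier E)) ∧
    Measure.map (fun q => fr.P (q - p)) ((μH[d] : Measure V).restrict (A ∩ frontier E)) ≤
      ENNReal.ofReal ((1 + 8 / R * δ) ^ d) •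
        (μH[d] : Measure W).restrict (fr.chartPreimage p f δ A) := by
  have hm : Measurable fun q : V => fr.P (q - p) := by
    have : Continuous fun q : V => fr.P (q - p) := by fun_prop
    exact this.measurable
  have key : ∀ C : Set W, (fun q => fr.P (q - p)) ⁻¹' C ∩ (A ∩ frontier E) =
      fr.graphPt p f '' (C ∩ fr.chartPreimage p f δ A) := by
    intro C
    rw [← hf.image_graphPt hδ hAc]
    ext q
    constructor
    · rintro ⟨hq, x, hx, rfl⟩
      rw [mem_preimage, fr.P_graphPt] at hq
      exact ⟨x, ⟨hq, hx⟩, rfl⟩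
    · rintro ⟨x, ⟨hC, hx⟩, rfl⟩
      exact ⟨by rwa [mem_preimage, fr.P_graphPt], x, hx, rfl⟩
  constructor
  · refine Measure.le_iff.2 fun C hC => ?_
    rw [Measure.map_apply hm hC, Measure.restrict_apply (hm hC), Measure.restrict_apply hC, key]
    have h1 : LipschitzWith 1 fun q : V => fr.P (q - p) := LipschitzWith.of_dist_le_mul fun q q' => by
      rw [dist_eq_norm, dist_eq_norm, ← _root_.map_sub, _root_.sub_sub_sub_cancel_right,
        NNReal.coe_one, one_mul]
      exact fr.norm_P_le _
    have h2 := h1.hausdorffMeasure_image_le hd (fr.graphPt p f '' (C ∩ fr.chartPreimage p f δ A))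
    rw [image_image] at h2
    simpa [fr.P_graphPt] using h2
  · refine Measure.le_iff.2 fun C hC => ?_
    rw [Measure.map_apply hm hC, Measure.restrict_apply (hm hC), Measure.smul_apply,
      Measure.restrict_apply hC, key, smul_eq_mul]
    have h2 := ((hf.lipschitzOnWith_graphPt hR hδ0 hδ).mono
      (inter_subset_right.trans inter_subset_left :
        C ∩ fr.chartPreimage p f δ A ⊆ _)).hausdorffMeasure_image_le hd
    rw [← ENNReal.ofReal_rpow_of_pos (by positivity)]
    exact h2

lemma add_coord_tubeMap [FiniteDimensional ℝ V] [FiniteDimensional ℝ W] (x : W) (t : ℝ) :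
    p + fr.coord (tubeMap f (x, t)) =
      fr.graphPt p f x + t • fr.graphNormal (gradient f x) := by
  rw [NormalFrame.graphPt, fr.coord_tube, tubeMap]

lemma tube_inter_nearest [FiniteDimensional ℝ V] [FiniteDimensional ℝ W]
    (hf : IsChart fr R E p f) (hE : IsClosed E) (hR : 0 < R)
    (hN : ∀ q ∈ frontier E, ∃ ν, IsOuterNormal R E q ν)
    (hδ : δ ≤ R / 16) (hs : s ≤ R) (hAc : A ⊆ fr.cyl R p δ) :
    nearest E ⁻¹' A ∩ tube E s =
      (fun y => p + fr.coord y) '' (tubeMap f '' (fr.chartPreimage p f δ A ×ˢ Ioo 0 s)) := by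
  rw [image_image]
  ext y
  constructor
  · rintro ⟨hyA, hy⟩
    have hq := nearest_mem_frontier hE hy
    obtain ⟨ν, hν⟩ := hN _ hq
    have hqx := hf.eq_graphPt hδ hq (hAc hyA)
    set x := fr.P (nearest E y - p)
    have hx : x ∈ ball (0 : W) δ := mem_ball_zero_iff.2 (hAc hyA).1
    have hνx : ν = fr.graphNormal (gradient f x) := by
      refine hν.unique hR ?_
      rw [hqx]
      exact hf.isOuterNormal x (ball_subset_ball hδ hx)
    refine ⟨(x, infDist y E), ⟨⟨hx, by rwa [mem_preimage, ← hqx]⟩, hy⟩, ?_⟩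
    change p + fr.coord (tubeMap f (x, infDist y E)) = y
    rw [add_coord_tubeMap, ← hqx, ← hνx]
    exact (eq_nearest_add hE hR hy hν).symm
  · rintro ⟨⟨x, t⟩, ⟨⟨hx, hxA⟩, ht⟩, rfl⟩
    have hν := hf.isOuterNormal x (ball_subset_ball hδ hx)
    change p + fr.coord (tubeMap f (x, t)) ∈ _
    rw [add_coord_tubeMap]
    refine ⟨?_, hν.add_smul_mem_tube hE hR hs ht⟩
    rw [mem_preimage, NormalFrame.graphPt, hν.nearest_add_smul hE hR ⟨ht.1, ht.2.trans_le hs⟩]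
    exact hxA

lemma injOn_tubeMap [FiniteDimensional ℝ V] [FiniteDimensional ℝ W]
    (hf : IsChart fr R E p f) (hE : IsClosed E) (hR : 0 < R) :
    InjOn (tubeMap f) (ball 0 (R / 16) ×ˢ Ioo 0 R) := by
  rintro ⟨x, t⟩ ⟨hx, ht⟩ ⟨x', t'⟩ ⟨hx', ht'⟩ h
  have h1 : p + fr.coord (tubeMap f (x, t)) = p + fr.coord (tubeMap f (x', t')) := by rw [h]
  rw [add_coord_tubeMap, add_coord_tubeMap] at h1
  have hν := hf.isOuterNormal x hx
  have hν' := hf.isOuterNormal x' hx'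
  have h2 : nearest E _ = nearest E _ := congrArg (nearest E) h1
  have h3 : infDist _ E = infDist _ E := congrArg (infDist · E) h1
  rw [NormalFrame.graphPt, hν.nearest_add_smul hE hR ht, NormalFrame.graphPt,
    hν'.nearest_add_smul hE hR ht'] at h2
  rw [NormalFrame.graphPt, hν.infDist_eq hE hR ht.1 ht.2, NormalFrame.graphPt,
    hν'.infDist_eq hE hR ht'.1 ht'.2] at h3
  have h4 : fr.P (fr.graphPt p f x - p) = fr.P (fr.graphPt p f x' - p) := by
    rw [NormalFrame.graphPt, h2, NormalFrame.graphPt]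
  rw [fr.P_graphPt, fr.P_graphPt] at h4
  exact Prod.ext h4 h3

lemma exists_lipschitzOnWith_tubeMap [FiniteDimensional ℝ V] [FiniteDimensional ℝ W]
    (hf : IsChart fr R E p f) (hR : 0 < R) :
    ∃ C, LipschitzOnWith C (tubeMap f) (ball 0 (R / 16) ×ˢ Ioo 0 R) := by
  have h1 : LipschitzOnWith 4
      (fun y : W × ℝ => fr.graphPt p f y.1 + y.2 • fr.graphNormal (gradient f y.1) - p)
      (ball 0 (R / 16) ×ˢ Ioo 0 R) := by
    refine LipschitzOnWith.of_dist_le_mul ?_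
    rintro ⟨x, t⟩ ⟨hx, ht⟩ ⟨y, t'⟩ ⟨hy, ht'⟩
    have hx1 := hf.norm_graphPt_sub_le hR le_rfl hx hy
    rw [show 1 + 8 / R * (R / 16) = 3 / 2 by field_simp; norm_num] at hx1
    have hx2 := (hf.isOuterNormal x hx).mul_norm_sub_le hR (hf.isOuterNormal y hy)
    change R * ‖_‖ ≤ ‖fr.graphPt p f x - fr.graphPt p f y‖ at hx2
    set ν := fr.graphNormal (gradient f x)
    set ν' := fr.graphNormal (gradient f y)
    have hν1 : ‖ν‖ = 1 := (hf.isOuterNormal x hx).norm_eq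
    rw [dist_eq_norm, dist_eq_norm]
    have e : fr.graphPt p f x + t • ν - p - (fr.graphPt p f y + t' • ν' - p) =
        (fr.graphPt p f x - fr.graphPt p f y) + (t - t') • ν + t' • (ν - ν') := by
      rw [sub_smul, smul_sub]; abel
    have hxd : ‖x - y‖ ≤ ‖((x, t) : W × ℝ) - (y, t')‖ := norm_fst_le (((x, t) : W × ℝ) - (y, t'))
    have htd : ‖t - t'‖ ≤ ‖((x, t) : W × ℝ) - (y, t')‖ := norm_snd_le (((x, t) : W × ℝ) - (y, t'))
    have h3 : t' * ‖ν - ν'‖ ≤ R * ‖ν - ν'‖ :=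
      mul_le_mul_of_nonneg_right ht'.2.le (norm_nonneg _)
    change ‖fr.graphPt p f x + t • ν - p - (fr.graphPt p f y + t' • ν' - p)‖ ≤ _
    rw [e]
    refine (norm_add₃_le).trans ?_
    rw [norm_smul, norm_smul, hν1, mul_one, Real.norm_of_nonneg ht'.1.le]
    change _ ≤ (4 : ℝ) * _
    linarith
  have h2 := (fr.coord.symm.lipschitz.lipschitzOnWith (s := univ)).comp h1 (mapsTo_univ _ _)
  have e : (fr.coord.symm ∘
      fun y : W × ℝ => fr.graphPt p f y.1 + y.2 • fr.graphNormal (gradient f y.1) - p) =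
      tubeMap f := by
    ext1 y
    rw [Function.comp_apply, ← add_coord_tubeMap (p := p) (fr := fr), add_sub_cancel_left,
      ContinuousLinearEquiv.symm_apply_apply]
  exact ⟨_, e ▸ h2⟩

end IsChart

end LocalChart

section TubeVolume

variable {W : Type*} [NormedAddCommGroup W] [InnerProductSpace ℝ W]

lemma inner_weingarten {F : W → W} {x : W} (hF : DifferentiableAt ℝ F x) (v : W) :
    inner ℝ (F x) (weingarten F x v) = normalFactor (F x) ^ 3 * inner ℝ (F x) (fderiv ℝ F x v) := by
  rw [weingarten_apply hF, inner_sub_right, inner_smul_right, inner_smul_right,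
    real_inner_self_eq_norm_sq]
  have h := normalFactor_sq (F x)
  linear_combination (-(normalFactor (F x) * inner ℝ (F x) (fderiv ℝ F x v))) * h

omit [InnerProductSpace ℝ W] in
lemma continuous_normalFactor : Continuous (normalFactor : W → ℝ) := by
  unfold normalFactor
  refine Continuous.inv₀ (by fun_prop) fun v => Real.sqrt_ne_zero'.2 (by positivity)

/-- The derivative of the tube map of the graph of an affine function with gradient `v`. -/
def tubeFactor (v : W) : W × ℝ →L[ℝ] W × ℝ :=
  (ContinuousLinearMap.fst ℝ W ℝ -
    (normalFactor v • ContinuousLinearMap.snd ℝ W ℝ).smulRight v).prod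
  ((innerSL ℝ v).comp (ContinuousLinearMap.fst ℝ W ℝ) +
    normalFactor v • ContinuousLinearMap.snd ℝ W ℝ)

lemma tubeFactor_apply (v : W) (y : W × ℝ) :
    tubeFactor v y = (y.1 - (normalFactor v * y.2) • v, inner ℝ v y.1 + normalFactor v * y.2) := rfl

lemma tubeFactor_zero : tubeFactor (0 : W) = 1 := by
  refine ContinuousLinearMap.ext fun y => ?_
  rw [tubeFactor_apply]
  simp [normalFactor]

lemma continuous_det_tubeFactor [FiniteDimensional ℝ W] :
    Continuous fun v : W => (tubeFactor v).det := by
  refine ContinuousLinearMap.continuous_det.comp (continuous_clm_apply.2 fun y => ?_)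
  simp only [tubeFactor_apply]
  have := continuous_normalFactor (W := W)
  fun_prop

lemma det_tubeFactor_comp (v : W) (T : W →L[ℝ] W) [FiniteDimensional ℝ W] :
    ((tubeFactor v).comp (T.prodMap (ContinuousLinearMap.id ℝ ℝ))).det =
      (tubeFactor v).det * T.det := by
  rw [ContinuousLinearMap.det, ContinuousLinearMap.toLinearMap_comp, LinearMap.det_comp,
    ContinuousLinearMap.coe_prodMap, LinearMap.det_prodMap]
  simp [ContinuousLinearMap.det]

variable [CompleteSpace W] {f : W → ℝ} {x : W} {t : ℝ}

lemma hasFDerivAt_tubeMap (hf : HasGradientAt f (gradient f x) x)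
    (hd : DifferentiableAt ℝ (gradient f) x) (t : ℝ) :
    HasFDerivAt (tubeMap f) ((tubeFactor (gradient f x)).comp
      ((1 - t • weingarten (gradient f) x).prodMap (ContinuousLinearMap.id ℝ ℝ))) (x, t) := by
  have hfst : HasFDerivAt (fun y : W × ℝ => y.1) (ContinuousLinearMap.fst ℝ W ℝ) (x, t) :=
    hasFDerivAt_fst
  have hsnd : HasFDerivAt (fun y : W × ℝ => y.2) (ContinuousLinearMap.snd ℝ W ℝ) (x, t) :=
    hasFDerivAt_snd
  have h1 : HasFDerivAt (fun y : W × ℝ => normalFactor (gradient f y.1) • gradient f y.1)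
      _ (x, t) := HasFDerivAt.comp (g := fun y => normalFactor (gradient f y) • gradient f y) (x, t)
      (hasFDerivAt_weingarten hd) hfst
  have h2 : HasFDerivAt (fun y : W × ℝ => normalFactor (gradient f y.1)) _ (x, t) :=
    HasFDerivAt.comp (g := fun y => normalFactor (gradient f y)) (x, t)
      (hasFDerivAt_normalFactor hd) hfst
  have h3 : HasFDerivAt (fun y : W × ℝ => f y.1) _ (x, t) :=
    HasFDerivAt.comp (x, t) hf.hasFDerivAt hfst
  have h4 := (hfst.sub (hsnd.smul h1)).prodMk (h3.add (hsnd.mul h2))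
  have e : tubeMap f = fun y : W × ℝ =>
      (y.1 - y.2 • (normalFactor (gradient f y.1) • gradient f y.1),
        f y.1 + y.2 * normalFactor (gradient f y.1)) := by
    ext1 y
    rw [tubeMap, smul_smul]
  rw [e]
  refine h4.congr_fderiv ?_
  refine ContinuousLinearMap.ext fun ⟨w, τ⟩ => ?_
  rw [ContinuousLinearMap.comp_apply, tubeFactor_apply]
  change (w - (t • weingarten (gradient f) x w + τ • (normalFactor (gradient f x) • gradient f x)),
    inner ℝ (gradient f x) w + (t * (-(normalFactor (gradient f x) ^ 3) *
      inner ℝ (gradient f x) (fderiv ℝ (gradient f) x w)) + normalFactor (gradient f x) * τ)) =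
    (w - t • weingarten (gradient f) x w - (normalFactor (gradient f x) * τ) • gradient f x,
      inner ℝ (gradient f x) (w - t • weingarten (gradient f) x w)
        + normalFactor (gradient f x) * τ)
  rw [inner_sub_right, inner_smul_right, inner_weingarten hd, smul_smul, mul_comm τ]
  refine Prod.ext ?_ ?_
  · simp only
    abel
  · simp only
    ring

variable [MeasurableSpace W] [BorelSpace W]

lemma measurable_gradient (f : W → ℝ) : Measurable (gradient f) :=
  (InnerProductSpace.toDual ℝ W).symm.continuous.measurable.comp (measurable_fderiv ℝ f)

lemma measurable_det_one_sub (F : W → W) :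
    Measurable fun y : W × ℝ => (1 - y.2 • weingarten F y.1).det := by
  have h1 : Measurable fun y : W × ℝ => (weingarten F y.1, y.2) :=
    ((measurable_fderiv ℝ _).comp measurable_fst).prodMk measurable_snd
  have h2 : Continuous fun z : (W →L[ℝ] W) × ℝ => (1 - z.2 • z.1).det :=
    ContinuousLinearMap.continuous_det.comp (by fun_prop)
  exact h2.measurable.comp h1

omit [NormedAddCommGroup W] [InnerProductSpace ℝ W] [CompleteSpace W] [BorelSpace W] in
lemma lintegral_prod_mul_left (μ : Measure W) [SFinite μ] {a : W → ℝ≥0∞} {b : W × ℝ → ℝ≥0∞}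
    (ha : Measurable a) (hb : Measurable b) (B : Set W) (I : Set ℝ) :
    ∫⁻ y in B ×ˢ I, a y.1 * b y ∂(μ.prod volume) =
      ∫⁻ x in B, a x * (∫⁻ t in I, b (x, t)) ∂μ := by
  have h : Measurable fun y : W × ℝ => a y.1 * b y := (ha.comp measurable_fst).mul hb
  rw [← Measure.prod_restrict, lintegral_prod _ h.aemeasurable]
  refine lintegral_congr fun x => ?_
  have hbx : Measurable fun t => b (x, t) := hb.comp measurable_prodMk_left
  exact lintegral_const_mul (a x) hbx

lemma lintegral_prod_tube [FiniteDimensional ℝ W] (μ : Measure W) [SFinite μ] (F : W → W)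
    (hF : Measurable F) (B : Set W) (I : Set ℝ) :
    ∫⁻ y in B ×ˢ I, ENNReal.ofReal |(tubeFactor (F y.1)).det| *
      ENNReal.ofReal |(1 - y.2 • weingarten F y.1).det| ∂(μ.prod volume) =
    ∫⁻ x in B, ENNReal.ofReal |(tubeFactor (F x)).det| *
      (∫⁻ t in I, ENNReal.ofReal |(1 - t • weingarten F x).det|) ∂μ := by
  have hm1 : Measurable fun x => ENNReal.ofReal |(tubeFactor (F x)).det| := by
    have := continuous_det_tubeFactor.measurable.comp hF
    exact this.abs.ennreal_ofReal
  have hm2 : Measurable fun y : W × ℝ => ENNReal.ofReal |(1 - y.2 • weingarten F y.1).det| :=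
    (measurable_det_one_sub F).abs.ennreal_ofReal
  exact lintegral_prod_mul_left μ hm1 hm2 B I

variable [FiniteDimensional ℝ W] {V : Type*} [NormedAddCommGroup V] [InnerProductSpace ℝ V]
  {fr : NormalFrame W V} {R s : ℝ} {E : Set V} {p : V} {B : Set W} (μ : Measure W)
  [μ.IsAddHaarMeasure]

lemma IsChart.ae_differentiableAt (hf : IsChart fr R E p f) :
    ∀ᵐ x ∂μ, x ∈ ball (0 : W) (R / 16) → DifferentiableAt ℝ (gradient f) x := by
  filter_upwards [hf.lipschitz.ae_differentiableWithinAt_of_mem (μ := μ)] with x hx hxb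
  exact (hx hxb).differentiableAt (isOpen_ball.mem_nhds hxb)

lemma measure_image_eq_zero_of_lipschitzOnWith {Y : Type*} [NormedAddCommGroup Y] [NormedSpace ℝ Y]
    [FiniteDimensional ℝ Y] [MeasurableSpace Y] [BorelSpace Y] (ρ : Measure Y)
    [ρ.IsAddHaarMeasure] {C : ℝ≥0} {g : Y → Y} {S : Set Y} (hg : LipschitzOnWith C g S)
    (hS : ρ S = 0) : ρ (g '' S) = 0 := by
  have h1 : (μH[Module.finrank ℝ Y] : Measure Y) S = 0 :=
    Measure.absolutelyContinuous_isAddHaarMeasure _ ρ hS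
  have h2 := hg.hausdorffMeasure_image_le (d := (Module.finrank ℝ Y : ℝ)) (by positivity)
  rw [h1, mul_zero] at h2
  exact Measure.absolutelyContinuous_isAddHaarMeasure _ _ (le_antisymm h2 bot_le)

theorem IsChart.measure_image_tubeMap [FiniteDimensional ℝ V] (hf : IsChart fr R E p f)
    (hE : IsClosed E) (hR : 0 < R)
    (hB : B ⊆ ball 0 (R / 16)) (hBm : MeasurableSet B) (hs : s ≤ R) :
    (μ.prod volume) (tubeMap f '' (B ×ˢ Ioo 0 s)) =
      ∫⁻ x in B, ENNReal.ofReal |(tubeFactor (gradient f x)).det| *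
        (∫⁻ t in Ioo 0 s, ENNReal.ofReal |(1 - t • weingarten (gradient f) x).det|) ∂μ := by
  set G := {x | DifferentiableAt ℝ (gradient f) x} with hG
  have hGm : MeasurableSet G := measurableSet_of_differentiableAt ℝ _
  have hnull : μ (B \ G) = 0 := by
    refine measure_mono_null ?_ (hf.ae_differentiableAt μ)
    rintro x ⟨hx, hxG⟩ h
    exact hxG (h (hB hx))
  have hsub : Ioo 0 s ⊆ Ioo 0 R := Ioo_subset_Ioo_right hs
  have hIm : MeasurableSet ((B ∩ G) ×ˢ Ioo (0 : ℝ) s) := (hBm.inter hGm).prod measurableSet_Ioo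
  obtain ⟨C, hC⟩ := hf.exists_lipschitzOnWith_tubeMap hR
  have h1 : (μ.prod volume) (tubeMap f '' (B ×ˢ Ioo 0 s)) =
      (μ.prod volume) (tubeMap f '' ((B ∩ G) ×ˢ Ioo 0 s)) := by
    refine le_antisymm ?_ (measure_mono (image_mono (prod_mono_left inter_subset_left)))
    have hu : B ×ˢ Ioo 0 s = (B ∩ G) ×ˢ Ioo 0 s ∪ (B \ G) ×ˢ Ioo 0 s := by
      rw [← union_prod, inter_union_sdiff]
    rw [hu, image_union]
    refine (measure_union_le _ _).trans ?_
    rw [measure_image_eq_zero_of_lipschitzOnWith (μ.prod volume)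
      (hC.mono (prod_mono (sdiff_subset.trans hB) hsub)) (by rw [Measure.prod_prod, hnull, zero_mul]),
      add_zero]
  rw [h1, ← lintegral_abs_det_fderiv_eq_addHaar_image (μ.prod volume) hIm
    (f' := fun y => (tubeFactor (gradient f y.1)).comp
      ((1 - y.2 • weingarten (gradient f) y.1).prodMap (ContinuousLinearMap.id ℝ ℝ)))
    (fun y hy => (hasFDerivAt_tubeMap (hf.hasGradientAt _ (hB hy.1.1)) hy.1.2
      y.2).hasFDerivWithinAt)
    ((hf.injOn_tubeMap hE hR).mono (prod_mono (inter_subset_left.trans hB) hsub))]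
  simp only [det_tubeFactor_comp, abs_mul, ENNReal.ofReal_mul (abs_nonneg _)]
  have hae : (B ∩ G : Set W) =ᵐ[μ] B := by
    rw [ae_eq_set]
    refine ⟨by rw [sdiff_eq_empty.2 inter_subset_left, measure_empty], ?_⟩
    rwa [sdiff_self_inter]
  rw [lintegral_prod_tube μ _ (measurable_gradient f), Measure.restrict_congr_set hae]

end TubeVolume

section LocalSteiner

namespace IsChart

section

variable {W V : Type*} [NormedAddCommGroup W] [InnerProductSpace ℝ W] [FiniteDimensional ℝ W]
  [NormedAddCommGroup V] [InnerProductSpace ℝ V] {fr : NormalFrame W V}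
  {R δ : ℝ} {E : Set V} {p : V} {f : W → ℝ} {x : W}

lemma norm_weingarten_le (hf : IsChart fr R E p f) (hR : 0 < R) (hx : x ∈ ball (0 : W) (R / 16))
    (hd : DifferentiableAt ℝ (gradient f) x) : ‖weingarten (gradient f) x‖ ≤ 16 / R := by
  have h := norm_fderiv_le_of_lipschitzOn ℝ (isOpen_ball.mem_nhds hx) hf.lipschitz
  rw [Real.coe_toNNReal _ (by positivity)] at h
  calc _ ≤ 2 * ‖fderiv ℝ (gradient f) x‖ := _root_.norm_weingarten_le hd
    _ ≤ 2 * (8 / R) := by gcongr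
    _ = 16 / R := by ring

lemma ae_eq_graphPt [MeasurableSpace V] [BorelSpace V] [MeasurableSpace W] [BorelSpace W]
    (hf : IsChart fr R E p f) (hR : 0 < R) (hδ0 : 0 < δ) (hδ : δ ≤ R / 16) {d : ℝ} (hd : 0 ≤ d)
    [(μH[d] : Measure W).IsAddHaarMeasure] :
    ∀ᵐ q ∂(μH[d] : Measure V).restrict (fr.cyl R p δ ∩ frontier E),
      fr.P (q - p) ∈ ball (0 : W) (R / 16) ∧ DifferentiableAt ℝ (gradient f) (fr.P (q - p)) ∧
        q = fr.graphPt p f (fr.P (q - p)) := by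
  have hc : Continuous fun q : V => fr.P (q - p) := by fun_prop
  have h1 : ∀ᵐ x ∂Measure.map (fun q => fr.P (q - p))
      ((μH[d] : Measure V).restrict (fr.cyl R p δ ∩ frontier E)),
      x ∈ ball (0 : W) (R / 16) → DifferentiableAt ℝ (gradient f) x := by
    refine Measure.AbsolutelyContinuous.ae_le ?_ (hf.ae_differentiableAt μH[d])
    refine (hf.le_map_restrict hR hδ0 hδ subset_rfl hd).2.absolutelyContinuous.trans ?_
    exact (Measure.smul_absolutelyContinuous).trans Measure.absolutelyContinuous_restrict
  have h2 := ae_of_ae_map hc.aemeasurable h1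
  have hm : MeasurableSet (fr.cyl R p δ ∩ frontier E) :=
    fr.isOpen_cyl.measurableSet.inter isClosed_frontier.measurableSet
  filter_upwards [h2, ae_restrict_mem hm] with q hq hqm
  have hb : fr.P (q - p) ∈ ball (0 : W) (R / 16) := mem_ball_zero_iff.2 (hqm.1.1.trans_le hδ)
  exact ⟨hb, hq hb, hf.eq_graphPt hδ hqm.2 hqm.1⟩

end

end IsChart

variable {n : ℕ}

/-- The curvature functions, extended by `K_0 = 1`. -/
def extCurv (K : ℕ → En n → ℝ) (p : ℕ) (q : En n) : ℝ := if p = 0 then 1 else K p q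

/-- The Jacobian at distance `t` of the normal exponential map. -/
def steinerPoly (n : ℕ) (K : ℕ → En n → ℝ) (q : En n) (t : ℝ) : ℝ :=
  ∑ p ∈ Finset.range n, steinerCoeff n p * extCurv K p q * t ^ p

variable {hn : 2 ≤ n} {E A : Set (En n)} {K : ℕ → En n → ℝ} {R s : ℝ} {p : En n}
  {U : En n ≃ₗᵢ[ℝ] En n} {f : En (n - 1) → ℝ}

namespace IsChart

lemma det_eq_steinerPoly (hf : IsChart ((stdFrame hn).map U) R E p f) (hR : 0 < R)
    (hK : IsCurvFuns n E K) {x : En (n - 1)} (hx : x ∈ ball 0 (R / 16))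
    (hd : DifferentiableAt ℝ (gradient f) x) (t : ℝ) :
    (1 - t • weingarten (gradient f) x).det =
      steinerPoly n K (((stdFrame hn).map U).graphPt p f x) t := by
  rw [det_one_sub_weingarten hn hd, steinerPoly]
  refine Finset.sum_congr rfl fun k hk => ?_
  congr 2
  rw [extCurv]
  split_ifs with h
  · rw [h, Kp_zero]
  · exact (hK.eq_Kp hR hf hx hd (by omega) (by have := Finset.mem_range.1 hk; omega)).symm

lemma volume_tube_inter_nearest (hf : IsChart ((stdFrame hn).map U) R E p f) (hE : IsClosed E)
    (hR : 0 < R) (hN : ∀ q ∈ frontier E, ∃ ν, IsOuterNormal R E q ν) {δ : ℝ} (hδ0 : 0 < δ)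
    (hδ : δ ≤ R / 16) (hs : s ≤ R) (hA : MeasurableSet A)
    (hAc : A ⊆ ((stdFrame hn).map U).cyl R p δ) {κ : ℝ≥0∞}
    (hκ : (volume : Measure (En n)) = κ • Measure.map ((stdFrame hn).map U).coord
        ((μH[(n : ℝ) - 1] : Measure (En (n - 1))).prod volume)) :
    volume (nearest E ⁻¹' A ∩ tube E s) =
      κ * ∫⁻ x in ((stdFrame hn).map U).chartPreimage p f δ A,
        ENNReal.ofReal |(tubeFactor (gradient f x)).det| *
        (∫⁻ t in Ioo 0 s, ENNReal.ofReal |(1 - t • weingarten (gradient f) x).det|)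
          ∂μH[(n : ℝ) - 1] := by
  have : Fact (2 ≤ n) := ⟨hn⟩
  set fr := (stdFrame hn).map U
  have hB : fr.chartPreimage p f δ A ⊆ ball 0 (R / 16) :=
    inter_subset_left.trans (ball_subset_ball hδ)
  rw [← hf.measure_image_tubeMap _ hE hR hB
    (hf.measurableSet_chartPreimage hR hδ0 hδ hA) hs, hf.tube_inter_nearest hE hR hN hδ hs hAc]
  set S := tubeMap f '' (fr.chartPreimage p f δ A ×ˢ Ioo 0 s)
  have h1 : (fun y => p + fr.coord y) '' S = (fun v => -p + v) ⁻¹' (fr.coord '' S) := by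
    rw [← image_add_left]
    exact (image_image (p + ·) fr.coord S).symm
  have h2 : Measure.map fr.coord
      ((μH[(n : ℝ) - 1] : Measure (En (n - 1))).prod volume) (fr.coord '' S) =
      ((μH[(n : ℝ) - 1] : Measure (En (n - 1))).prod volume) S := by
    have := fr.coord.toHomeomorph.toMeasurableEquiv.map_apply
      (μ := (μH[(n : ℝ) - 1] : Measure (En (n - 1))).prod volume) (fr.coord '' S)
    refine this.trans (congrArg _ ?_)
    exact preimage_image_eq _ fr.coord.injective
  rw [h1, measure_preimage_add, hκ, Measure.smul_apply, h2, smul_eq_mul]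

end IsChart

/-- The thickness of the tube of width `s` over a point, weighted with the Jacobian. -/
def steinerWeight (n : ℕ) (K : ℕ → En n → ℝ) (s : ℝ) (q : En n) : ℝ≥0∞ :=
  ∫⁻ t in Ioo 0 s, ENNReal.ofReal |steinerPoly n K q t|

theorem exists_isOpen_measure_tube_le (hn : 2 ≤ n) (hE : IsClosed E) (hR : 0 < R)
    (hN : ∀ q ∈ frontier E, ∃ ν, IsOuterNormal R E q ν) (hK : IsCurvFuns n E K)
    (hp : p ∈ frontier E) (hs : s ≤ R) {κ : ℝ≥0∞}
    (hκ : ∀ U : En n ≃ₗᵢ[ℝ] En n, (volume : Measure (En n)) =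
      κ • Measure.map ((stdFrame hn).map U).coord
        ((μH[(n : ℝ) - 1] : Measure (En (n - 1))).prod volume)) {η : ℝ} (hη : 1 < η) :
    ∃ O, IsOpen O ∧ p ∈ O ∧ ∀ A ⊆ O, MeasurableSet A →
      volume (nearest E ⁻¹' A ∩ tube E s) ≤ ENNReal.ofReal (η ^ 2) *
        (κ * ∫⁻ q in A ∩ frontier E, steinerWeight n K s q ∂μH[(n : ℝ) - 1]) ∧
      κ * ∫⁻ q in A ∩ frontier E, steinerWeight n K s q ∂μH[(n : ℝ) - 1] ≤
        ENNReal.ofReal (η ^ 2) * volume (nearest E ⁻¹' A ∩ tube E s) := by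
  have : Fact (2 ≤ n) := ⟨hn⟩
  have hη0 : 0 < η := by linarith
  have hd0 : (0 : ℝ) ≤ (n : ℝ) - 1 := by
    have : (2 : ℝ) ≤ n := by exact_mod_cast hn
    linarith
  obtain ⟨ν, hν⟩ := hN p hp
  obtain ⟨U, rfl⟩ := (stdFrame hn).exists_map_e_eq hν.norm_eq
  obtain ⟨f, hf⟩ := exists_isChart _ hR hE hN hν
  set fr := (stdFrame hn).map U
  have hD : ∀ᶠ v in 𝓝 (0 : En (n - 1)), |(tubeFactor v).det| ∈ Ioo η⁻¹ η := by
    refine (continuous_abs.comp continuous_det_tubeFactor).continuousAt.eventually_mem ?_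
    have : (tubeFactor (0 : En (n - 1))).det = 1 := by
      rw [tubeFactor_zero]; exact LinearMap.det_id
    simp only [Function.comp_apply, this, abs_one]
    exact Ioo_mem_nhds (inv_lt_one_of_one_lt₀ hη) hη
  obtain ⟨ε, hε, hεD⟩ := Metric.eventually_nhds_iff_ball.1 hD
  have hc1 : ∀ᶠ δ in 𝓝[>] (0 : ℝ), (1 + 8 / R * δ) ^ ((n : ℝ) - 1) < η := by
    have : ContinuousAt (fun δ : ℝ => (1 + 8 / R * δ) ^ ((n : ℝ) - 1)) 0 :=
      ContinuousAt.rpow_const (by fun_prop) (Or.inr hd0)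
    exact (this.eventually_lt continuousAt_const (by simpa using hη)).filter_mono nhdsWithin_le_nhds
  have hc2 : ∀ᶠ δ in 𝓝[>] (0 : ℝ), 8 / R * δ < ε := by
    have : ContinuousAt (fun δ : ℝ => 8 / R * δ) 0 := by fun_prop
    exact (this.eventually_lt continuousAt_const (by simpa using hε)).filter_mono nhdsWithin_le_nhds
  have hc3 : ∀ᶠ δ in 𝓝[>] (0 : ℝ), δ < R / 16 :=
    (eventually_lt_nhds (by positivity)).filter_mono nhdsWithin_le_nhds
  obtain ⟨δ, h1, h2, h3, hδ0⟩ := (hc1.and (hc2.and (hc3.and self_mem_nhdsWithin))).exists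
  have hδ0 : 0 < δ := hδ0
  refine ⟨fr.cyl R p δ, fr.isOpen_cyl, fr.mem_cyl_self hR hδ0, fun A hA hAm => ?_⟩
  set B := fr.chartPreimage p f δ A with hBdef
  have hBm : MeasurableSet B := hf.measurableSet_chartPreimage hR hδ0 h3.le hAm
  set j : En (n - 1) → ℝ≥0∞ := fun x =>
    ∫⁻ t in Ioo 0 s, ENNReal.ofReal |(1 - t • weingarten (gradient f) x).det| with hj
  have hjm : Measurable j :=
    Measurable.lintegral_prod_right' (f := fun y : En (n - 1) × ℝ =>
      ENNReal.ofReal |(1 - y.2 • weingarten (gradient f) y.1).det|)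
      (measurable_det_one_sub (gradient f)).abs.ennreal_ofReal
  have hvol := hf.volume_tube_inter_nearest hE hR hN hδ0 h3.le hs hAm hA (hκ U)
  have hPc : Continuous fun q : En n => fr.P (q - p) := by fun_prop
  have hw : ∫⁻ q in A ∩ frontier E, steinerWeight n K s q ∂μH[(n : ℝ) - 1] =
      ∫⁻ x, j x ∂(Measure.map (fun q => fr.P (q - p))
        ((μH[(n : ℝ) - 1] : Measure (En n)).restrict (A ∩ frontier E))) := by
    rw [lintegral_map hjm hPc.measurable]
    refine lintegral_congr_ae ?_
    have := ae_mono (Measure.restrict_mono (inter_subset_inter_left (frontier E) hA) le_rfl)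
      (hf.ae_eq_graphPt hR hδ0 h3.le hd0)
    filter_upwards [this] with q ⟨hq1, hq2, hq3⟩
    simp only [steinerWeight, hj]
    refine lintegral_congr fun t => ?_
    rw [hf.det_eq_steinerPoly hR hK hq1 hq2, ← hq3]
  obtain ⟨hle1, hle2⟩ := hf.le_map_restrict hR hδ0 h3.le hA hd0
  have hJ1 : ∫⁻ x in B, j x ∂μH[(n : ℝ) - 1] ≤
      ∫⁻ q in A ∩ frontier E, steinerWeight n K s q ∂μH[(n : ℝ) - 1] :=
    hw ▸ lintegral_mono' hle1 le_rfl
  have hJ2 : ∫⁻ q in A ∩ frontier E, steinerWeight n K s q ∂μH[(n : ℝ) - 1] ≤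
      ENNReal.ofReal η * ∫⁻ x in B, j x ∂μH[(n : ℝ) - 1] := by
    rw [hw]
    refine (lintegral_mono' hle2 le_rfl).trans ?_
    rw [lintegral_smul_measure, smul_eq_mul]
    gcongr
  have hDx : ∀ x ∈ B, |(tubeFactor (gradient f x)).det| ∈ Ioo η⁻¹ η := fun x hx => by
    refine hεD _ (mem_ball_zero_iff.2 ?_)
    refine (hf.norm_gradient_le hR (ball_subset_ball h3.le hx.1)).trans_lt (lt_of_le_of_lt ?_ h2)
    have := (mem_ball_zero_iff.1 hx.1).le
    gcongr
  have hV1 : volume (nearest E ⁻¹' A ∩ tube E s) ≤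
      ENNReal.ofReal η * (κ * ∫⁻ x in B, j x ∂μH[(n : ℝ) - 1]) := by
    rw [hvol, mul_left_comm, ← lintegral_const_mul _ hjm]
    gcongr κ * ?_
    refine setLIntegral_mono' hBm fun x hx => ?_
    gcongr
    exact (hDx x hx).2.le
  have hV2 : κ * ∫⁻ x in B, j x ∂μH[(n : ℝ) - 1] ≤
      ENNReal.ofReal η * volume (nearest E ⁻¹' A ∩ tube E s) := by
    rw [hvol, mul_left_comm, ← lintegral_const_mul' _ _ ENNReal.ofReal_ne_top]
    gcongr κ * ?_
    refine setLIntegral_mono' hBm fun x hx => ?_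
    rw [← mul_assoc, ← ENNReal.ofReal_mul hη0.le]
    refine le_mul_of_one_le_left zero_le ?_
    rw [ENNReal.one_le_ofReal]
    have := (hDx x hx).1.le
    calc (1 : ℝ) = η * η⁻¹ := (mul_inv_cancel₀ hη0.ne').symm
      _ ≤ _ := by gcongr
  have hηη : ENNReal.ofReal η ≤ ENNReal.ofReal (η ^ 2) := by
    refine ENNReal.ofReal_le_ofReal ?_
    nlinarith
  refine ⟨hV1.trans ?_, ?_⟩
  · gcongr
  · calc κ * ∫⁻ q in A ∩ frontier E, steinerWeight n K s q ∂μH[(n : ℝ) - 1]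
        ≤ κ * (ENNReal.ofReal η * ∫⁻ x in B, j x ∂μH[(n : ℝ) - 1]) := by gcongr
      _ = ENNReal.ofReal η * (κ * ∫⁻ x in B, j x ∂μH[(n : ℝ) - 1]) := mul_left_comm _ _ _
      _ ≤ ENNReal.ofReal η * (ENNReal.ofReal η * volume (nearest E ⁻¹' A ∩ tube E s)) := by gcongr
      _ = _ := by rw [← mul_assoc, ← ENNReal.ofReal_mul hη0.le, pow_two]

end LocalSteiner

section GlobalSteiner

lemma IsCompact.exists_isOpen_of_local {X : Type*} [TopologicalSpace X] {F : Set X}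
    (hF : IsCompact F) {P : Set X → Prop} (h0 : P ∅)
    (hU : ∀ O O', IsOpen O → IsOpen O' → P O → P O' → P (O ∪ O'))
    (hl : ∀ p ∈ F, ∃ O, IsOpen O ∧ p ∈ O ∧ P O) : ∃ O, IsOpen O ∧ F ⊆ O ∧ P O := by
  refine hF.induction_on (p := fun S => ∃ O, IsOpen O ∧ S ⊆ O ∧ P O)
    ⟨∅, isOpen_empty, subset_rfl, h0⟩ (fun S T hST ⟨O, h1, h2, h3⟩ => ⟨O, h1, hST.trans h2, h3⟩)
    (fun S T ⟨O, h1, h2, h3⟩ ⟨O', h1', h2', h3'⟩ =>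
      ⟨O ∪ O', h1.union h1', union_subset_union h2 h2', hU O O' h1 h1' h3 h3'⟩) fun p hp => ?_
  obtain ⟨O, h1, h2, h3⟩ := hl p hp
  exact ⟨O, mem_nhdsWithin_of_mem_nhds (h1.mem_nhds h2), O, h1, subset_rfl, h3⟩

lemma measure_le_of_local {X : Type*} [TopologicalSpace X] [MeasurableSpace X]
    [OpensMeasurableSpace X] {m₁ m₂ : Measure X} {F : Set X} (hF : IsCompact F) {c : ℝ≥0∞}
    (h0 : m₁ Fᶜ = 0) (hl : ∀ p ∈ F, ∃ O, IsOpen O ∧ p ∈ O ∧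
      ∀ A ⊆ O, MeasurableSet A → m₁ A ≤ c * m₂ A) {A : Set X} (hA : MeasurableSet A) :
    m₁ A ≤ c * m₂ A := by
  obtain ⟨O, hO, hFO, hP⟩ := hF.exists_isOpen_of_local
    (P := fun O => ∀ A ⊆ O, MeasurableSet A → m₁ A ≤ c * m₂ A)
    (fun A hA _ => by simp [subset_empty_iff.1 hA]) (fun O O' hO hO' h h' A hA hAm => by
      rw [← measure_inter_add_sdiff A hO.measurableSet (μ := m₁),
        ← measure_inter_add_sdiff A hO.measurableSet (μ := m₂), mul_add]
      exact add_le_add (h _ inter_subset_right (hAm.inter hO.measurableSet))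
        (h' _ (sdiff_subset_iff.2 hA) (hAm.diff hO.measurableSet))) hl
  calc m₁ A ≤ m₁ (A ∩ O) + m₁ Fᶜ := by
        refine (measure_mono fun x hx => ?_).trans (measure_union_le _ _)
        by_cases h : x ∈ F
        · exact Or.inl ⟨hx, hFO h⟩
        · exact Or.inr h
    _ ≤ c * m₂ (A ∩ O) + 0 := by
        rw [h0]
        exact add_le_add (hP _ inter_subset_right (hA.inter hO.measurableSet)) le_rfl
    _ ≤ c * m₂ A := by
        rw [add_zero]
        gcongr
        exact inter_subset_left

lemma ENNReal.le_of_forall_sq_mul {a b : ℝ≥0∞}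
    (h : ∀ η : ℝ, 1 < η → a ≤ ENNReal.ofReal (η ^ 2) * b) : a ≤ b := by
  have h1 : Tendsto (fun η : ℝ => ENNReal.ofReal (η ^ 2) * b) (𝓝[>] 1) (𝓝 (1 * b)) := by
    refine ENNReal.Tendsto.mul_const ?_ (Or.inl one_ne_zero)
    have : ContinuousAt (fun η : ℝ => ENNReal.ofReal (η ^ 2)) 1 :=
      ENNReal.continuous_ofReal.continuousAt.comp (by fun_prop)
    simpa using this.tendsto.mono_left nhdsWithin_le_nhds
  rw [one_mul] at h1
  exact ge_of_tendsto h1 (eventually_nhdsWithin_of_forall h)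

variable {n : ℕ} {E : Set (En n)} {K : ℕ → En n → ℝ} {R s : ℝ}

lemma continuousOn_nearest {V : Type*} [NormedAddCommGroup V] [InnerProductSpace ℝ V]
    [FiniteDimensional ℝ V] {E : Set V} (hE : IsClosed E) (hR : 0 < R) (hs : s ≤ R)
    (hN : ∀ q ∈ frontier E, ∃ ν, IsOuterNormal R E q ν) : ContinuousOn (nearest E) (tube E s) := by
  intro y hy
  have hne := nonempty_of_mem_tube hy
  refine tendsto_nearest_of_tendsto hE hR hs hN hy ?_ ?_
  · refine tendsto_const_nhds.congr fun z => ?_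
    exact (infDist_zero_of_mem (nearest_spec hE hne z).1).symm
  · have h1 : Tendsto (fun z => infDist z E) (𝓝[tube E s] y) (𝓝 (infDist y E)) :=
      (continuous_infDist_pt E).continuousAt.mono_left nhdsWithin_le_nhds
    have h2 : Tendsto (fun z => dist y z) (𝓝[tube E s] y) (𝓝 0) := by
      have : ContinuousAt (fun z => dist y z) y := by fun_prop
      simpa using this.tendsto.mono_left nhdsWithin_le_nhds
    refine tendsto_of_tendsto_of_tendsto_of_le_of_le (by simpa using h1.sub h2)
      (by simpa using h1.add h2) (fun z => ?_)
      fun z => ?_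
    · have := (nearest_spec hE hne z).2
      have := dist_triangle z y (nearest E z)
      rw [dist_comm z y] at this
      simp only; linarith
    · have := (nearest_spec hE hne z).2
      have := dist_triangle y z (nearest E z)
      simp only; linarith

theorem map_nearest_tube (hn : 2 ≤ n) (hE : IsClosed E) (hF : IsCompact (frontier E)) (hR : 0 < R)
    (hN : ∀ q ∈ frontier E, ∃ ν, IsOuterNormal R E q ν) (hK : IsCurvFuns n E K)
    (hs : s ≤ R) {κ : ℝ≥0∞}
    (hκ : ∀ U : En n ≃ₗᵢ[ℝ] En n, (volume : Measure (En n)) =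
      κ • Measure.map ((stdFrame hn).map U).coord
        ((μH[(n : ℝ) - 1] : Measure (En (n - 1))).prod volume)) :
    Measure.map (nearest E) (volume.restrict (tube E s)) =
      κ • ((μH[(n : ℝ) - 1]).restrict (frontier E)).withDensity (steinerWeight n K s) := by
  have hnm : AEMeasurable (nearest E) (volume.restrict (tube E s)) :=
    (continuousOn_nearest hE hR hs hN).aemeasurable isOpen_tube.measurableSet
  have e1 : ∀ A, MeasurableSet A → Measure.map (nearest E) (volume.restrict (tube E s)) A =
      volume (nearest E ⁻¹' A ∩ tube E s) := fun A hA => by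
    rw [Measure.map_apply_of_aemeasurable hnm hA, Measure.restrict_apply' isOpen_tube.measurableSet]
  have e2 : ∀ A, MeasurableSet A →
      (κ • ((μH[(n : ℝ) - 1]).restrict (frontier E)).withDensity (steinerWeight n K s)) A =
      κ * ∫⁻ q in A ∩ frontier E, steinerWeight n K s q ∂μH[(n : ℝ) - 1] := fun A hA => by
    rw [Measure.smul_apply, withDensity_apply _ hA, Measure.restrict_restrict hA, smul_eq_mul]
  have hFm : MeasurableSet (frontier E)ᶜ := hF.isClosed.measurableSet.compl
  refine Measure.ext fun A hA => le_antisymm ?_ ?_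
  · refine ENNReal.le_of_forall_sq_mul fun η hη => measure_le_of_local hF ?_ (fun p hp => ?_) hA
    · rw [e1 _ hFm]
      convert measure_empty (μ := (volume : Measure (En n))) using 2
      exact eq_empty_of_forall_notMem fun y hy => hy.1 (nearest_mem_frontier hE hy.2)
    · obtain ⟨O, h1, h2, h3⟩ := exists_isOpen_measure_tube_le hn hE hR hN hK hp hs hκ hη
      refine ⟨O, h1, h2, fun A hA hAm => ?_⟩
      rw [e1 _ hAm, e2 _ hAm]
      exact (h3 A hA hAm).1
  · refine ENNReal.le_of_forall_sq_mul fun η hη => measure_le_of_local hF ?_ (fun p hp => ?_) hA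
    · rw [e2 _ hFm, compl_inter_self]
      simp
    · obtain ⟨O, h1, h2, h3⟩ := exists_isOpen_measure_tube_le hn hE hR hN hK hp hs hκ hη
      refine ⟨O, h1, h2, fun A hA hAm => ?_⟩
      rw [e1 _ hAm, e2 _ hAm]
      exact (h3 A hA hAm).2

lemma exists_isOpen_aemeasurable_steinerPoly (hn : 2 ≤ n) (hE : IsClosed E) (hR : 0 < R)
    (hN : ∀ q ∈ frontier E, ∃ ν, IsOuterNormal R E q ν) (hK : IsCurvFuns n E K) {p : En n}
    (hp : p ∈ frontier E) {s₀ : ℝ} (hs₀ : ∀ T : En (n - 1) →L[ℝ] En (n - 1), ‖T‖ ≤ 16 / R →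
      ∀ t ∈ Icc 0 s₀, (1 - t • T).det ∈ Icc (1 / 2 : ℝ) 2) :
    ∃ O, IsOpen O ∧ p ∈ O ∧
      (∀ t, AEMeasurable (fun q => steinerPoly n K q t)
        ((μH[(n : ℝ) - 1]).restrict (O ∩ frontier E))) ∧
      ∀ᵐ q ∂(μH[(n : ℝ) - 1]).restrict (O ∩ frontier E), ∀ t ∈ Icc 0 s₀,
        steinerPoly n K q t ∈ Icc (1 / 2 : ℝ) 2 := by
  have : Fact (2 ≤ n) := ⟨hn⟩
  have hd0 : (0 : ℝ) ≤ (n : ℝ) - 1 := by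
    have : (2 : ℝ) ≤ n := by exact_mod_cast hn
    linarith
  obtain ⟨ν, hν⟩ := hN p hp
  obtain ⟨U, rfl⟩ := (stdFrame hn).exists_map_e_eq hν.norm_eq
  obtain ⟨f, hf⟩ := exists_isChart _ hR hE hN hν
  set fr := (stdFrame hn).map U
  have hδ : 0 < R / 16 := by positivity
  have hae := hf.ae_eq_graphPt hR hδ le_rfl hd0
  have hPc : Continuous fun q : En n => fr.P (q - p) := by fun_prop
  refine ⟨fr.cyl R p (R / 16), fr.isOpen_cyl, fr.mem_cyl_self hR hδ, fun t => ?_, ?_⟩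
  · have h1 : Measurable fun q => (1 - t • weingarten (gradient f) (fr.P (q - p))).det :=
      (measurable_det_one_sub (gradient f)).comp (hPc.measurable.prodMk measurable_const)
    refine ⟨_, h1, ?_⟩
    filter_upwards [hae] with q ⟨hq1, hq2, hq3⟩
    rw [hf.det_eq_steinerPoly hR hK hq1 hq2, ← hq3]
  · filter_upwards [hae] with q ⟨hq1, hq2, hq3⟩ t ht
    rw [hq3, ← hf.det_eq_steinerPoly hR hK hq1 hq2]
    exact hs₀ _ (hf.norm_weingarten_le hR hq1 hq2) t ht

lemma aemeasurable_steinerPoly (hn : 2 ≤ n) (hE : IsClosed E) (hF : IsCompact (frontier E))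
    (hR : 0 < R) (hN : ∀ q ∈ frontier E, ∃ ν, IsOuterNormal R E q ν) (hK : IsCurvFuns n E K)
    {s₀ : ℝ} (hs₀ : ∀ T : En (n - 1) →L[ℝ] En (n - 1), ‖T‖ ≤ 16 / R →
      ∀ t ∈ Icc 0 s₀, (1 - t • T).det ∈ Icc (1 / 2 : ℝ) 2) :
    (∀ t, AEMeasurable (fun q => steinerPoly n K q t)
      ((μH[(n : ℝ) - 1]).restrict (frontier E))) ∧
    ∀ᵐ q ∂(μH[(n : ℝ) - 1]).restrict (frontier E), ∀ t ∈ Icc 0 s₀,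
      steinerPoly n K q t ∈ Icc (1 / 2 : ℝ) 2 := by
  obtain ⟨O, -, hFO, hO⟩ := hF.exists_isOpen_of_local
    (P := fun O => (∀ t, AEMeasurable (fun q => steinerPoly n K q t)
        ((μH[(n : ℝ) - 1]).restrict (O ∩ frontier E))) ∧
      ∀ᵐ q ∂(μH[(n : ℝ) - 1]).restrict (O ∩ frontier E), ∀ t ∈ Icc 0 s₀,
        steinerPoly n K q t ∈ Icc (1 / 2 : ℝ) 2)
    (by simp) (fun O O' hO hO' h h' => by
      rw [union_inter_distrib_right]
      exact ⟨fun t => aemeasurable_union_iff.2 ⟨h.1 t, h'.1 t⟩,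
        (ae_restrict_union_iff _ _ _).2 ⟨h.2, h'.2⟩⟩)
    (fun p hp => exists_isOpen_aemeasurable_steinerPoly hn hE hR hN hK hp hs₀)
  rwa [inter_eq_right.2 hFO] at hO

/-- The integral of the Steiner polynomial. -/
def steinerInt (n : ℕ) (K : ℕ → En n → ℝ) (s : ℝ) (q : En n) : ℝ :=
  ∑ p ∈ Finset.range n, steinerCoeff n p * extCurv K p q * (s ^ (p + 1) / (p + 1))

lemma integral_steinerPoly_eq {q : En n} (hs : 0 < s) :
    ∫ t in Ioo 0 s, steinerPoly n K q t = steinerInt n K s q := by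
  rw [← integral_Ioc_eq_integral_Ioo, ← intervalIntegral.integral_of_le hs.le]
  simp only [steinerPoly, steinerInt]
  rw [intervalIntegral.integral_finsetSum fun i _ =>
    Continuous.intervalIntegrable (by fun_prop) _ _]
  refine Finset.sum_congr rfl fun i _ => ?_
  rw [intervalIntegral.integral_const_mul, integral_pow]
  simp

lemma steinerWeight_eq {q : En n} (hs : 0 < s) (h : ∀ t ∈ Icc 0 s, 0 ≤ steinerPoly n K q t) :
    steinerWeight n K s q = ENNReal.ofReal (steinerInt n K s q) := by
  have hc : Continuous (steinerPoly n K q) := by unfold steinerPoly; fun_prop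
  have hae : ∀ᵐ t ∂volume.restrict (Ioo 0 s), 0 ≤ steinerPoly n K q t := by
    filter_upwards [ae_restrict_mem measurableSet_Ioo] with t ht
    exact h t (Ioo_subset_Icc_self ht)
  rw [← integral_steinerPoly_eq hs, ofReal_integral_eq_lintegral_ofReal
    ((hc.integrableOn_Icc).mono_set Ioo_subset_Icc_self) hae, steinerWeight]
  refine lintegral_congr_ae ?_
  filter_upwards [hae] with t ht
  rw [abs_of_nonneg ht]

end GlobalSteiner

open scoped BoundedContinuousFunction symmDiff

section SteinerFormula

variable {n : ℕ}

/-- The Steiner formula for the outer tubes of `E`, together with bounds for the curvatures. -/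
structure HasSteinerFormula (n : ℕ) (κ s₀ C : ℝ) (E : Set (En n)) (K : ℕ → En n → ℝ) : Prop where
  aemeasurable : ∀ p < n, AEMeasurable (extCurv K p) ((μH[(n : ℝ) - 1]).restrict (frontier E))
  abs_le : ∀ᵐ q ∂(μH[(n : ℝ) - 1]).restrict (frontier E), ∀ p < n, |extCurv K p q| ≤ C
  measure_lt_top : (μH[(n : ℝ) - 1] : Measure (En n)) (frontier E) < ∞
  integral_tube : ∀ s ∈ Ioc 0 s₀, ∀ ψ : En n →ᵇ ℝ,
    ∫ y in tube E s, ψ (nearest E y) =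
      κ * ∫ q in frontier E, ψ q * steinerInt n K s q ∂μH[(n : ℝ) - 1]

lemma volume_tube_lt_top {E : Set (En n)} (hE : Bornology.IsBounded E) (s : ℝ) :
    volume (tube E s) < ∞ := by
  refine (measure_mono fun y hy => ?_).trans_lt (hE.thickening (δ := s)).measure_lt_top
  rw [mem_thickening_iff_infDist_lt (nonempty_of_mem_tube hy)]
  exact hy.2

theorem exists_hasSteinerFormula (hn : 2 ≤ n) {R : ℝ} (hR : 0 < R) :
    ∃ κ s₀ C : ℝ, 0 < κ ∧ 0 < s₀ ∧ s₀ < R ∧ ∀ E ∈ UR n R, ∀ K, IsCurvFuns n E K →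
      HasSteinerFormula n κ s₀ C E K := by
  obtain ⟨κ, hκ0, hκt, hκ⟩ := exists_volume_eq_smul_map_coord hn
  obtain ⟨s₁, hs₁, hdet⟩ := exists_det_one_sub_mem (En (n - 1)) (16 / R)
  set s₀ := min s₁ (R / 2) with hs₀def
  have hs₀ : 0 < s₀ := lt_min hs₁ (by positivity)
  have hs₀R : s₀ < R := (min_le_right _ _).trans_lt (by linarith)
  have hn0 : (0 : ℝ) < n := by exact_mod_cast (by omega : 0 < n)
  have hdet' : ∀ T : En (n - 1) →L[ℝ] En (n - 1), ‖T‖ ≤ 16 / R →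
      ∀ t ∈ Icc 0 s₀, (1 - t • T).det ∈ Icc (1 / 2 : ℝ) 2 := fun T hT t ht =>
    hdet T hT t ⟨ht.1, ht.2.trans (min_le_left _ _)⟩
  set τ : Fin n → ℝ := fun i => s₀ * ((i + 1) / n) with hτ
  have hτinj : Function.Injective τ := fun i j hij => by
    have h1 := mul_left_cancel₀ hs₀.ne' hij
    have h2 := (div_left_inj' hn0.ne').1 h1
    exact Fin.ext (by exact_mod_cast add_right_cancel h2)
  have hτm : ∀ i, τ i ∈ Icc 0 s₀ := fun i => by
    have : (i : ℝ) + 1 ≤ n := by exact_mod_cast i.2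
    refine ⟨by positivity, mul_le_of_le_one_right hs₀.le ?_⟩
    rwa [div_le_one hn0]
  obtain ⟨c, hc⟩ := exists_coeff_eq_sum_eval hτinj
  have hext : ∀ K : ℕ → En n → ℝ, ∀ p < n, extCurv K p =
      fun q => (∑ i, c p i * steinerPoly n K q (τ i)) / steinerCoeff n p := by
    intro K p hp
    funext q
    have := hc (fun p => steinerCoeff n p * extCurv K p q) p hp
    rw [eq_div_iff (steinerCoeff_ne_zero hp), mul_comm]
    exact this
  set C : ℝ := ∑ p ∈ Finset.range n, (∑ i, |c p i| * 2) / |steinerCoeff n p| with hC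
  refine ⟨κ.toReal, s₀, C, ENNReal.toReal_pos hκ0 hκt, hs₀, hs₀R, fun E hE K hK => ?_⟩
  have hF : IsCompact (frontier E) :=
    isCompact_of_isClosed_isBounded isClosed_frontier
      (hE.2.1.subset hE.1.frontier_subset)
  have hN : ∀ q ∈ frontier E, ∃ ν, IsOuterNormal R E q ν := fun q hq =>
    sphereCond.exists_isOuterNormal hR hE.2.2 hq
  obtain ⟨hm, hae⟩ := aemeasurable_steinerPoly hn hE.1 hF hR hN hK hdet'
  have hmext : ∀ p < n, AEMeasurable (extCurv K p)
      ((μH[(n : ℝ) - 1]).restrict (frontier E)) := fun p hp => by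
    rw [hext K p hp]
    exact (Finset.aemeasurable_fun_sum _ fun i _ => (hm (τ i)).const_mul _).div_const _
  have hw : ∀ s ∈ Ioc 0 s₀, steinerWeight n K s =ᵐ[(μH[(n : ℝ) - 1]).restrict (frontier E)]
      fun q => ENNReal.ofReal (steinerInt n K s q) := fun s hs => by
    filter_upwards [hae] with q hq
    exact steinerWeight_eq hs.1 fun t ht => by
      linarith [(hq t ⟨ht.1, ht.2.trans hs.2⟩).1]
  have hmap : ∀ s ∈ Ioc 0 s₀, _ := fun s hs =>
    map_nearest_tube hn hE.1 hF hR hN hK (hs.2.trans hs₀R.le) hκ (s := s)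
  have hnm : ∀ s ∈ Ioc 0 s₀, AEMeasurable (nearest E) (volume.restrict (tube E s)) := fun s hs =>
    (continuousOn_nearest hE.1 hR (hs.2.trans hs₀R.le) hN).aemeasurable isOpen_tube.measurableSet
  refine ⟨hmext, ?_, ?_, fun s hs ψ => ?_⟩
  · filter_upwards [hae] with q hq p hp
    rw [hext K p hp]
    simp only [abs_div]
    refine le_trans ?_ (Finset.single_le_sum (f := fun p => (∑ i, |c p i| * 2) / |steinerCoeff n p|)
      (fun p _ => by positivity) (Finset.mem_range.2 hp))
    gcongr
    refine (Finset.abs_sum_le_sum_abs _ _).trans (Finset.sum_le_sum fun i _ => ?_)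
    rw [abs_mul]
    gcongr
    have := hq (τ i) (hτm i)
    rw [abs_of_nonneg (by linarith [this.1])]
    exact this.2
  · have h1 := congrArg (fun m => m univ) (hmap s₀ ⟨hs₀, le_rfl⟩)
    simp only [Measure.smul_apply, withDensity_apply _ MeasurableSet.univ, Measure.restrict_univ,
      smul_eq_mul] at h1
    rw [Measure.map_apply_of_aemeasurable (hnm s₀ ⟨hs₀, le_rfl⟩) MeasurableSet.univ, preimage_univ,
      Measure.restrict_apply_univ] at h1
    have h2 : ∫⁻ q in frontier E, ENNReal.ofReal (s₀ / 2) ∂μH[(n : ℝ) - 1] ≤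
        ∫⁻ q in frontier E, steinerWeight n K s₀ q ∂μH[(n : ℝ) - 1] := by
      refine lintegral_mono_ae ?_
      filter_upwards [hae] with q hq
      calc ENNReal.ofReal (s₀ / 2) = ∫⁻ t in Ioo 0 s₀, ENNReal.ofReal (1 / 2) := by
            rw [setLIntegral_const, Real.volume_Ioo, ← ENNReal.ofReal_mul (by norm_num)]
            congr 1; ring
        _ ≤ _ := by
            refine setLIntegral_mono' measurableSet_Ioo fun t ht => ?_
            gcongr
            exact (hq t (Ioo_subset_Icc_self ht)).1.trans (le_abs_self _)
    rw [setLIntegral_const] at h2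
    have h3 : ∫⁻ q in frontier E, steinerWeight n K s₀ q ∂μH[(n : ℝ) - 1] < ∞ := by
      by_contra h
      rw [not_lt_top_iff.1 h, ENNReal.mul_top hκ0] at h1
      exact (volume_tube_lt_top hE.2.1 s₀).ne h1
    have h4 := h2.trans_lt h3
    by_contra h
    rw [not_lt_top_iff.1 h, ENNReal.mul_top (by simpa using hs₀)] at h4
    exact h4.ne rfl
  · have hmw : AEMeasurable (steinerWeight n K s) ((μH[(n : ℝ) - 1]).restrict (frontier E)) := by
      refine AEMeasurable.congr (f := fun q => ENNReal.ofReal (steinerInt n K s q)) ?_ (hw s hs).symm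
      unfold steinerInt
      exact (Finset.aemeasurable_fun_sum _ fun p hp =>
        ((hmext p (Finset.mem_range.1 hp)).const_mul _).mul_const _).ennreal_ofReal
    have h1 := integral_map (hnm s hs) (f := ψ) ψ.continuous.aestronglyMeasurable
    rw [← h1, hmap s hs, integral_smul_measure, smul_eq_mul,
      integral_withDensity_eq_integral_toReal_smul₀ hmw]
    · congr 1
      refine integral_congr_ae ?_
      filter_upwards [hw s hs, hae] with q hq hq2
      have : 0 ≤ steinerInt n K s q := by
        rw [← integral_steinerPoly_eq hs.1]
        refine setIntegral_nonneg measurableSet_Ioo fun t ht => ?_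
        linarith [(hq2 t ⟨ht.1.le, ht.2.le.trans hs.2⟩).1]
      rw [hq, ENNReal.toReal_ofReal this, smul_eq_mul, mul_comm]
    · filter_upwards [hw s hs] with q hq
      rw [hq]; exact ENNReal.ofReal_lt_top

end SteinerFormula

section Convergence

/-- A set with inner tangent balls contains a ball of fixed size near each of its points. -/
lemma exists_ball_subset_inter {V : Type*} [NormedAddCommGroup V] [InnerProductSpace ℝ V]
    {R ε : ℝ} {E : Set V} {y : V} (hE : IsClosed E) (hR : 0 < R)
    (hN : ∀ q ∈ frontier E, ∃ ν, IsOuterNormal R E q ν) (hy : y ∈ E) (hε : 0 < ε) :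
    ∃ z, ball z (min R (ε / 4)) ⊆ E ∩ ball y ε := by
  set ρ := min R (ε / 4) with hρ
  have hρR : ρ ≤ R := min_le_left _ _
  have hρε : ρ ≤ ε / 4 := min_le_right _ _
  have hρ0 : 0 < ρ := lt_min hR (by positivity)
  by_cases h : ∃ p ∈ frontier E, dist p y < ε / 2
  · obtain ⟨p, hp, hpy⟩ := h
    obtain ⟨ν, hν⟩ := hN p hp
    refine ⟨p - ρ • ν, subset_inter ?_ (ball_subset_ball' ?_)⟩
    · refine (ball_subset_ball' ?_).trans hν.inner_ball
      rw [dist_eq_norm, _root_.sub_sub_sub_cancel_left, ← sub_smul, norm_smul, hν.norm_eq,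
        Real.norm_of_nonneg (by linarith)]
      linarith
    · have h1 : dist (p - ρ • ν) p = ρ := by
        rw [dist_eq_norm, sub_sub_cancel_left, norm_neg, norm_smul, hν.norm_eq, mul_one,
          Real.norm_of_nonneg hρ0.le]
      linarith [dist_triangle (p - ρ • ν) p y]
  · push Not at h
    refine ⟨y, subset_inter ?_ (ball_subset_ball (by linarith))⟩
    have h1 : ball y (ε / 2) ⊆ interior E ∪ Eᶜ := fun z hz => by
      by_contra hc
      rw [mem_union, not_or, notMem_compl_iff] at hc
      exact (h z (hE.frontier_eq ▸ ⟨hc.2, hc.1⟩)).not_gt hz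
    have hyi : y ∈ interior E :=
      (h1 (mem_ball_self (by positivity))).resolve_right fun h => h hy
    refine (ball_subset_ball (by linarith)).trans
      (((convex_ball y (ε / 2)).isPreconnected.subset_left_of_subset_union isOpen_interior
        hE.isOpen_compl (disjoint_compl_right.mono_left interior_subset) h1
        ⟨y, mem_ball_self (by positivity), hyi⟩).trans interior_subset)

variable {n : ℕ} {R s : ℝ} {E : Set (En n)} {F : ℕ → Set (En n)}

lemma exists_isOuterNormal_of_mem_UR (hR : 0 < R) (hE : E ∈ UR n R) :
    ∀ q ∈ frontier E, ∃ ν, IsOuterNormal R E q ν := fun _ hq =>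
  sphereCond.exists_isOuterNormal hR hE.2.2 hq

lemma exists_dist_lt_of_volume_symmDiff_lt {F : Set (En n)} (hR : 0 < R) (hE : E ∈ UR n R) {ε : ℝ}
    (hε : 0 < ε) (h : volume (F ∆ E) < volume (ball (0 : En n) (min R (ε / 4)))) {y : En n}
    (hy : y ∈ E) : ∃ z ∈ F, dist z y < ε := by
  by_contra! hc
  obtain ⟨z, hz⟩ := exists_ball_subset_inter hE.1 hR (exists_isOuterNormal_of_mem_UR hR hE) hy hε
  refine h.not_ge ?_
  rw [← Measure.addHaar_ball_center volume z]
  exact measure_mono fun w hw => Or.inr ⟨(hz hw).1, fun hwF => (hc w hwF).not_gt (hz hw).2⟩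

lemma L1Conv.tendsto_volume_symmDiff (h : L1Conv F E) (hF : ∀ k, F k ∈ UR n R) (hE : E ∈ UR n R) :
    Tendsto (fun k => volume (F k ∆ E)) atTop (𝓝 0) := by
  have hm : ∀ k, MeasurableSet (F k ∆ E) := fun k =>
    (hF k).1.measurableSet.symmDiff hE.1.measurableSet
  have hlt : ∀ k, volume (F k ∆ E) ≠ ∞ := fun k =>
    (((hF k).2.1.union hE.2.1).subset symmDiff_subset_union).measure_lt_top.ne
  have h1 : ∀ k, ∫ x, |(F k).indicator (fun _ => (1 : ℝ)) x - E.indicator (fun _ => (1 : ℝ)) x| =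
      volume.real (F k ∆ E) := fun k => by
    rw [← integral_indicator_one (hm k)]
    congr 1
    funext x
    rw [← Set.apply_indicator_symmDiff abs_neg]
    by_cases hx : x ∈ F k ∆ E <;> simp [hx]
  unfold L1Conv at h
  simp_rw [h1] at h
  have h2 := ENNReal.tendsto_ofReal h
  simpa only [ofReal_measureReal (hlt _), ENNReal.ofReal_zero] using h2

/-- The distance functions converge uniformly. -/
lemma eventually_abs_infDist_sub_le (hR : 0 < R) (hF : ∀ k, F k ∈ UR n R) (hE : E ∈ UR n R)
    (hV : Tendsto (fun k => volume (F k ∆ E)) atTop (𝓝 0)) (hne : E.Nonempty) {ε : ℝ}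
    (hε : 0 < ε) :
    ∀ᶠ k in atTop, (F k).Nonempty ∧ ∀ y, |infDist y (F k) - infDist y E| ≤ ε := by
  have hpos : 0 < volume (ball (0 : En n) (min R (ε / 4))) :=
    measure_ball_pos _ _ (lt_min hR (by positivity))
  filter_upwards [hV.eventually_lt_const hpos] with k hk
  have h1 := fun y => exists_dist_lt_of_volume_symmDiff_lt (y := y) hR hE hε hk
  have h2 := fun y => exists_dist_lt_of_volume_symmDiff_lt (y := y) hR (hF k) hε
    (symmDiff_comm (F k) E ▸ hk)
  have hFne : (F k).Nonempty := by
    obtain ⟨y, hy⟩ := hne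
    obtain ⟨z, hz, -⟩ := h1 y hy
    exact ⟨z, hz⟩
  have key : ∀ {A B : Set (En n)}, IsClosed A → A.Nonempty →
      (∀ y ∈ A, ∃ z ∈ B, dist z y < ε) → ∀ y, infDist y B ≤ infDist y A + ε := by
    intro A B hA hAne hAB y
    obtain ⟨p, hp, hyp⟩ := hA.exists_infDist_eq_dist hAne y
    obtain ⟨z, hz, hzp⟩ := hAB p hp
    rw [hyp]
    have := infDist_le_dist_of_mem (x := y) hz
    have := dist_triangle_right y z p
    rw [dist_comm z p, dist_comm p z] at *
    linarith [dist_triangle y p z, dist_comm p z]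
  refine ⟨hFne, fun y => abs_sub_le_iff.2 ⟨?_, ?_⟩⟩
  · linarith [key hE.1 hne h1 y]
  · linarith [key (hF k).1 hFne h2 y]

lemma eventually_eq_empty (hR : 0 < R) (hF : ∀ k, F k ∈ UR n R) 
    (hV : Tendsto (fun k => volume (F k ∆ (∅ : Set (En n)))) atTop (𝓝 0)) :
    ∀ᶠ k in atTop, F k = ∅ := by
  have hpos : 0 < volume (ball (0 : En n) (min R (1 / 4))) :=
    measure_ball_pos _ _ (lt_min hR (by positivity))
  filter_upwards [hV.eventually_lt_const hpos] with k hk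
  refine eq_empty_of_forall_notMem fun y hy => ?_
  obtain ⟨z, hz, -⟩ := exists_dist_lt_of_volume_symmDiff_lt hR (hF k) one_pos
    (symmDiff_comm (F k) ∅ ▸ hk) hy
  exact hz

lemma aestronglyMeasurable_indicator_tube (hR : 0 < R) (hE : E ∈ UR n R) (hs : s ≤ R)
    (ψ : En n →ᵇ ℝ) :
    AEStronglyMeasurable ((tube E s).indicator fun y => ψ (nearest E y)) volume :=
  (aestronglyMeasurable_indicator_iff isOpen_tube.measurableSet).2
    ((ψ.continuous.comp_continuousOn (continuousOn_nearest hE.1 hR hs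
      (exists_isOuterNormal_of_mem_UR hR hE))).aestronglyMeasurable isOpen_tube.measurableSet)

lemma tendsto_integral_tube (hR : 0 < R) (hF : ∀ k, F k ∈ UR n R) (hE : E ∈ UR n R)
    (hV : Tendsto (fun k => volume (F k ∆ E)) atTop (𝓝 0)) (hs : s ≤ R)
    (hs0 : volume {y | infDist y E = s} = 0) (ψ : En n →ᵇ ℝ) :
    Tendsto (fun k => ∫ y in tube (F k) s, ψ (nearest (F k) y)) atTop
      (𝓝 (∫ y in tube E s, ψ (nearest E y))) := by
  rcases E.eq_empty_or_nonempty with rfl | hne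
  · refine tendsto_const_nhds.congr' ?_
    filter_upwards [eventually_eq_empty hR hF hV] with k hk
    rw [hk]
  have hd := fun ε hε => eventually_abs_infDist_sub_le (ε := ε) hR hF hE hV hne hε
  have hlim : ∀ y, Tendsto (fun k => infDist y (F k)) atTop (𝓝 (infDist y E)) := fun y =>
    Metric.tendsto_nhds.2 fun ε hε => by
      filter_upwards [hd (ε / 2) (by positivity)] with k hk
      rw [Real.dist_eq]
      linarith [hk.2 y]
  set f : Set (En n) → En n → ℝ := fun A => (tube A s).indicator fun y => ψ (nearest A y) with hf
  have hint : ∀ A : Set (En n), A ∈ UR n R → Integrable (f A) := fun A hA => by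
    refine Integrable.mono' (g := (tube A s).indicator fun _ => ‖ψ‖) ?_
      (aestronglyMeasurable_indicator_tube hR hA hs ψ) (ae_of_all _ fun y => ?_)
    · exact (integrable_indicator_iff isOpen_tube.measurableSet).2
        (integrableOn_const (volume_tube_lt_top hA.2.1 s).ne)
    · rw [norm_indicator_eq_indicator_norm]
      exact indicator_le_indicator (ψ.norm_coe_le_norm _)
  have hEm := hE.1.measurableSet
  have hsplit : ∀ A : Set (En n), A ∈ UR n R →
      ∫ y in tube A s, ψ (nearest A y) = (∫ y in E, f A y) + ∫ y in Eᶜ, f A y := fun A hA => by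
    rw [integral_add_compl hEm (hint A hA), hf, integral_indicator isOpen_tube.measurableSet]
  rw [hsplit E hE]
  simp_rw [fun k => hsplit (F k) (hF k)]
  refine Tendsto.add ?_ ?_
  · have h0 : ∫ y in E, f E y = 0 := setIntegral_eq_zero_of_forall_eq_zero fun y hy =>
      indicator_of_notMem (fun h => notMem_of_mem_tube h hy) _
    rw [h0]
    have hlt : ∀ k, volume (F k ∆ E) ≠ ∞ := fun k =>
      (((hF k).2.1.union hE.2.1).subset symmDiff_subset_union).measure_lt_top.ne
    have hV' : Tendsto (fun k => ‖ψ‖ * volume.real (F k ∆ E)) atTop (𝓝 0) := by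
      simpa [measureReal_def] using ((ENNReal.tendsto_toReal zero_ne_top).comp hV).const_mul ‖ψ‖
    refine squeeze_zero_norm (fun k => ?_) hV'
    have hEk : MeasurableSet (E \ F k) := hEm.diff (hF k).1.measurableSet
    have h1 : ∫ y in E, f (F k) y = ∫ y in E \ F k, f (F k) y := by
      rw [← setIntegral_eq_of_subset_of_forall_sdiff_eq_zero hEm sdiff_subset fun y hy => ?_]
      refine indicator_of_notMem (fun h => notMem_of_mem_tube h ?_) _
      by_contra hc
      exact hy.2 ⟨hy.1, hc⟩
    have hsub : E \ F k ⊆ F k ∆ E := fun y hy => Or.inr hy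
    rw [h1]
    refine (norm_setIntegral_le_of_norm_le_const
      ((measure_mono hsub).trans_lt (hlt k).lt_top) (C := ‖ψ‖) fun y _ => ?_).trans ?_
    · rw [hf, norm_indicator_eq_indicator_norm]
      exact indicator_apply_le' (fun _ => ψ.norm_coe_le_norm _) fun _ => norm_nonneg _
    · gcongr
      exact hlt k
  · refine tendsto_integral_filter_of_dominated_convergence
      ((thickening (s + 1) E).indicator fun _ => ‖ψ‖) ?_ ?_ ?_ ?_
    · exact Eventually.of_forall fun k =>
        (aestronglyMeasurable_indicator_tube hR (hF k) hs ψ).restrict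
    · filter_upwards [hd 1 one_pos] with k hk
      refine ae_of_all _ fun y => ?_
      by_cases hy : y ∈ tube (F k) s
      · have hyE : y ∈ thickening (s + 1) E := by
          rw [mem_thickening_iff_infDist_lt hne]
          linarith [hy.2, (abs_sub_le_iff.1 (hk.2 y)).2]
        rw [hf, norm_indicator_eq_indicator_norm, indicator_of_mem hy, indicator_of_mem hyE]
        exact ψ.norm_coe_le_norm _
      · rw [hf, norm_indicator_eq_indicator_norm, indicator_of_notMem hy]
        exact indicator_nonneg (fun _ _ => norm_nonneg _) _
    · exact ((integrable_indicator_iff isOpen_thickening.measurableSet).2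
        (integrableOn_const hE.2.1.thickening.measure_lt_top.ne)).restrict
    · have hs0' : ∀ᵐ y : En n, infDist y E ≠ s := by simpa [ae_iff] using hs0
      filter_upwards [ae_restrict_of_ae hs0', ae_restrict_mem hEm.compl] with y hys hyE
      have hpos : 0 < infDist y E := (hE.1.notMem_iff_infDist_pos hne).1 hyE
      rcases hys.lt_or_gt with hlt | hgt
      · have hy : y ∈ tube E s := ⟨hpos, hlt⟩
        have hyk : ∀ᶠ k in atTop, y ∈ tube (F k) s :=
          ((hlim y).eventually_const_lt hpos).and ((hlim y).eventually_lt_const hlt)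
        have hn : Tendsto (fun k => nearest (F k) y) atTop (𝓝 (nearest E y)) := by
          refine tendsto_nearest_of_tendsto hE.1 hR hs (exists_isOuterNormal_of_mem_UR hR hE) hy
            (Metric.tendsto_nhds.2 fun ε hε => ?_) ((hlim y).congr' ?_)
          · filter_upwards [hd (ε / 2) (by positivity)] with k hk
            have h1 := hk.2 (nearest (F k) y)
            rw [infDist_zero_of_mem (nearest_spec (hF k).1 hk.1 y).1, zero_sub, abs_neg] at h1
            rw [Real.dist_eq, sub_zero]
            linarith
          · filter_upwards [hd 1 one_pos] with k hk
            exact (nearest_spec (hF k).1 hk.1 y).2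
        have h2 := (ψ.continuous.tendsto _).comp hn
        rw [hf]
        dsimp only
        rw [indicator_of_mem hy]
        refine h2.congr' ?_
        filter_upwards [hyk] with k hk
        rw [indicator_of_mem hk]; rfl
      · rw [hf]
        dsimp only
        rw [indicator_of_notMem fun h => h.2.not_gt hgt]
        refine tendsto_const_nhds.congr' ?_
        filter_upwards [(hlim y).eventually_const_lt hgt] with k hk
        rw [indicator_of_notMem fun h => h.2.not_gt hk]

end Convergence

section WeakConvergence

variable {n : ℕ} {R κ s₀ C : ℝ} {E : Set (En n)} {K : ℕ → En n → ℝ}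

lemma HasSteinerFormula.isFiniteMeasure (h : HasSteinerFormula n κ s₀ C E K) :
    IsFiniteMeasure ((μH[(n : ℝ) - 1] : Measure (En n)).restrict (frontier E)) :=
  ⟨by rw [Measure.restrict_apply_univ]; exact h.measure_lt_top⟩

lemma HasSteinerFormula.integrable_extCurv (h : HasSteinerFormula n κ s₀ C E K) {p : ℕ}
    (hp : p < n) : IntegrableOn (extCurv K p) (frontier E) μH[(n : ℝ) - 1] := by
  have := h.isFiniteMeasure
  refine Integrable.of_bound (h.aemeasurable p hp).aestronglyMeasurable C ?_
  filter_upwards [h.abs_le] with q hq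
  exact hq p hp

lemma HasSteinerFormula.integrable_mul_extCurv (h : HasSteinerFormula n κ s₀ C E K) {p : ℕ}
    (hp : p < n) (ψ : En n →ᵇ ℝ) :
    IntegrableOn (fun q => ψ q * extCurv K p q) (frontier E) μH[(n : ℝ) - 1] :=
  (h.integrable_extCurv hp).bdd_mul ψ.continuous.aestronglyMeasurable
    (ae_of_all _ ψ.norm_coe_le_norm)

lemma HasSteinerFormula.sum_eq (h : HasSteinerFormula n κ s₀ C E K) (hκ : 0 < κ) {s : ℝ}
    (hs : s ∈ Ioc 0 s₀) (ψ : En n →ᵇ ℝ) :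
    ∑ p ∈ Finset.range n, (steinerCoeff n p / (p + 1) *
      ∫ q in frontier E, ψ q * extCurv K p q ∂μH[(n : ℝ) - 1]) * s ^ p =
        (κ * s)⁻¹ * ∫ y in tube E s, ψ (nearest E y) := by
  have hs0 : s ≠ 0 := hs.1.ne'
  rw [h.integral_tube s hs ψ]
  have h1 : ∀ q, ψ q * steinerInt n K s q = ∑ p ∈ Finset.range n,
      steinerCoeff n p * (s ^ (p + 1) / (p + 1)) * (ψ q * extCurv K p q) := fun q => by
    rw [steinerInt, Finset.mul_sum]
    exact Finset.sum_congr rfl fun p _ => by ring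
  simp_rw [h1]
  rw [integral_finsetSum _ fun p hp =>
    (h.integrable_mul_extCurv (Finset.mem_range.1 hp) ψ).const_mul _, Finset.mul_sum,
    Finset.mul_sum]
  refine Finset.sum_congr rfl fun p _ => ?_
  rw [integral_const_mul]
  field_simp
  ring

lemma exists_injective_volume_level_eq_zero (E : Set (En n)) (hs₀ : 0 < s₀) :
    ∃ s : Fin n → ℝ, Function.Injective s ∧
      ∀ i, s i ∈ Ioc 0 s₀ ∧ volume {y | infDist y E = s i} = 0 := by
  have hc : {t : ℝ | 0 < volume {y | infDist y E = t}}.Countable :=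
    Measure.countable_meas_level_set_pos (continuous_infDist_pt E).measurable
  have hinf : (Ioc 0 s₀ \ {t : ℝ | 0 < volume {y | infDist y E = t}}).Infinite := fun hfin =>
    (Cardinal.Real.Ioc_countable_iff.not.2 hs₀.not_ge) ((hfin.countable.union hc).mono
      fun t ht => by
        by_cases h : 0 < volume {y | infDist y E = t}
        · exact Or.inr h
        · exact Or.inl ⟨ht, h⟩)
  refine ⟨fun i => hinf.natEmbedding _ i,
    fun i j hij => Fin.ext ((hinf.natEmbedding _).injective (Subtype.ext hij)), fun i => ?_⟩
  have := (hinf.natEmbedding _ i).2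
  exact ⟨this.1, nonpos_iff_eq_zero.1 (not_lt.1 this.2)⟩

/-- The curvature measures converge weakly. -/
lemma tendsto_integral_mul_extCurv {F : ℕ → Set (En n)} {Kh : ℕ → ℕ → En n → ℝ} (hR : 0 < R)
    (hκ : 0 < κ) (hs₀ : 0 < s₀) (hs₀R : s₀ ≤ R) (hF : ∀ k, F k ∈ UR n R) (hE : E ∈ UR n R)
    (hV : Tendsto (fun k => volume (F k ∆ E)) atTop (𝓝 0))
    (hSF : ∀ k, HasSteinerFormula n κ s₀ C (F k) (Kh k)) (hSE : HasSteinerFormula n κ s₀ C E K)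
    {p : ℕ} (hp : p < n) (ψ : En n →ᵇ ℝ) :
    Tendsto (fun k => ∫ q in frontier (F k), ψ q * extCurv (Kh k) p q ∂μH[(n : ℝ) - 1]) atTop
      (𝓝 (∫ q in frontier E, ψ q * extCurv K p q ∂μH[(n : ℝ) - 1])) := by
  obtain ⟨s, hsi, hs⟩ := exists_injective_volume_level_eq_zero E hs₀
  obtain ⟨c, hc⟩ := exists_coeff_eq_sum_eval hsi
  have hne : steinerCoeff n p / ((p : ℝ) + 1) ≠ 0 :=
    div_ne_zero (steinerCoeff_ne_zero hp) (by positivity)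
  have key : ∀ {A : Set (En n)} {L : ℕ → En n → ℝ}, HasSteinerFormula n κ s₀ C A L →
      ∫ q in frontier A, ψ q * extCurv L p q ∂μH[(n : ℝ) - 1] =
        (steinerCoeff n p / (p + 1))⁻¹ *
          ∑ i, c p i * ((κ * s i)⁻¹ * ∫ y in tube A (s i), ψ (nearest A y)) := by
    intro A L hA
    have h1 := hc (fun p => steinerCoeff n p / (p + 1) *
      ∫ q in frontier A, ψ q * extCurv L p q ∂μH[(n : ℝ) - 1]) p hp
    simp only [hA.sum_eq hκ (hs _).1 ψ] at h1
    rw [← h1, inv_mul_cancel_left₀ hne]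
  rw [key hSE]
  simp_rw [fun k => key (hSF k)]
  exact (tendsto_finsetSum _ fun i _ => ((tendsto_integral_tube hR hF hE hV
    ((hs i).1.2.trans hs₀R) (hs i).2 ψ).const_mul _).const_mul _).const_mul _

end WeakConvergence

section ConvexSemicontinuity

/-- A convex function has a continuous choice of affine minorants that are almost exact. -/
lemma ConvexOn.exists_continuous_affine_minorant {W : Type*} [NormedAddCommGroup W]
    [InnerProductSpace ℝ W] [FiniteDimensional ℝ W] {φ : W → ℝ} (hφ : ConvexOn ℝ univ φ) {ε : ℝ}
    (hε : 0 < ε) : ∃ (a : W → W) (b : W → ℝ), Continuous a ∧ Continuous b ∧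
      (∀ y z, inner ℝ (a y) z + b y ≤ φ z) ∧ ∀ y, φ y - ε < inner ℝ (a y) y + b y := by
  have hc : Continuous φ := continuousOn_univ.1 (hφ.continuousOn isOpen_univ)
  have : ProperSpace W := FiniteDimensional.proper_real W
  let t : W → Set (W × ℝ) := fun y =>
    {x | (∀ z, inner ℝ x.1 z + x.2 ≤ φ z) ∧ φ y - ε < inner ℝ x.1 y + x.2}
  have ht : ∀ y, Convex ℝ (t y) := by
    rintro y ⟨a, b⟩ ⟨h1, h2⟩ ⟨a', b'⟩ ⟨h1', h2'⟩ α β hα hβ hαβ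
    have key : ∀ z, inner ℝ (α • a + β • a') z + (α * b + β * b') =
        α * (inner ℝ a z + b) + β * (inner ℝ a' z + b') := fun z => by
      rw [inner_add_left, real_inner_smul_left, real_inner_smul_left]; ring
    refine ⟨fun z => ?_, ?_⟩
    · change inner ℝ (α • a + β • a') z + (α * b + β * b') ≤ φ z
      rw [key]
      calc _ ≤ α * φ z + β * φ z :=
            add_le_add (mul_le_mul_of_nonneg_left (h1 z) hα) (mul_le_mul_of_nonneg_left (h1' z) hβ)
        _ = φ z := by rw [← add_mul, hαβ, one_mul]
    · change φ y - ε < inner ℝ (α • a + β • a') y + (α * b + β * b')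
      rw [key]
      exact (convex_Ioi (φ y - ε)) h2 h2' hα hβ hαβ
  obtain ⟨g, hg⟩ := exists_continuous_forall_mem_convex_of_local_const ht fun y => by
    obtain ⟨l, c, hl, hly⟩ := ConvexOn.exists_affine_le_of_lt (𝕜 := ℝ) (mem_univ y)
      (show φ y - ε / 2 < φ y by linarith) isClosed_univ
      (hc.lowerSemicontinuous.lowerSemicontinuousOn _) hφ
    refine ⟨((InnerProductSpace.toDual ℝ W).symm l, c), ?_⟩
    have h1 : ∀ᶠ z in 𝓝 y, φ z - ε < l z + c :=
      ContinuousAt.eventually_lt (by fun_prop) (by fun_prop) (by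
        simp only [RCLike.re_to_real] at hly; linarith)
    filter_upwards [h1] with z hz
    refine ⟨fun w => ?_, ?_⟩
    · rw [InnerProductSpace.toDual_symm_apply]
      exact hl ⟨w, mem_univ w⟩
    · rwa [InnerProductSpace.toDual_symm_apply]
  exact ⟨fun y => (g y).1, fun y => (g y).2, by fun_prop, by fun_prop, fun y => (hg y).1,
    fun y => (hg y).2⟩

lemma exists_continuous_retraction_closedBall {W : Type*} [NormedAddCommGroup W]
    [NormedSpace ℝ W] {M : ℝ} (hM : 0 < M) :
    ∃ r : W → W, Continuous r ∧ (∀ y, ‖r y‖ ≤ M) ∧ ∀ y, ‖y‖ ≤ M → r y = y := by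
  have hpos : ∀ y : W, 0 < max M ‖y‖ := fun y => hM.trans_le (le_max_left _ _)
  refine ⟨fun y => (M / max M ‖y‖) • y, ?_, fun y => ?_, fun y hy => ?_⟩
  · exact (continuous_const.div (continuous_const.max continuous_norm)
      fun y => (hpos y).ne').smul continuous_id
  · rw [norm_smul, Real.norm_of_nonneg (div_nonneg hM.le (hpos y).le), div_mul_eq_mul_div,
      div_le_iff₀ (hpos y)]
    gcongr
    exact le_max_right _ _
  · simp only
    rw [max_eq_left hy, div_self hM.ne', one_smul]

lemma integrable_inner_add {X W : Type*} [MeasurableSpace X] [NormedAddCommGroup W]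
    [InnerProductSpace ℝ W] {μ : Measure X} [IsFiniteMeasure μ] {u α : X → W}
    {β : X → ℝ} {M A B : ℝ} (hu : AEStronglyMeasurable u μ) (huM : ∀ᵐ x ∂μ, ‖u x‖ ≤ M)
    (hα : AEStronglyMeasurable α μ) (hαA : ∀ᵐ x ∂μ, ‖α x‖ ≤ A) (hβ : AEStronglyMeasurable β μ)
    (hβB : ∀ᵐ x ∂μ, |β x| ≤ B) : Integrable (fun x => inner ℝ (α x) (u x) + β x) μ := by
  refine Integrable.of_bound ((hα.inner hu).add hβ) (A * M + B) ?_
  filter_upwards [huM, hαA, hβB] with x hx hA hB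
  refine (norm_add_le _ _).trans (add_le_add ((norm_inner_le_norm _ _).trans ?_) hB)
  exact mul_le_mul hA hx (norm_nonneg _) ((norm_nonneg _).trans hA)

variable {X : Type*} [PseudoMetricSpace X] [MeasurableSpace X] [BorelSpace X]

lemma exists_continuous_seq_tendsto_ae {W : Type*} [NormedAddCommGroup W] [NormedSpace ℝ W]
    {μ : Measure X} [IsFiniteMeasure μ] {u : X → W} {M : ℝ} (hM : 0 < M)
    (hu : AEStronglyMeasurable u μ) (huM : ∀ᵐ x ∂μ, ‖u x‖ ≤ M) :
    ∃ g : ℕ → X → W, (∀ j, Continuous (g j)) ∧ (∀ j x, ‖g j x‖ ≤ M) ∧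
      ∀ᵐ x ∂μ, Tendsto (fun j => g j x) atTop (𝓝 (u x)) := by
  obtain ⟨r, hrc, hrM, hr⟩ := exists_continuous_retraction_closedBall (W := W) hM
  have hmem : MemLp u 1 μ := MemLp.of_bound hu M huM
  choose g hg hg' using fun j : ℕ => hmem.exists_boundedContinuous_eLpNorm_sub_le one_ne_top
    (ε := ((j : ℝ≥0∞) + 1)⁻¹) (by simp)
  have hlim : Tendsto (fun j => eLpNorm ((g j : X → W) - u) 1 μ) atTop (𝓝 0) := by
    refine tendsto_of_tendsto_of_tendsto_of_le_of_le tendsto_const_nhds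
      (h := fun j : ℕ => ((j : ℝ≥0∞) + 1)⁻¹) ?_ (fun _ => zero_le) fun j => ?_
    · have := (tendsto_add_atTop_iff_nat 1).2 ENNReal.tendsto_inv_nat_nhds_zero
      simpa using this
    · rw [eLpNorm_sub_comm]; exact hg j
  obtain ⟨ns, -, hns⟩ := (tendstoInMeasure_of_tendsto_eLpNorm one_ne_zero
    (fun j => (hg' j).aestronglyMeasurable) hu hlim).exists_seq_tendsto_ae
  refine ⟨fun j x => r (g (ns j) x), fun j => hrc.comp (g (ns j)).continuous, fun j x => hrM _, ?_⟩
  filter_upwards [hns, huM] with x hx hxM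
  have := (hrc.tendsto (u x)).comp hx
  rwa [hr _ hxM] at this

variable {ι : Type*} [Fintype ι]

lemma integral_inner_add {μ : Measure X} [IsFiniteMeasure μ] {u : X → EuclideanSpace ℝ ι}
    {M : ℝ} (hu : AEStronglyMeasurable u μ) (huM : ∀ᵐ x ∂μ, ‖u x‖ ≤ M) (α : ι → X →ᵇ ℝ)
    (β : X →ᵇ ℝ) :
    ∫ x, inner ℝ (WithLp.toLp 2 fun i => α i x) (u x) + β x ∂μ =
      ∑ i, (∫ x, α i x * u x i ∂μ) + ∫ x, β x ∂μ := by
  have h1 : ∀ i, Integrable (fun x => α i x * u x i) μ := fun i => by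
    refine (Integrable.of_bound ((EuclideanSpace.proj (𝕜 := ℝ) i).continuous.comp_aestronglyMeasurable hu) M ?_).bdd_mul
      (α i).continuous.aestronglyMeasurable (ae_of_all _ (α i).norm_coe_le_norm)
    filter_upwards [huM] with x hx
    exact (PiLp.norm_apply_le _ _).trans hx
  have h2 : Integrable β μ := Integrable.of_bound β.continuous.aestronglyMeasurable ‖β‖
    (ae_of_all _ β.norm_coe_le_norm)
  rw [← integral_finsetSum _ fun i _ => h1 i,
    ← integral_add (integrable_finsetSum _ fun i _ => h1 i) h2]
  congr 1
  funext x
  rw [PiLp.inner_apply]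
  congr 1
  exact Finset.sum_congr rfl fun i _ => by simp [mul_comm]

/-- Lower semicontinuity of convex integral functionals under weak convergence of measures and of
vector-valued densities. -/
theorem ConvexOn.integral_comp_le_liminf {μ : Measure X} [IsFiniteMeasure μ] {μk : ℕ → Measure X}
    [∀ k, IsFiniteMeasure (μk k)] {φ : EuclideanSpace ℝ ι → ℝ} (hφ : ConvexOn ℝ univ φ)
    {u : X → EuclideanSpace ℝ ι} {uk : ℕ → X → EuclideanSpace ℝ ι} {M : ℝ} (hM : 0 < M)
    (hu : AEStronglyMeasurable u μ) (huM : ∀ᵐ x ∂μ, ‖u x‖ ≤ M)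
    (huk : ∀ k, AEStronglyMeasurable (uk k) (μk k)) (hukM : ∀ k, ∀ᵐ x ∂μk k, ‖uk k x‖ ≤ M)
    (h0 : ∀ ψ : X →ᵇ ℝ, Tendsto (fun k => ∫ x, ψ x ∂μk k) atTop (𝓝 (∫ x, ψ x ∂μ)))
    (h1 : ∀ (i : ι) (ψ : X →ᵇ ℝ), Tendsto (fun k => ∫ x, ψ x * uk k x i ∂μk k) atTop
      (𝓝 (∫ x, ψ x * u x i ∂μ))) :
    ∫ x, φ (u x) ∂μ ≤ liminf (fun k => ∫ x, φ (uk k x) ∂μk k) atTop := by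
  have hc : Continuous φ := continuousOn_univ.1 (hφ.continuousOn isOpen_univ)
  have hbound : ∀ {f : EuclideanSpace ℝ ι → ℝ},
      Continuous f → ∃ S, ∀ y, ‖y‖ ≤ M → |f y| ≤ S := fun hf => by
    obtain ⟨S, hS⟩ := (isCompact_closedBall (0 : EuclideanSpace ℝ ι) M).exists_bound_of_continuousOn
      hf.continuousOn
    exact ⟨S, fun y hy => hS y (mem_closedBall_zero_iff.2 hy)⟩
  obtain ⟨S, hS⟩ := hbound hc
  have hint : ∀ {ν : Measure X} [IsFiniteMeasure ν] {v : X → EuclideanSpace ℝ ι},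
      AEStronglyMeasurable v ν → (∀ᵐ x ∂ν, ‖v x‖ ≤ M) → Integrable (fun x => φ (v x)) ν :=
    fun hv hvM => Integrable.of_bound (hc.comp_aestronglyMeasurable hv) S
      (hvM.mono fun x hx => hS _ hx)
  have hmass : Tendsto (fun k => (μk k).real univ) atTop (𝓝 (μ.real univ)) := by
    simpa using h0 (BoundedContinuousFunction.const X 1)
  have hcob : IsCoboundedUnder (· ≥ ·) atTop fun k => ∫ x, φ (uk k x) ∂μk k := by
    refine IsBoundedUnder.isCoboundedUnder_ge ⟨S * (μ.real univ + 1), ?_⟩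
    rw [eventually_map]
    have hS0 : 0 ≤ S := (abs_nonneg _).trans (hS 0 (by simpa using hM.le))
    filter_upwards [hmass.eventually_le_const (lt_add_one _)] with k hk
    refine (Real.le_norm_self _).trans ((norm_integral_le_of_norm_le_const
      ((hukM k).mono fun x hx => hS _ hx)).trans ?_)
    gcongr
  refine le_of_forall_pos_sub_le fun δ hδ => le_liminf_of_le hcob ?_
  set m := μ.real univ with hm
  have hm0 : 0 ≤ m := measureReal_nonneg
  obtain ⟨a, b, ha, hb, hle, hlt⟩ := hφ.exists_continuous_affine_minorant
    (ε := δ / (2 * (m + 1))) (by positivity)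
  obtain ⟨A, hA⟩ := hbound ha.norm
  simp only [abs_norm] at hA
  obtain ⟨B, hB⟩ := hbound hb
  obtain ⟨g, hgc, hgM, hgu⟩ := exists_continuous_seq_tendsto_ae hM hu huM
  have hlim : Tendsto (fun j => ∫ x, inner ℝ (a (g j x)) (u x) + b (g j x) ∂μ) atTop
      (𝓝 (∫ x, inner ℝ (a (u x)) (u x) + b (u x) ∂μ)) := by
    refine tendsto_integral_of_dominated_convergence (fun _ => A * M + B) (fun j => ?_)
      (integrable_const _) (fun j => ?_) ?_
    · exact ((ha.comp (hgc j)).aestronglyMeasurable.inner hu).add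
        (hb.comp (hgc j)).aestronglyMeasurable
    · filter_upwards [huM] with x hx
      refine (norm_add_le _ _).trans (add_le_add ((norm_inner_le_norm _ _).trans ?_)
        (hB _ (hgM j x)))
      exact mul_le_mul (hA _ (hgM j x)) hx (norm_nonneg _)
        ((norm_nonneg _).trans (hA _ (hgM j x)))
    · filter_upwards [hgu] with x hx
      exact (((ha.tendsto _).comp hx).inner tendsto_const_nhds).add ((hb.tendsto _).comp hx)
  have hgt : ∫ x, φ (u x) ∂μ - δ < ∫ x, inner ℝ (a (u x)) (u x) + b (u x) ∂μ := by
    have h2 : ∫ x, φ (u x) - δ / (2 * (m + 1)) ∂μ ≤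
        ∫ x, inner ℝ (a (u x)) (u x) + b (u x) ∂μ :=
      integral_mono ((hint hu huM).sub (integrable_const _))
        (integrable_inner_add hu huM (ha.comp_aestronglyMeasurable hu)
          (huM.mono fun x hx => hA _ hx) (hb.comp_aestronglyMeasurable hu)
          (huM.mono fun x hx => hB _ hx)) fun x => (hlt _).le
    rw [integral_sub (hint hu huM) (integrable_const _), integral_const, smul_eq_mul] at h2
    have h3 : m * (δ / (2 * (m + 1))) < δ := by
      rw [mul_div_assoc', div_lt_iff₀ (by positivity)]
      nlinarith
    linarith
  obtain ⟨j, hj⟩ := (hlim.eventually_const_lt hgt).exists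
  let α : ι → X →ᵇ ℝ := fun i => BoundedContinuousFunction.ofNormedAddCommGroup
    (fun x => a (g j x) i) ((EuclideanSpace.proj (𝕜 := ℝ) i).continuous.comp (ha.comp (hgc j))) A
    fun x => (PiLp.norm_apply_le _ _).trans (hA _ (hgM j x))
  let β : X →ᵇ ℝ := BoundedContinuousFunction.ofNormedAddCommGroup (fun x => b (g j x))
    (hb.comp (hgc j)) B fun x => hB _ (hgM j x)
  have hconv : Tendsto (fun k => ∫ x, inner ℝ (a (g j x)) (uk k x) + b (g j x) ∂μk k) atTop
      (𝓝 (∫ x, inner ℝ (a (g j x)) (u x) + b (g j x) ∂μ)) := by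
    have h2 := (tendsto_finsetSum Finset.univ fun i _ => h1 i (α i)).add (h0 β)
    rw [← integral_inner_add hu huM α β] at h2
    simp_rw [fun k => (integral_inner_add (huk k) (hukM k) α β).symm] at h2
    exact h2
  filter_upwards [hconv.eventually_const_lt hj] with k hk
  refine hk.le.trans (integral_mono (integrable_inner_add (huk k) (hukM k)
    (ha.comp (hgc j)).aestronglyMeasurable (ae_of_all _ fun x => hA _ (hgM j x))
    (hb.comp (hgc j)).aestronglyMeasurable (ae_of_all _ fun x => hB _ (hgM j x)))
    (hint (huk k) (hukM k))
    fun x => hle _ _)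

end ConvexSemicontinuity

section CurvatureVector

variable {n : ℕ} {κ s₀ C : ℝ} {E : Set (En n)} {K : ℕ → En n → ℝ}

lemma KvecOf_apply (K : ℕ → En n → ℝ) (q : En n) (i : Fin (n - 1)) :
    KvecOf n K q i = extCurv K (i + 1) q := by
  simp [KvecOf, extCurv]

lemma HasSteinerFormula.aestronglyMeasurable_KvecOf (h : HasSteinerFormula n κ s₀ C E K) :
    AEStronglyMeasurable (KvecOf n K) ((μH[(n : ℝ) - 1]).restrict (frontier E)) := by
  have h1 : AEMeasurable (fun q => fun i : Fin (n - 1) => K ((i : ℕ) + 1) q)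
      ((μH[(n : ℝ) - 1]).restrict (frontier E)) := aemeasurable_pi_lambda _ fun i =>
    (h.aemeasurable (i + 1) (by omega)).congr (ae_of_all _ fun q => by simp [extCurv])
  exact (WithLp.measurable_toLp 2 _).comp_aemeasurable h1 |>.aestronglyMeasurable

lemma HasSteinerFormula.norm_KvecOf_le (h : HasSteinerFormula n κ s₀ C E K) :
    ∀ᵐ q ∂(μH[(n : ℝ) - 1]).restrict (frontier E), ‖KvecOf n K q‖ ≤ n * |C| + 1 := by
  filter_upwards [h.abs_le] with q hq
  have h1 : ‖KvecOf n K q‖ ≤ ∑ i, ‖KvecOf n K q i‖ := by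
    conv_lhs => rw [← (EuclideanSpace.basisFun (Fin (n - 1)) ℝ).sum_repr (KvecOf n K q)]
    refine (norm_sum_le _ _).trans_eq (Finset.sum_congr rfl fun i _ => ?_)
    rw [norm_smul, OrthonormalBasis.norm_eq_one, mul_one, EuclideanSpace.basisFun_repr]
  refine h1.trans ?_
  calc ∑ i, ‖KvecOf n K q i‖ ≤ ∑ _i : Fin (n - 1), |C| := Finset.sum_le_sum fun i _ => by
        rw [KvecOf_apply]
        exact (hq _ (by omega)).trans (le_abs_self C)
    _ = (n - 1 : ℕ) * |C| := by simp
    _ ≤ n * |C| := by gcongr; exact n.sub_le 1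
    _ ≤ _ := by linarith

end CurvatureVector

theorem curvature_integral_semicontinuity (n : ℕ) (hn : 2 ≤ n) (R : ℝ) (hR : 0 < R)
    (φ : En (n - 1) → ℝ) (hφ : ConvexOn ℝ univ φ)
    (E : Set (En n)) (hE : E ∈ UR n R)
    (Eh : ℕ → Set (En n)) (hEh : ∀ h, Eh h ∈ UR n R) (hL1 : L1Conv Eh E)
    (K : ℕ → En n → ℝ) (hK : IsCurvFuns n E K)
    (Kh : ℕ → ℕ → En n → ℝ) (hKh : ∀ h, IsCurvFuns n (Eh h) (Kh h)) :
    ∫ q in frontier E, φ (KvecOf n K q) ∂(μH[(n : ℝ) - 1])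
      ≤ liminf (fun h =>
          ∫ q in frontier (Eh h), φ (KvecOf n (Kh h) q) ∂(μH[(n : ℝ) - 1])) atTop := by
  obtain ⟨κ, s₀, C, hκ, hs₀, hs₀R, hS⟩ := exists_hasSteinerFormula hn hR
  have hSE := hS E hE K hK
  have hSh : ∀ h, HasSteinerFormula n κ s₀ C (Eh h) (Kh h) := fun h =>
    hS (Eh h) (hEh h) (Kh h) (hKh h)
  have hfin := hSE.isFiniteMeasure
  have hfinh : ∀ h, IsFiniteMeasure
      ((μH[(n : ℝ) - 1] : Measure (En n)).restrict (frontier (Eh h))) := fun h =>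
    (hSh h).isFiniteMeasure
  have hlim : ∀ p < n, ∀ ψ : En n →ᵇ ℝ, _ := fun p hp ψ =>
    tendsto_integral_mul_extCurv hR hκ hs₀ hs₀R.le hEh hE
      (hL1.tendsto_volume_symmDiff hEh hE) hSh hSE hp ψ
  refine hφ.integral_comp_le_liminf (M := n * |C| + 1) (by positivity)
    hSE.aestronglyMeasurable_KvecOf hSE.norm_KvecOf_le
    (fun h => (hSh h).aestronglyMeasurable_KvecOf) (fun h => (hSh h).norm_KvecOf_le)
    (fun ψ => ?_) fun i ψ => ?_
  · simpa [extCurv] using hlim 0 (by omega) ψ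
  · simpa only [KvecOf_apply] using hlim (i + 1) (by omega) ψ
end
end
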